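/- Let φ be a translation invariant continuous valuation on ℝⁿ that is simple, i.e., φ(K) = 0 whenever the convex body K has empty interior. Then there exists a constant c ∈ ℂ such that φ(K) + φ(−K) = 2c · λ(K) for every convex body K, where λ is the Lebesgue measure on ℝⁿ; moreover the odd part ψ(K) = (φ(K) − φ(−K))/2 is homogeneous of degree n−1, i.e., ψ(tK) = t^{n−1} ψ(K) for all t > 0 and all convex bodies K. -/

import Mathlib

open MeasureTheory Metric Filter Topology
open scoped Pointwise

/-- ℝⁿ as Euclidean space. -/
abbrev Rn (n : ℕ) := EuclideanSpace ℝ (Fin n)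

/-- A convex body: a nonempty compact convex subset of ℝⁿ. -/
def IsConvexBody {n : ℕ} (K : Set (Rn n)) : Prop :=
  K.Nonempty ∧ IsCompact K ∧ Convex ℝ K

/-- A translation invariant continuous valuation on the convex bodies of ℝⁿ. -/
structure TIValuation (n : ℕ) where
  /-- the value of the valuation on a convex body -/
  val : Set (Rn n) → ℂ
  continuity : ∀ (Ki : ℕ → Set (Rn n)) (K : Set (Rn n)), (∀ i, IsConvexBody (Ki i)) →
    IsConvexBody K → Tendsto (fun i => hausdorffDist (Ki i) K) atTop (𝓝 0) →
    Tendsto (fun i => val (Ki i)) atTop (𝓝 (val K))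
  translation_invariant : ∀ K : Set (Rn n), IsConvexBody K → ∀ x : Rn n,
    val ((fun y => y + x) '' K) = val K
  valuation : ∀ K L : Set (Rn n), IsConvexBody K → IsConvexBody L → IsConvexBody (K ∪ L) →
    val (K ∪ L) + val (K ∩ L) = val K + val L

/-- A translation invariant continuous valuation is homogeneous of degree `i`. -/
def TIValuation.Homogeneous {n : ℕ} (φ : TIValuation n) (i : ℕ) : Prop :=
  ∀ t : ℝ, 0 < t → ∀ K : Set (Rn n), IsConvexBody K → φ.val (t • K) = (t : ℂ) ^ i * φ.val K


namespace KS

/-! ### convex bodies -/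

theorem body_add {n : ℕ} {A B : Set (Rn n)} (hA : IsConvexBody A) (hB : IsConvexBody B) :
    IsConvexBody (A + B) :=
  ⟨hA.1.add hB.1, hA.2.1.add hB.2.1, hA.2.2.add hB.2.2⟩

theorem body_image {m n : ℕ} (f : Rn m →L[ℝ] Rn n) {A : Set (Rn m)} (hA : IsConvexBody A) :
    IsConvexBody (f '' A) :=
  ⟨hA.1.image _, hA.2.1.image f.continuous, hA.2.2.linear_image f.toLinearMap⟩

theorem body_smul {n : ℕ} (t : ℝ) {A : Set (Rn n)} (hA : IsConvexBody A) :
    IsConvexBody (t • A) :=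
  ⟨hA.1.smul_set, hA.2.1.smul t, hA.2.2.smul t⟩

theorem body_neg {n : ℕ} {A : Set (Rn n)} (hA : IsConvexBody A) :
    IsConvexBody (-A) :=
  ⟨hA.1.neg, hA.2.1.neg, hA.2.2.neg⟩

theorem body_singleton {n : ℕ} (x : Rn n) : IsConvexBody ({x} : Set (Rn n)) :=
  ⟨Set.singleton_nonempty x, isCompact_singleton, convex_singleton x⟩

theorem body_segment {n : ℕ} (x y : Rn n) : IsConvexBody (segment ℝ x y) := by
  refine ⟨⟨x, left_mem_segment ℝ x y⟩, ?_, convex_segment x y⟩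
  rw [segment_eq_image']
  exact isCompact_Icc.image (by fun_prop)

theorem body_hull {n : ℕ} {ι : Type*} [Finite ι] [Nonempty ι] (p : ι → Rn n) :
    IsConvexBody (convexHull ℝ (Set.range p)) := by
  refine ⟨(Set.range_nonempty p).convexHull, ?_, convex_convexHull ℝ _⟩
  exact (Set.finite_range p).isCompact_convexHull (𝕜 := ℝ)

theorem body_le {n : ℕ} {A : Set (Rn n)} (hA : IsConvexBody A) (a : Rn n →L[ℝ] ℝ) (c : ℝ)
    (h : (A ∩ {x | a x ≤ c}).Nonempty) : IsConvexBody (A ∩ {x | a x ≤ c}) :=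
  ⟨h, hA.2.1.inter_right (isClosed_le a.continuous continuous_const),
    hA.2.2.inter (convex_halfSpace_le a.toLinearMap.isLinear c)⟩

theorem body_ge {n : ℕ} {A : Set (Rn n)} (hA : IsConvexBody A) (a : Rn n →L[ℝ] ℝ) (c : ℝ)
    (h : (A ∩ {x | c ≤ a x}).Nonempty) : IsConvexBody (A ∩ {x | c ≤ a x}) :=
  ⟨h, hA.2.1.inter_right (isClosed_le continuous_const a.continuous),
    hA.2.2.inter (convex_halfSpace_ge a.toLinearMap.isLinear c)⟩

/-! ### flat sets -/

def Flat {n : ℕ} (K : Set (Rn n)) : Prop :=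
  ∃ a : Rn n →L[ℝ] ℝ, a ≠ 0 ∧ ∃ c : ℝ, ∀ x ∈ K, a x = c

theorem Flat.mono {n : ℕ} {K L : Set (Rn n)} (h : Flat L) (hKL : K ⊆ L) : Flat K := by
  obtain ⟨a, ha, c, hc⟩ := h
  exact ⟨a, ha, c, fun x hx => hc x (hKL hx)⟩

theorem flat_of_submodule {n : ℕ} {K : Set (Rn n)} (p : Rn n) (W : Submodule ℝ (Rn n))
    (hW : W ≠ ⊤) (h : ∀ x ∈ K, x - p ∈ W) : Flat K := by
  obtain ⟨f, hf, hfW⟩ := Submodule.exists_le_ker_of_lt_top W (lt_top_iff_ne_top.2 hW)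
  refine ⟨LinearMap.toContinuousLinearMap f, ?_, f p, ?_⟩
  · simpa using hf
  · intro x hx
    have := hfW (h x hx)
    simp only [LinearMap.mem_ker, map_sub] at this
    simpa using sub_eq_zero.1 this

theorem flat_of_finrank {n : ℕ} {K : Set (Rn n)} (p : Rn n) (W : Submodule ℝ (Rn n))
    (hW : Module.finrank ℝ W < n) (h : ∀ x ∈ K, x - p ∈ W) : Flat K := by
  refine flat_of_submodule p W ?_ h
  rintro rfl
  simp at hW

theorem Flat.exists_submodule {n : ℕ} {K : Set (Rn n)} (h : Flat K) :
    ∃ p : Rn n, ∃ W : Submodule ℝ (Rn n), Module.finrank ℝ W < n ∧ ∀ x ∈ K, x - p ∈ W := by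
  obtain ⟨a, ha, c, hc⟩ := h
  obtain ⟨v, hv⟩ : ∃ v, a v ≠ 0 := by
    by_contra hcon
    push Not at hcon
    exact ha (by ext v; simpa using hcon v)
  refine ⟨(c / a v) • v, LinearMap.ker a.toLinearMap, ?_, ?_⟩
  · have h1 : LinearMap.ker a.toLinearMap < ⊤ := by
      rw [lt_top_iff_ne_top]
      intro h
      have : v ∈ LinearMap.ker a.toLinearMap := by rw [h]; trivial
      exact hv (by simpa using this)
    have := Submodule.finrank_lt_finrank_of_lt h1
    simpa using this
  · intro x hx
    simp [hc x hx, hv]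

theorem flat_iff {n : ℕ} {K : Set (Rn n)} (hK : IsConvexBody K) : interior K = ∅ ↔ Flat K := by
  constructor
  · intro h
    have h1 : affineSpan ℝ K ≠ ⊤ := by
      intro h2
      rw [← hK.2.2.interior_nonempty_iff_affineSpan_eq_top, h] at h2
      exact Set.not_nonempty_empty h2
    obtain ⟨p, hp⟩ := hK.1
    refine flat_of_submodule p (affineSpan ℝ K).direction ?_ ?_
    · intro h2
      exact h1 ((AffineSubspace.direction_eq_top_iff_of_nonempty
        ⟨p, subset_affineSpan ℝ K hp⟩).1 h2)
    · intro x hx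
      exact AffineSubspace.vsub_mem_direction (subset_affineSpan ℝ K hx)
        (subset_affineSpan ℝ K hp)
  · rintro ⟨a, ha, c, hc⟩
    by_contra hne
    obtain ⟨x, hx⟩ := Set.nonempty_iff_ne_empty.2 hne
    apply ha
    obtain ⟨r, hr, hball⟩ := Metric.isOpen_iff.1 isOpen_interior x hx
    ext v
    have hcont : Tendsto (fun s : ℝ => x + s • v) (𝓝[>] 0) (𝓝 x) := by
      have : Tendsto (fun s : ℝ => x + s • v) (𝓝 0) (𝓝 (x + (0:ℝ) • v)) :=
        Continuous.tendsto (by fun_prop) 0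
      simp only [zero_smul, add_zero] at this
      exact this.mono_left nhdsWithin_le_nhds
    have h1 := (hcont.eventually (Metric.ball_mem_nhds x hr)).and self_mem_nhdsWithin
    obtain ⟨s, hs, hs0⟩ := h1.exists
    have h2 := hc _ (interior_subset (hball hs))
    have h3 := hc _ (interior_subset hx)
    simp only [map_add, map_smul, smul_eq_mul, h3] at h2
    have hs0 : (0:ℝ) < s := hs0
    have : s * a v = 0 := by linarith
    simpa [hs0.ne'] using this

theorem flat_image {n : ℕ} {m : ℕ} (f : Rn m →L[ℝ] Rn n) {A : Set (Rn m)} (hA : Flat A)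
    (hmn : m ≤ n) : Flat (f '' A) := by
  obtain ⟨p, W, hW, h⟩ := hA.exists_submodule
  refine flat_of_finrank (f p) (W.map f.toLinearMap) ?_ ?_
  · exact lt_of_le_of_lt (Submodule.finrank_map_le _ _) (lt_of_lt_of_le hW hmn)
  · rintro _ ⟨x, hx, rfl⟩
    exact ⟨x - p, h x hx, by simp⟩

theorem flat_image_of_lt {n : ℕ} {m : ℕ} (f : Rn m →L[ℝ] Rn n) (A : Set (Rn m))
    (hmn : m < n) : Flat (f '' A) := by
  refine flat_of_finrank 0 (LinearMap.range f.toLinearMap) ?_ ?_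
  · refine lt_of_le_of_lt (LinearMap.finrank_range_le _) ?_
    simpa using hmn
  · rintro _ ⟨x, hx, rfl⟩
    simp

/-- sum of images: flat if `A` flat and `k + l ≤ n`. -/
theorem flat_add_image {n k l : ℕ} (f : Rn k →L[ℝ] Rn n) (g : Rn l →L[ℝ] Rn n)
    {A : Set (Rn k)} (B : Set (Rn l)) (hA : Flat A) (hkl : k + l ≤ n) :
    Flat (f '' A + g '' B) := by
  obtain ⟨p, W, hW, h⟩ := hA.exists_submodule
  refine flat_of_finrank (f p) (W.map f.toLinearMap ⊔ LinearMap.range g.toLinearMap) ?_ ?_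
  · have h1 := Submodule.finrank_add_le_finrank_add_finrank (W.map f.toLinearMap)
      (LinearMap.range g.toLinearMap)
    have h2 : Module.finrank ℝ (W.map f.toLinearMap) ≤ Module.finrank ℝ W :=
      Submodule.finrank_map_le _ _
    have h3 := LinearMap.finrank_range_le g.toLinearMap
    simp only [finrank_euclideanSpace, Fintype.card_fin] at h3
    omega
  · rintro _ ⟨_, ⟨x, hx, rfl⟩, _, ⟨y, hy, rfl⟩, rfl⟩
    have : f x + g y - f p = f (x - p) + g y := by simp; abel
    simp only [this]
    exact Submodule.add_mem_sup ⟨x - p, h x hx, rfl⟩ ⟨y, rfl⟩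

/-! ### Hausdorff distance -/

theorem exists_dist_le_hd {n : ℕ} {A B : Set (Rn n)} (hA : IsConvexBody A) (hB : IsConvexBody B)
    {x : Rn n} (hx : x ∈ A) : ∃ y ∈ B, dist x y ≤ hausdorffDist A B := by
  obtain ⟨y, hy, h⟩ := hB.2.1.exists_infDist_eq_dist hB.1 x
  refine ⟨y, hy, ?_⟩
  rw [← h]
  exact infDist_le_hausdorffDist_of_mem hx (hausdorffEDist_ne_top_of_nonempty_of_bounded
    hA.1 hB.1 hA.2.1.isBounded hB.2.1.isBounded)

theorem hd_le {n : ℕ} {A B : Set (Rn n)} {r : ℝ} (hr : 0 ≤ r)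
    (h1 : ∀ x ∈ A, ∃ y ∈ B, dist x y ≤ r) (h2 : ∀ x ∈ B, ∃ y ∈ A, dist x y ≤ r) :
    hausdorffDist A B ≤ r :=
  hausdorffDist_le_of_mem_dist hr h1 h2

theorem hd_image_add {m n : ℕ} (f : Rn m →L[ℝ] Rn n) {A A' : Set (Rn m)} (B : Set (Rn n))
    (hA : IsConvexBody A) (hA' : IsConvexBody A') :
    hausdorffDist (f '' A + B) (f '' A' + B) ≤ ‖f‖ * hausdorffDist A A' := by
  have key : ∀ A A' : Set (Rn m), IsConvexBody A → IsConvexBody A' →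
      ∀ x ∈ f '' A + B, ∃ y ∈ f '' A' + B, dist x y ≤ ‖f‖ * hausdorffDist A A' := by
    rintro A A' hA hA' _ ⟨_, ⟨a, ha, rfl⟩, b, hb, rfl⟩
    obtain ⟨a', ha', h⟩ := exists_dist_le_hd hA hA' ha
    refine ⟨f a' + b, ⟨_, ⟨a', ha', rfl⟩, b, hb, rfl⟩, ?_⟩
    simp only [dist_add_right]
    rw [dist_eq_norm, ← map_sub]
    refine (f.le_opNorm _).trans ?_
    rw [← dist_eq_norm]
    gcongr
  refine hd_le (mul_nonneg (norm_nonneg _) hausdorffDist_nonneg) (key A A' hA hA') ?_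
  rw [hausdorffDist_comm]
  exact key A' A hA' hA

/-- Convergence of bodies. -/
def Conv {n : ℕ} (Ki : ℕ → Set (Rn n)) (K : Set (Rn n)) : Prop :=
  Tendsto (fun i => hausdorffDist (Ki i) K) atTop (𝓝 0)

theorem Conv.of_le {n : ℕ} {Ki : ℕ → Set (Rn n)} {K : Set (Rn n)} {r : ℕ → ℝ}
    (h : ∀ i, hausdorffDist (Ki i) K ≤ r i) (hr : Tendsto r atTop (𝓝 0)) : Conv Ki K :=
  squeeze_zero (fun _ => hausdorffDist_nonneg) h hr

theorem Conv.image_add {m n : ℕ} {Ki : ℕ → Set (Rn m)} {K : Set (Rn m)} (f : Rn m →L[ℝ] Rn n)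
    (B : Set (Rn n)) (hKi : ∀ i, IsConvexBody (Ki i)) (hK : IsConvexBody K) (h : Conv Ki K) :
    Conv (fun i => f '' (Ki i) + B) (f '' K + B) := by
  refine Conv.of_le (fun i => hd_image_add f B (hKi i) hK) ?_
  have : Tendsto (fun i => ‖f‖ * hausdorffDist (Ki i) K) atTop (𝓝 (‖f‖ * 0)) := h.const_mul _
  simpa using this

theorem smul_eq_image {n : ℕ} (t : ℝ) (K : Set (Rn n)) :
    t • K = (t • ContinuousLinearMap.id ℝ (Rn n)) '' K := by
  ext x; simp [Set.mem_smul_set]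

theorem neg_eq_image {n : ℕ} (K : Set (Rn n)) :
    -K = (-ContinuousLinearMap.id ℝ (Rn n)) '' K := by
  ext x
  simp only [Set.mem_neg, ContinuousLinearMap.neg_apply, ContinuousLinearMap.id_apply,
    Set.mem_image]
  constructor
  · intro h; exact ⟨-x, h, by simp⟩
  · rintro ⟨y, hy, rfl⟩; simpa using hy

theorem image_id_add {n : ℕ} (K : Set (Rn n)) (B : Set (Rn n)) :
    (ContinuousLinearMap.id ℝ (Rn n)) '' K + B = K + B := by simp

theorem hd_smul_le {n : ℕ} {K : Set (Rn n)} {R : ℝ} (hR : ∀ x ∈ K, ‖x‖ ≤ R) 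
    (hK : IsConvexBody K) (s t : ℝ) :
    hausdorffDist (s • K) (t • K) ≤ |s - t| * R := by
  have hR0 : 0 ≤ R := by
    obtain ⟨x, hx⟩ := hK.1
    exact (norm_nonneg x).trans (hR x hx)
  refine hd_le (by positivity) ?_ ?_
  · rintro _ ⟨x, hx, rfl⟩
    refine ⟨t • x, ⟨x, hx, rfl⟩, ?_⟩
    simp only [dist_eq_norm, ← sub_smul, norm_smul, Real.norm_eq_abs]
    gcongr
    exact hR x hx
  · rintro _ ⟨x, hx, rfl⟩
    refine ⟨s • x, ⟨x, hx, rfl⟩, ?_⟩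
    simp only [dist_eq_norm, ← sub_smul, norm_smul, Real.norm_eq_abs]
    rw [abs_sub_comm]
    gcongr
    exact hR x hx

theorem body_bound {n : ℕ} {K : Set (Rn n)} (hK : IsConvexBody K) :
    ∃ R : ℝ, 0 < R ∧ ∀ x ∈ K, ‖x‖ ≤ R := by
  obtain ⟨R, hR⟩ := hK.2.1.isBounded.exists_norm_le
  exact ⟨max R 1, by positivity, fun x hx => (hR x hx).trans (le_max_left _ _)⟩

theorem Conv.smul {n : ℕ} {K : Set (Rn n)} (hK : IsConvexBody K) {s : ℕ → ℝ} {t : ℝ}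
    (h : Tendsto s atTop (𝓝 t)) : Conv (fun i => s i • K) (t • K) := by
  obtain ⟨R, hR0, hR⟩ := body_bound hK
  refine Conv.of_le (fun i => hd_smul_le hR hK (s i) t) ?_
  have h1 : Tendsto (fun i => |s i - t| * R) atTop (𝓝 (|t - t| * R)) :=
    ((h.sub_const t).abs).mul_const R
  simpa using h1

theorem Conv.add_left {n : ℕ} {Ki : ℕ → Set (Rn n)} {K : Set (Rn n)} 
    (B : Set (Rn n)) (hKi : ∀ i, IsConvexBody (Ki i)) (hK : IsConvexBody K) (h : Conv Ki K) :
    Conv (fun i => B + Ki i) (B + K) := by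
  have := h.image_add (ContinuousLinearMap.id ℝ (Rn n)) B hKi hK
  simpa [add_comm] using this

theorem add_singleton_eq {n : ℕ} (K : Set (Rn n)) (x : Rn n) :
    K + {x} = (fun y => y + x) '' K := by simp

theorem inter_add_of_union_convex {m : ℕ} {A A' : Set (Rn m)} (hA : IsConvexBody A)
    (hA' : IsConvexBody A') (hU : IsConvexBody (A ∪ A')) : ∀ a ∈ A, ∀ a' ∈ A', ∃ t : ℝ,
      0 ≤ t ∧ t ≤ 1 ∧ (1 - t) • a + t • a' ∈ A ∩ A' := by
  intro a ha a' ha'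
  -- connectedness of [0,1]
  let g : ℝ → Rn m := fun t => (1 - t) • a + t • a'
  have hg : Continuous g := by fun_prop
  have hsub : ∀ t ∈ Set.Icc (0:ℝ) 1, g t ∈ A ∪ A' := fun t ht =>
    hU.2.2 (Or.inl ha) (Or.inr ha') (by linarith [ht.2]) ht.1 (by ring)
  have hconn := (isPreconnected_closed_iff.1 (isPreconnected_Icc (a := (0:ℝ)) (b := 1)))
    (g ⁻¹' A) (g ⁻¹' A') (hA.2.1.isClosed.preimage hg) (hA'.2.1.isClosed.preimage hg)
    (fun t ht => hsub t ht) ⟨0, by simp, by simpa [g] using ha⟩ ⟨1, by simp, by simpa [g] using ha'⟩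
  obtain ⟨t, ht, h1, h2⟩ := hconn
  exact ⟨t, ht.1, ht.2, h1, h2⟩

theorem inter_add {m n : ℕ} (f : Rn m →L[ℝ] Rn n) {A A' : Set (Rn m)} {B : Set (Rn n)}
    (hA : IsConvexBody A) (hA' : IsConvexBody A') (hB : IsConvexBody B)
    (hU : IsConvexBody (A ∪ A')) :
    f '' (A ∩ A') + B = (f '' A + B) ∩ (f '' A' + B) := by
  apply Set.Subset.antisymm
  · rintro _ ⟨_, ⟨a, ha, rfl⟩, b, hb, rfl⟩
    exact ⟨⟨_, ⟨a, ha.1, rfl⟩, b, hb, rfl⟩, ⟨_, ⟨a, ha.2, rfl⟩, b, hb, rfl⟩⟩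
  · rintro x ⟨⟨_, ⟨a, ha, rfl⟩, b, hb, rfl⟩, ⟨_, ⟨a', ha', rfl⟩, b', hb', h⟩⟩
    obtain ⟨t, h0, h1, hmem⟩ := inter_add_of_union_convex hA hA' hU a ha a' ha'
    refine ⟨_, ⟨_, hmem, rfl⟩, (1 - t) • b + t • b', 
      hB.2.2 hb hb' (by linarith) h0 (by ring), ?_⟩
    simp only [map_add, map_smul] at h ⊢
    have : (1 - t) • f a + t • f a' + ((1 - t) • b + t • b')
        = (1 - t) • (f a + b) + t • (f a' + b') := by
      simp only [smul_add]; abel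
    rw [this, h, ← add_smul]
    simp

theorem body_inter_of_union {m : ℕ} {A A' : Set (Rn m)} (hA : IsConvexBody A)
    (hA' : IsConvexBody A') (hU : IsConvexBody (A ∪ A')) : IsConvexBody (A ∩ A') := by
  obtain ⟨a, ha⟩ := hA.1
  obtain ⟨a', ha'⟩ := hA'.1
  obtain ⟨t, _, _, h⟩ := inter_add_of_union_convex hA hA' hU a ha a' ha'
  exact ⟨⟨_, h⟩, hA.2.1.inter_right hA'.2.1.isClosed, hA.2.2.inter hA'.2.2⟩

/-! ### operations on valuations -/

noncomputable def pull {m n : ℕ} (φ : TIValuation n) (f : Rn m →L[ℝ] Rn n) (B : Set (Rn n))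
    (hB : IsConvexBody B) : TIValuation m where
  val A := φ.val (f '' A + B)
  continuity Ki K hKi hK h := φ.continuity _ _ (fun i => body_add (body_image f (hKi i)) hB)
    (body_add (body_image f hK) hB) (Conv.image_add f B hKi hK h)
  translation_invariant K hK x := by
    rw [← φ.translation_invariant (f '' K + B) (body_add (body_image f hK) hB) (f x)]
    congr 1
    rw [← add_singleton_eq, ← add_singleton_eq, Set.image_add, Set.image_singleton]
    abel
  valuation K L hK hL hU := by
    rw [inter_add f hK hL hB hU, ← φ.valuation _ _ (body_add (body_image f hK) hB)
      (body_add (body_image f hL) hB)]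
    · rw [Set.image_union, Set.union_add]
    · rw [← Set.union_add, ← Set.image_union]
      exact body_add (body_image f hU) hB

@[simp] theorem pull_val {m n : ℕ} (φ : TIValuation n) (f : Rn m →L[ℝ] Rn n) (B : Set (Rn n))
    (hB : IsConvexBody B) (A : Set (Rn m)) : (pull φ f B hB).val A = φ.val (f '' A + B) := rfl

/-- linear combination `a φ + b ψ + c`. -/
noncomputable def comb {n : ℕ} (a b c : ℂ) (φ ψ : TIValuation n) : TIValuation n where
  val A := a * φ.val A + b * ψ.val A + c
  continuity Ki K hKi hK h := 
    (((φ.continuity Ki K hKi hK h).const_mul a).add 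
      ((ψ.continuity Ki K hKi hK h).const_mul b)).add_const c
  translation_invariant K hK x := by
    rw [φ.translation_invariant K hK x, ψ.translation_invariant K hK x]
  valuation K L hK hL hU := by
    linear_combination a * φ.valuation K L hK hL hU + b * ψ.valuation K L hK hL hU

@[simp] theorem comb_val {n : ℕ} (a b c : ℂ) (φ ψ : TIValuation n) (A : Set (Rn n)) :
    (comb a b c φ ψ).val A = a * φ.val A + b * ψ.val A + c := rfl

/-- pull along a linear map (no Minkowski summand). -/
noncomputable def lpull {m n : ℕ} (φ : TIValuation n) (f : Rn m →L[ℝ] Rn n) : TIValuation m :=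
  pull φ f {0} (body_singleton 0)

@[simp] theorem lpull_val {m n : ℕ} (φ : TIValuation n) (f : Rn m →L[ℝ] Rn n)
    (A : Set (Rn m)) : (lpull φ f).val A = φ.val (f '' A) := by
  simp [lpull]

def Simple {n : ℕ} (φ : TIValuation n) : Prop :=
  ∀ K : Set (Rn n), IsConvexBody K → Flat K → φ.val K = 0

theorem val_add_singleton {n : ℕ} (φ : TIValuation n) {K : Set (Rn n)} (hK : IsConvexBody K)
    (x : Rn n) : φ.val (K + {x}) = φ.val K := by
  rw [add_singleton_eq]; exact φ.translation_invariant K hK x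

theorem val_singleton_add {n : ℕ} (φ : TIValuation n) {K : Set (Rn n)} (hK : IsConvexBody K)
    (x : Rn n) : φ.val ({x} + K) = φ.val K := by
  rw [add_comm, val_add_singleton φ hK]

theorem val_singleton {n : ℕ} (φ : TIValuation n) (x : Rn n) : φ.val {x} = φ.val {0} := by
  have := val_add_singleton φ (body_singleton (0 : Rn n)) x
  simpa using this

theorem Simple.lpull {n : ℕ} {φ : TIValuation n} (h : Simple φ) (f : Rn n →L[ℝ] Rn n) :
    Simple (lpull φ f) := by
  intro K hK hF
  rw [lpull_val]
  exact h _ (body_image f hK) (flat_image f hF le_rfl)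

theorem Simple.comb {n : ℕ} {φ ψ : TIValuation n} (h : Simple φ) (h' : Simple ψ) (a b : ℂ) :
    Simple (comb a b 0 φ ψ) := by
  intro K hK hF
  simp [h K hK hF, h' K hK hF]

end KS


namespace KS

/-! ### simplices -/

theorem mem_hull {n : ℕ} {ι : Type*} [Fintype ι] {p : ι → Rn n} {y : Rn n} :
    y ∈ convexHull ℝ (Set.range p) ↔
      ∃ w : ι → ℝ, (∀ i, 0 ≤ w i) ∧ ∑ i, w i = 1 ∧ ∑ i, w i • p i = y := by
  classical
  have h := LinearMap.image_convexHull (𝕜 := ℝ) (Fintype.linearCombination ℝ p)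
    (Set.range fun (i j : ι) => if i = j then (1:ℝ) else 0)
  rw [convexHull_basis_eq_stdSimplex, ← Set.range_comp] at h
  have h2 : (Fintype.linearCombination ℝ p ∘ fun (i j : ι) => if i = j then (1:ℝ) else 0) = p := by
    ext i : 1
    simp [Fintype.linearCombination_apply]
  rw [h2] at h
  rw [← h]
  constructor
  · rintro ⟨w, hw, rfl⟩
    exact ⟨w, hw.1, hw.2, by simp [Fintype.linearCombination_apply]⟩
  · rintro ⟨w, h1, h2, rfl⟩
    exact ⟨w, ⟨h1, h2⟩, by simp [Fintype.linearCombination_apply]⟩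

theorem flat_hull {n : ℕ} {p : Fin (n + 1) → Rn n} (h : ¬ AffineIndependent ℝ p) :
    Flat (convexHull ℝ (Set.range p)) := by
  rw [affineIndependent_iff_finrank_vectorSpan_eq ℝ p (n := n) (by simp)] at h
  refine flat_of_finrank (p 0) (vectorSpan ℝ (Set.range p)) ?_ ?_
  · refine lt_of_le_of_ne ?_ h
    have := Submodule.finrank_le (vectorSpan ℝ (Set.range p))
    simpa using this
  · intro x hx
    have h1 := convexHull_subset_affineSpan _ hx
    have h2 := AffineSubspace.vsub_mem_direction h1 
      (subset_affineSpan ℝ (Set.range p) (Set.mem_range_self 0))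
    rwa [direction_affineSpan] at h2

theorem exists_functional {n : ℕ} {p : Fin (n + 1) → Rn n} (h : AffineIndependent ℝ p)
    (w : Fin (n + 1) → ℝ) : ∃ a : Rn n →L[ℝ] ℝ, ∃ c : ℝ, ∀ i, a (p i) = w i + c := by
  classical
  have htop : affineSpan ℝ (Set.range p) = ⊤ := by
    rw [h.affineSpan_eq_top_iff_card_eq_finrank_add_one]
    simp
  let b : AffineBasis (Fin (n + 1)) ℝ (Rn n) := ⟨p, h, htop⟩
  let F : Rn n →ᵃ[ℝ] ℝ := ∑ i, w i • b.coord i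
  refine ⟨LinearMap.toContinuousLinearMap F.linear, - F 0, fun i => ?_⟩
  have h1 : F (p i) = F.linear (p i) + F 0 := by
    have := F.map_vadd 0 (p i)
    simpa using this
  have happ : ∀ x, F x = ∑ j, w j * b.coord j x := by
    intro x
    have : ∀ s : Finset (Fin (n+1)), (∑ i ∈ s, w i • b.coord i) x = ∑ j ∈ s, w j * b.coord j x := by
      intro s
      induction s using Finset.induction_on with
      | empty => simp
      | insert i s hi ih => rw [Finset.sum_insert hi, Finset.sum_insert hi]; simp [ih]
    exact this _
  have h2 : F (p i) = w i := by
    rw [happ]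
    have : ∀ j, b.coord j (p i) = if j = i then 1 else 0 := fun j => b.coord_apply j i
    simp [this]
  simp only [LinearMap.coe_toContinuousLinearMap']
  linarith

/-! ### cut functionals -/

structure Cut {n : ℕ} (f : Set (Rn n) → ℂ) : Prop where
  empty : f ∅ = 0
  flat : ∀ K, IsConvexBody K → Flat K → f K = 0
  cut : ∀ K, IsConvexBody K → ∀ a : Rn n →L[ℝ] ℝ, a ≠ 0 → ∀ c : ℝ,
    f K = f (K ∩ {x | a x ≤ c}) + f (K ∩ {x | c ≤ a x})

open Classical in
noncomputable def ext0 {n : ℕ} (φ : TIValuation n) (K : Set (Rn n)) : ℂ :=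
  if K.Nonempty then φ.val K else 0

theorem ext0_body {n : ℕ} (φ : TIValuation n) {K : Set (Rn n)} (h : IsConvexBody K) :
    ext0 φ K = φ.val K := by
  simp [ext0, h.1]

theorem ext0_empty {n : ℕ} (φ : TIValuation n) : ext0 φ ∅ = 0 := by simp [ext0]

theorem halves_union {n : ℕ} (K : Set (Rn n)) (a : Rn n →L[ℝ] ℝ) (c : ℝ) :
    (K ∩ {x | a x ≤ c}) ∪ (K ∩ {x | c ≤ a x}) = K := by
  rw [← Set.inter_union_distrib_left]
  apply Set.inter_eq_left.2
  intro x _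
  exact le_total (a x) c

theorem val_cut {n : ℕ} {φ : TIValuation n} (h : Simple φ) {K : Set (Rn n)}
    (hK : IsConvexBody K) {a : Rn n →L[ℝ] ℝ} (ha : a ≠ 0) {c : ℝ}
    (h1 : (K ∩ {x | a x ≤ c}).Nonempty) (h2 : (K ∩ {x | c ≤ a x}).Nonempty) :
    φ.val K = φ.val (K ∩ {x | a x ≤ c}) + φ.val (K ∩ {x | c ≤ a x}) := by
  have hb1 := body_le hK a c h1
  have hb2 := body_ge hK a c h2
  have hU := halves_union K a c
  have hbU : IsConvexBody ((K ∩ {x | a x ≤ c}) ∪ (K ∩ {x | c ≤ a x})) := by rwa [hU]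
  have h3 := φ.valuation _ _ hb1 hb2 hbU
  have h4 := body_inter_of_union hb1 hb2 hbU
  rw [hU, h _ h4 ⟨a, ha, c, ?_⟩] at h3
  · simpa using h3
  · rintro x ⟨⟨_, hx⟩, ⟨_, hx'⟩⟩
    exact le_antisymm hx hx'

theorem Simple.toCut {n : ℕ} {φ : TIValuation n} (h : Simple φ) : Cut (ext0 φ) where
  empty := by simp [ext0]
  flat K hK hF := by rw [ext0_body φ hK, h K hK hF]
  cut K hK a ha c := by
    by_cases h1 : (K ∩ {x | a x ≤ c}).Nonempty
    · by_cases h2 : (K ∩ {x | c ≤ a x}).Nonempty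
      · rw [ext0_body φ hK, ext0_body φ (body_le hK a c h1), ext0_body φ (body_ge hK a c h2)]
        exact val_cut h hK ha h1 h2
      · have := halves_union K a c
        rw [Set.not_nonempty_iff_eq_empty] at h2
        rw [h2, Set.union_empty] at this
        rw [h2, this, ext0_empty, add_zero]
    · have := halves_union K a c
      rw [Set.not_nonempty_iff_eq_empty] at h1
      rw [h1, Set.empty_union] at this
      rw [h1, this, ext0_empty, zero_add]

theorem Cut.restrict {n : ℕ} {f : Set (Rn n) → ℂ} (hf : Cut f) (a : Rn n →L[ℝ] ℝ) (c : ℝ) :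
    Cut (fun K => f (K ∩ {x | a x ≤ c})) where
  empty := by simp [hf.empty]
  flat K hK hF := by
    rcases Set.eq_empty_or_nonempty (K ∩ {x | a x ≤ c}) with h | h
    · simp only [h, hf.empty]
    · exact hf.flat _ (body_le hK a c h) (hF.mono Set.inter_subset_left)
  cut K hK b hb d := by
    rw [Set.inter_right_comm K {x | b x ≤ d}, Set.inter_right_comm K {x | d ≤ b x}]
    rcases Set.eq_empty_or_nonempty (K ∩ {x | a x ≤ c}) with h | h
    · simp only [h, hf.empty, Set.empty_inter, add_zero]
    · exact hf.cut _ (body_le hK a c h) b hb d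

theorem hull_update_subset {n : ℕ} {p : Fin (n + 1) → Rn n} {x : Rn n}
    (hx : x ∈ convexHull ℝ (Set.range p)) (j : Fin (n + 1)) :
    convexHull ℝ (Set.range (Function.update p j x)) ⊆ convexHull ℝ (Set.range p) := by
  apply convexHull_min _ (convex_convexHull ℝ _)
  rintro _ ⟨k, rfl⟩
  by_cases h : k = j
  · subst h; simpa using hx
  · rw [Function.update_of_ne h]
    exact subset_convexHull ℝ _ ⟨k, rfl⟩

theorem edge_mem {n : ℕ} (p : Fin (n + 1) → Rn n) (i j : Fin (n + 1)) {θ : ℝ}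
    (h0 : 0 < θ) (h1 : θ < 1) : (1 - θ) • p i + θ • p j ∈ convexHull ℝ (Set.range p) :=
  convex_convexHull ℝ _ (subset_convexHull ℝ _ (Set.mem_range_self i))
    (subset_convexHull ℝ _ (Set.mem_range_self j))
    (by linarith) h0.le (by ring)

theorem hull_half {n : ℕ} (p : Fin (n + 1) → Rn n) {i j : Fin (n + 1)} (hij : i ≠ j) {θ : ℝ}
    (h0 : 0 < θ) (h1 : θ < 1) (a : Rn n →L[ℝ] ℝ) (c : ℝ) {r : ℝ} (hr : 0 < r)
    (ha : ∀ k, a (p k) = r * (if k = i then -θ else if k = j then 1 - θ else 0) + c) :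
    convexHull ℝ (Set.range p) ∩ {x | a x ≤ c} =
      convexHull ℝ (Set.range (Function.update p j ((1 - θ) • p i + θ • p j))) := by
  classical
  have hai := ha i
  have haj := ha j
  simp only [if_true, hij.symm, if_false] at hai haj
  have hax : a ((1 - θ) • p i + θ • p j) = c := by
    simp only [map_add, map_smul, smul_eq_mul, hai, haj]; ring
  apply Set.Subset.antisymm
  · rintro y ⟨hy, hyc⟩
    obtain ⟨w, hw0, hw1, rfl⟩ := mem_hull.1 hy
    simp only [Set.mem_ofPred_eq, map_sum, map_smul, smul_eq_mul] at hyc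
    -- a value
    have hval : ∑ k, w k * a (p k) = r * (w j * (1 - θ) - w i * θ) + c := by
      have : ∀ k, w k * a (p k) = (if k = i then r * (- (w i * θ)) else 0)
          + (if k = j then r * (w j * (1 - θ)) else 0) + w k * c := by
        intro k
        rw [ha k]
        by_cases hki : k = i
        · subst hki; simp [hij]; ring
        · by_cases hkj : k = j
          · subst hkj; simp [hki]; ring
          · simp [hki, hkj]
      simp only [this, Finset.sum_add_distrib, ← Finset.sum_mul, hw1]
      simp
      ring
    rw [hval] at hyc
    have hle : w j * (1 - θ) ≤ w i * θ := by
      have : r * (w j * (1 - θ) - w i * θ) ≤ 0 := by linarith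
      nlinarith
    refine mem_hull.2 ⟨fun k => if k = i then w i - w j * (1 - θ) / θ else
      if k = j then w j / θ else w k, ?_, ?_, ?_⟩
    · intro k
      simp only
      split_ifs
      · rw [sub_nonneg, div_le_iff₀ h0]; exact hle
      · exact div_nonneg (hw0 j) h0.le
      · exact hw0 k
    · have : ∀ k, (if k = i then w i - w j * (1 - θ) / θ else
        if k = j then w j / θ else w k) = w k + (if k = i then -(w j * (1 - θ) / θ) else 0)
          + (if k = j then w j / θ - w j else 0) := by
        intro k
        by_cases hki : k = i
        · subst hki; simp [hij]; ring
        · by_cases hkj : k = j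
          · subst hkj; simp [hki]
          · simp [hki, hkj]
      simp only [this, Finset.sum_add_distrib, hw1]
      simp
      field_simp
      ring
    · have : ∀ k, (if k = i then w i - w j * (1 - θ) / θ else
        if k = j then w j / θ else w k) • Function.update p j ((1 - θ) • p i + θ • p j) k
          = w k • p k + (if k = i then (-(w j * (1 - θ) / θ)) • p i else 0)
          + (if k = j then (w j * (1 - θ) / θ) • p i else 0) := by
        intro k
        by_cases hki : k = i
        · subst hki; simp [hij, sub_smul]; module
        · by_cases hkj : k = j
          · subst hkj
            simp only [hki, if_false, if_true, Function.update_self, smul_add, smul_smul, add_zero]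
            rw [div_mul_cancel₀ _ h0.ne', add_comm]
            congr 2
            ring
          · simp [hki, hkj]
      simp only [this, Finset.sum_add_distrib]
      simp
  · intro y hy
    refine ⟨hull_update_subset (edge_mem p i j h0 h1) j hy, ?_⟩
    have hconv : Convex ℝ {x | a x ≤ c} := convex_halfSpace_le a.toLinearMap.isLinear c
    refine convexHull_min ?_ hconv hy
    rintro _ ⟨k, rfl⟩
    by_cases hkj : k = j
    · subst hkj; simp only [Function.update_self, Set.mem_ofPred_eq]; exact hax.le
    · rw [Function.update_of_ne hkj]
      simp only [Set.mem_ofPred_eq, ha k, hkj, if_false]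
      split_ifs
      · nlinarith
      · simp

theorem Cut.edge {n : ℕ} {f : Set (Rn n) → ℂ} (hf : Cut f) (p : Fin (n + 1) → Rn n)
    {i j : Fin (n + 1)} (hij : i ≠ j) {θ : ℝ} (h0 : 0 < θ) (h1 : θ < 1) :
    f (convexHull ℝ (Set.range p)) =
      f (convexHull ℝ (Set.range (Function.update p j ((1 - θ) • p i + θ • p j)))) +
      f (convexHull ℝ (Set.range (Function.update p i ((1 - θ) • p i + θ • p j)))) := by
  by_cases hp : AffineIndependent ℝ p
  · obtain ⟨a, c, ha⟩ := exists_functional hp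
      (fun k => 1 * (if k = i then -θ else if k = j then 1 - θ else 0))
    have hane : a ≠ 0 := by
      rintro rfl
      have h2 := ha i
      have h3 := ha j
      simp [hij.symm] at h2 h3
      linarith
    rw [hf.cut _ (body_hull p) a hane c, hull_half p hij h0 h1 a c one_pos ha]
    congr 2
    have h2 := hull_half p hij.symm (θ := 1 - θ) (by linarith) (by linarith) (-a) (-c) one_pos ?_
    · rw [add_comm ((1 - θ) • p i)]
      have e : (1 : ℝ) - (1 - θ) = θ := by ring
      rw [e] at h2
      rw [← h2]
      ext x
      simp
    · intro k
      have := ha k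
      by_cases hki : k = i
      · subst hki
        simp only [hij, if_true, if_false] at this ⊢
        simp only [neg_apply, this]; ring
      · by_cases hkj : k = j
        · subst hkj
          simp only [hki, if_true, if_false] at this ⊢
          simp only [neg_apply, this]; ring
        · simp only [hki, hkj, if_false] at this ⊢
          simp only [neg_apply, this]; ring
  · have hF := flat_hull hp
    have hx := edge_mem p i j h0 h1
    rw [hf.flat _ (body_hull p) hF, hf.flat _ (body_hull _) (hF.mono (hull_update_subset hx j)),
      hf.flat _ (body_hull _) (hF.mono (hull_update_subset hx i)), add_zero]

open Classical in
theorem Cut.lemmaA {n : ℕ} {f : Set (Rn n) → ℂ} (hf : Cut f)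
    (hs : ∀ p : Fin (n + 1) → Rn n, f (convexHull ℝ (Set.range p)) = 0)
    (a : Rn n →L[ℝ] ℝ) (ha : a ≠ 0) (c : ℝ) (N : ℕ) :
    ∀ p : Fin (n + 1) → Rn n, (Finset.univ.filter fun i => a (p i) ≠ c).card ≤ N → 
      f (convexHull ℝ (Set.range p) ∩ {x | a x ≤ c}) = 0 := by
  induction N with
  | zero =>
    intro p hp
    have : ∀ i, a (p i) = c := by
      intro i
      by_contra hcon
      have : i ∈ (Finset.univ.filter fun i => a (p i) ≠ c) := by simp [hcon]
      rw [Finset.card_eq_zero.1 (Nat.le_zero.1 hp)] at this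
      simp at this
    rw [Set.inter_eq_left.2]
    · exact hs p
    · refine convexHull_min ?_ (convex_halfSpace_le a.toLinearMap.isLinear c)
      rintro _ ⟨k, rfl⟩
      exact (this k).le
  | succ N ih =>
    intro p hp
    by_cases h1 : ∃ i, a (p i) < c
    · by_cases h2 : ∃ j, c < a (p j)
      · obtain ⟨i, hi⟩ := h1
        obtain ⟨j, hj⟩ := h2
        have hij : i ≠ j := by rintro rfl; linarith
        set θ := (c - a (p i)) / (a (p j) - a (p i)) with hθ
        have hpos : 0 < a (p j) - a (p i) := by linarith
        have h0 : 0 < θ := div_pos (by linarith) hpos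
        have h1 : θ < 1 := by rw [hθ, div_lt_one hpos]; linarith
        have hx : a ((1 - θ) • p i + θ • p j) = c := by
          simp only [map_add, map_smul, smul_eq_mul]
          have : θ * (a (p j) - a (p i)) = c - a (p i) := div_mul_cancel₀ _ hpos.ne'
          linarith
        have key : ∀ k, a (p k) ≠ c → (Finset.univ.filter fun i' => 
            a (Function.update p k ((1 - θ) • p i + θ • p j) i') ≠ c).card ≤ N := by
          intro k hk
          refine Nat.le_of_lt_succ (lt_of_lt_of_le (Finset.card_lt_card ?_) hp)
          refine Finset.ssubset_iff_of_subset ?_ |>.2 ⟨k, by simp [hk], by simp [hx]⟩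
          intro l hl
          simp only [Finset.mem_filter, Finset.mem_univ, true_and] at hl ⊢
          by_cases hlk : l = k
          · subst hlk; exact hk
          · rwa [Function.update_of_ne hlk] at hl
        have := (hf.restrict a c).edge p hij h0 h1
        rw [this, ih _ (key j hj.ne'), ih _ (key i hi.ne), add_zero]
      · push Not at h2
        rw [Set.inter_eq_left.2]
        · exact hs p
        · refine convexHull_min ?_ (convex_halfSpace_le a.toLinearMap.isLinear c)
          rintro _ ⟨k, rfl⟩
          exact h2 k
    · push Not at h1
      rcases Set.eq_empty_or_nonempty (convexHull ℝ (Set.range p) ∩ {x | a x ≤ c}) with h | h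
      · rw [h, hf.empty]
      · refine hf.flat _ (body_le (body_hull p) a c h) ⟨a, ha, c, ?_⟩
        rintro x ⟨hx, hxc⟩
        refine le_antisymm hxc ?_
        have : convexHull ℝ (Set.range p) ⊆ {x | c ≤ a x} := by
          refine convexHull_min ?_ (convex_halfSpace_ge a.toLinearMap.isLinear c)
          rintro _ ⟨k, rfl⟩
          exact h1 k
        exact this hx

theorem Cut.poly {n : ℕ} (l : List ((Rn n →L[ℝ] ℝ) × ℝ)) : ∀ {f : Set (Rn n) → ℂ} (_ : Cut f)
    (_ : ∀ p : Fin (n + 1) → Rn n, f (convexHull ℝ (Set.range p)) = 0)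
    (_ : ∀ q ∈ l, q.1 ≠ 0) (p : Fin (n + 1) → Rn n), 
      f (convexHull ℝ (Set.range p) ∩ {x | ∀ q ∈ l, q.1 x ≤ q.2}) = 0 := by
  induction l with
  | nil => intro f hf hs _ p; simpa using hs p
  | cons q l ih =>
    intro f hf hs hl p
    have h1 := ih (hf.restrict q.1 q.2)
      (fun p => hf.lemmaA hs q.1 (hl q (by simp)) q.2 _ p le_rfl) (fun r hr => hl r (by simp [hr])) p
    rw [← h1]
    congr 1
    ext x
    simp only [List.mem_cons, forall_eq_or_imp, Set.mem_inter_iff, Set.mem_ofPred_eq]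
    tauto

theorem exists_big_simplex {n : ℕ} {K : Set (Rn n)} (hK : IsConvexBody K) :
    ∃ p : Fin (n + 1) → Rn n, K ⊆ convexHull ℝ (Set.range p) := by
  obtain ⟨b, hb, -⟩ := exists_mem_interior_convexHull_affineBasis 
    (s := (Set.univ : Set (Rn n))) (x := 0) Filter.univ_mem
  obtain ⟨r, hr, hball⟩ := Metric.isOpen_iff.1 isOpen_interior _ hb
  obtain ⟨R, hR0, hR⟩ := body_bound hK
  set S := (2 * R / r) with hS
  have hSpos : 0 < S := by positivity
  refine ⟨fun i => S • b (Fin.cast (by simp) i), ?_⟩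
  have h1 : Set.range (fun i : Fin (n+1) => S • b (Fin.cast (by simp) i)) = S • Set.range b := by
    ext x
    simp only [Set.mem_range, Set.mem_smul_set, exists_exists_eq_and]
    constructor
    · rintro ⟨i, rfl⟩; exact ⟨_, rfl⟩
    · rintro ⟨i, rfl⟩; exact ⟨Fin.cast (by simp) i, by simp⟩
  rw [h1, convexHull_smul]
  intro x hx
  rw [Set.mem_smul_set_iff_inv_smul_mem₀ hSpos.ne']
  apply interior_subset
  apply hball
  rw [mem_ball_zero_iff, norm_smul, norm_inv, Real.norm_eq_abs, abs_of_pos hSpos,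
    inv_mul_lt_iff₀ hSpos, hS, div_mul_cancel₀ _ hr.ne']
  linarith [hR x hx]

theorem exists_poly {n : ℕ} {K : Set (Rn n)} (hK : IsConvexBody K) {ε : ℝ} (hε : 0 < ε) :
    ∃ p : Fin (n + 1) → Rn n, ∃ l : List ((Rn n →L[ℝ] ℝ) × ℝ), (∀ q ∈ l, q.1 ≠ 0) ∧ 
      K ⊆ convexHull ℝ (Set.range p) ∩ {x | ∀ q ∈ l, q.1 x ≤ q.2} ∧
      convexHull ℝ (Set.range p) ∩ {x | ∀ q ∈ l, q.1 x ≤ q.2} ⊆ thickening ε K := by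
  classical
  obtain ⟨p, hp⟩ := exists_big_simplex hK
  have hcomp : IsCompact (convexHull ℝ (Set.range p) \ thickening ε K) :=
    (body_hull p).2.1.diff isOpen_thickening
  let U : {q : (Rn n →L[ℝ] ℝ) × ℝ // ∀ x ∈ K, q.1 x < q.2} → Set (Rn n) :=
    fun q => {x | q.1.2 < q.1.1 x}
  obtain ⟨t, ht⟩ := hcomp.elim_finite_subcover U
    (fun q => isOpen_lt continuous_const q.1.1.continuous) (by
      rintro x ⟨_, hx⟩
      have hxK : x ∉ K := fun h => hx (self_subset_thickening hε K h)
      obtain ⟨f, u, h1, h2⟩ := geometric_hahn_banach_closed_point hK.2.2 hK.2.1.isClosed hxK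
      exact Set.mem_iUnion.2 ⟨⟨(f, u), h1⟩, h2⟩)
  let t' := t.filter (fun q => q.1.1 ≠ 0)
  refine ⟨p, t'.toList.map Subtype.val, ?_, ?_, ?_⟩
  · intro q hq
    simp only [List.mem_map, Finset.mem_toList] at hq
    obtain ⟨q', hq', rfl⟩ := hq
    exact (Finset.mem_filter.1 hq').2
  · intro x hx
    refine ⟨hp hx, ?_⟩
    intro q hq
    simp only [List.mem_map, Finset.mem_toList] at hq
    obtain ⟨q', hq', rfl⟩ := hq
    exact (q'.2 x hx).le
  · rintro x ⟨hx, hxl⟩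
    by_contra hcon
    obtain ⟨q, hq⟩ := Set.mem_iUnion.1 (ht ⟨hx, hcon⟩)
    simp only [Set.mem_iUnion] at hq
    obtain ⟨hqt, hqx⟩ := hq
    have hne : q.1.1 ≠ 0 := by
      intro h0
      obtain ⟨k, hk⟩ := hK.1
      have h1 := q.2 k hk
      simp only [U, Set.mem_ofPred_eq] at hqx
      simp only [h0, zero_apply] at h1 hqx
      linarith
    have := hxl q.1 (List.mem_map.2 ⟨q, Finset.mem_toList.2 (Finset.mem_filter.2 ⟨hqt, hne⟩), rfl⟩)
    exact absurd hqx (not_lt.2 this)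

theorem vanish_of_simplex {n : ℕ} {φ : TIValuation n} (h : Simple φ)
    (hs : ∀ p : Fin (n + 1) → Rn n, φ.val (convexHull ℝ (Set.range p)) = 0)
    {K : Set (Rn n)} (hK : IsConvexBody K) : φ.val K = 0 := by
  have hεpos : ∀ i : ℕ, (0:ℝ) < 1 / ((i : ℝ) + 1) := fun i => by positivity
  choose p l hl h1 h2 using fun i : ℕ => exists_poly hK (hεpos i)
  set P : ℕ → Set (Rn n) := fun i => convexHull ℝ (Set.range (p i)) ∩ {x | ∀ q ∈ l i, q.1 x ≤ q.2}
  have hP : ∀ i, IsConvexBody (P i) := by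
    intro i
    have hset : {x : Rn n | ∀ q ∈ l i, q.1 x ≤ q.2} = ⋂ q ∈ l i, {x | q.1 x ≤ q.2} := by
      ext x; simp
    refine ⟨hK.1.mono (h1 i), (body_hull _).2.1.inter_right ?_, (body_hull _).2.2.inter ?_⟩
    · rw [hset]
      exact isClosed_biInter fun q _ => isClosed_le q.1.continuous continuous_const
    · rw [hset]
      exact convex_iInter₂ fun q _ => convex_halfSpace_le q.1.toLinearMap.isLinear _
  have hv : ∀ i, φ.val (P i) = 0 := by
    intro i
    rw [← ext0_body φ (hP i)]
    refine h.toCut.poly (l i) ?_ (hl i) (p i)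
    intro p
    rw [ext0_body φ (body_hull p), hs p]
  have hconv : Conv P K := by
    refine Conv.of_le (r := fun i : ℕ => 1 / ((i : ℝ) + 1)) (fun i => ?_)
      tendsto_one_div_add_atTop_nhds_zero_nat
    refine hd_le (hεpos i).le ?_ ?_
    · intro x hx
      obtain ⟨y, hy, hxy⟩ := mem_thickening_iff.1 (h2 i hx)
      exact ⟨y, hy, hxy.le⟩
    · intro x hx
      exact ⟨x, h1 i hx, by simpa using (hεpos i).le⟩
  have hlim := φ.continuity P K hP hK hconv
  simp only [hv] at hlim
  exact (tendsto_nhds_unique hlim tendsto_const_nhds)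

end KS


namespace KS

/-! ### volume -/

theorem mem_of_ball_subset {n : ℕ} {K L : Set (Rn n)} (hK : IsConvexBody K) (hL : IsConvexBody L)
    {x : Rn n} {r : ℝ} (hb : ball x r ⊆ K) (h : hausdorffDist L K < r) : x ∈ L := by
  by_contra hx
  obtain ⟨f, u, h1, h2⟩ := geometric_hahn_banach_closed_point hL.2.2 hL.2.1.isClosed hx
  set v := (InnerProductSpace.toDual ℝ (Rn n)).symm f with hv
  have hf : ∀ y, f y = inner ℝ v y := by intro y; simp [hv]
  obtain ⟨l, hl⟩ := hL.1
  have hv0 : v ≠ 0 := by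
    intro h0
    have := h1 l hl
    rw [hf, h0] at this h2
    simp at this h2
    linarith
  have hvn : 0 < ‖v‖ := norm_pos_iff.2 hv0
  set s := (hausdorffDist L K + r) / 2 with hs
  have hhd : 0 ≤ hausdorffDist L K := hausdorffDist_nonneg
  have hs1 : hausdorffDist L K < s := by linarith
  have hs2 : s < r := by linarith
  have hy : x + (s / ‖v‖) • v ∈ K := by
    apply hb
    rw [mem_ball, dist_eq_norm, add_sub_cancel_left, norm_smul, Real.norm_eq_abs,
      abs_of_nonneg (div_nonneg (by linarith) hvn.le), div_mul_cancel₀ _ hvn.ne']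
    exact hs2
  obtain ⟨a, ha, hd⟩ := exists_dist_le_hd hK hL hy
  rw [hausdorffDist_comm] at hd
  have h3 := h1 a ha
  have h4 : f (x + (s / ‖v‖) • v) - f a ≤ ‖v‖ * hausdorffDist L K := by
    rw [← map_sub, hf]
    refine (real_inner_le_norm _ _).trans ?_
    rw [← dist_eq_norm]
    gcongr
  have h5 : f (x + (s / ‖v‖) • v) = f x + s * ‖v‖ := by
    rw [map_add, map_smul, hf v, real_inner_self_eq_norm_sq, smul_eq_mul]
    field_simp
  nlinarith

theorem volume_tendsto {n : ℕ} (Ki : ℕ → Set (Rn n)) (K : Set (Rn n))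
    (hKi : ∀ i, IsConvexBody (Ki i)) (hK : IsConvexBody K) (h : Conv Ki K) :
    Tendsto (fun i => volume (Ki i)) atTop (𝓝 (volume K)) := by
  have hev : ∀ ε > 0, ∀ᶠ i in atTop, hausdorffDist (Ki i) K < ε := fun ε hε =>
    h.eventually (gt_mem_nhds hε)
  refine tendsto_measure_of_ae_tendsto_indicator (B := cthickening 1 K) atTop
    hK.2.1.measurableSet (fun i => (hKi i).2.1.measurableSet) isClosed_cthickening.measurableSet
    (hK.2.1.isBounded.cthickening.measure_lt_top.ne) ?_ ?_
  · filter_upwards [hev 1 one_pos] with i hi x hx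
    obtain ⟨y, hy, hxy⟩ := exists_dist_le_hd (hKi i) hK hx
    exact mem_cthickening_of_dist_le x y 1 K hy (hxy.trans hi.le)
  · have hfr : ∀ᵐ x ∂(volume : Measure (Rn n)), x ∉ frontier K := by
      rw [ae_iff]
      simpa using hK.2.2.addHaar_frontier volume
    filter_upwards [hfr] with x hx
    by_cases hxK : x ∈ K
    · have hxi : x ∈ interior K := by
        by_contra hcon
        exact hx ⟨subset_closure hxK, hcon⟩
      obtain ⟨r, hr, hball⟩ := Metric.isOpen_iff.1 isOpen_interior _ hxi
      filter_upwards [hev r hr] with i hi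
      simp only [hxK, iff_true]
      exact mem_of_ball_subset hK (hKi i) (hball.trans interior_subset) hi
    · have hpos : 0 < infDist x K := by
        rw [← hK.2.1.isClosed.notMem_iff_infDist_pos hK.1]; exact hxK
      filter_upwards [hev _ hpos] with i hi
      simp only [hxK, iff_false]
      intro hcon
      obtain ⟨y, hy, hxy⟩ := exists_dist_le_hd (hKi i) hK hcon
      linarith [infDist_le_dist_of_mem (x := x) hy]

noncomputable def vol (n : ℕ) : TIValuation n where
  val K := ((volume K).toReal : ℂ)
  continuity Ki K hKi hK h := by
    have h1 := volume_tendsto Ki K hKi hK h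
    have h2 := (ENNReal.tendsto_toReal hK.2.1.measure_lt_top.ne).comp h1
    exact (Complex.continuous_ofReal.tendsto _).comp h2
  translation_invariant K hK x := by
    simp
  valuation K L hK hL hU := by
    have h1 := measure_union_add_inter (μ := (volume : Measure (Rn n))) K hL.2.1.measurableSet
    have hI := body_inter_of_union hK hL hU
    have h2 := congrArg ENNReal.toReal h1
    rw [ENNReal.toReal_add hU.2.1.measure_lt_top.ne hI.2.1.measure_lt_top.ne,
      ENNReal.toReal_add hK.2.1.measure_lt_top.ne hL.2.1.measure_lt_top.ne] at h2
    exact_mod_cast h2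

theorem vol_val {n : ℕ} (K : Set (Rn n)) : (vol n).val K = ((volume K).toReal : ℂ) := rfl

theorem vol_simple (n : ℕ) : Simple (vol n) := by
  intro K hK hF
  have h1 := (flat_iff hK).2 hF
  have h2 := hK.2.2.addHaar_frontier volume
  have h3 : volume K = 0 := by
    rw [frontier, h1, Set.sdiff_empty, hK.2.1.isClosed.closure_eq] at h2
    exact h2
  rw [vol_val, h3]
  simp

/-! ### additive functions -/

theorem additive_linear (g : ℝ → ℂ) (hadd : ∀ s t, 0 ≤ s → 0 ≤ t → g (s + t) = g s + g t)
    (hcont : ∀ s, 0 ≤ s → ∀ u : ℕ → ℝ, (∀ i, 0 ≤ u i) → Tendsto u atTop (𝓝 s) →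
      Tendsto (fun i => g (u i)) atTop (𝓝 (g s))) (s : ℝ) (hs : 0 ≤ s) :
    g s = (s : ℂ) * g 1 := by
  have h0 : g 0 = 0 := by
    have := hadd 0 0 le_rfl le_rfl
    simpa using this
  have hnat : ∀ (m : ℕ) (x : ℝ), 0 ≤ x → g (m * x) = m * g x := by
    intro m x hx
    induction m with
    | zero => simp [h0]
    | succ m ih =>
      push_cast
      rw [add_mul, add_mul, one_mul, hadd _ _ (by positivity) hx, ih, one_mul]
  have hlim : Tendsto (fun k : ℕ => (⌊s * ((k:ℝ) + 1)⌋₊ : ℝ) / ((k:ℝ) + 1)) atTop (𝓝 s) := by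
    have h1 : Tendsto (fun k : ℕ => (k : ℝ) + 1) atTop atTop :=
      tendsto_atTop_add_const_right _ _ tendsto_natCast_atTop_atTop
    exact (tendsto_nat_floor_mul_div_atTop hs).comp h1
  have h2 := hcont s hs _ (fun i => by positivity) hlim
  have h3 : ∀ k : ℕ, g ((⌊s * ((k:ℝ) + 1)⌋₊ : ℝ) / ((k:ℝ) + 1)) = 
      (((⌊s * ((k:ℝ) + 1)⌋₊ : ℝ) / ((k:ℝ) + 1) : ℝ) : ℂ) * g 1 := by
    intro k
    have hk : ((k:ℝ) + 1) ≠ 0 := by positivity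
    have hk' : ((k:ℂ) + 1) ≠ 0 := by exact_mod_cast hk
    have h4 := hnat (k + 1) (1 / ((k:ℝ) + 1)) (by positivity)
    push_cast at h4
    rw [mul_one_div_cancel hk] at h4
    rw [div_eq_mul_one_div, hnat _ _ (by positivity), h4]
    push_cast
    field_simp
  simp only [h3] at h2
  have h5 : Tendsto (fun k : ℕ => (((⌊s * ((k:ℝ) + 1)⌋₊ : ℝ) / ((k:ℝ) + 1) : ℝ) : ℂ) * g 1) atTop
    (𝓝 ((s : ℂ) * g 1)) := ((Complex.continuous_ofReal.tendsto _).comp hlim).mul_const _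
  exact tendsto_nhds_unique h2 h5

/-! ### boxes -/

def box {n : ℕ} (lo hi : Fin n → ℝ) : Set (Rn n) := {x | ∀ k, lo k ≤ x k ∧ x k ≤ hi k}

theorem body_box {n : ℕ} {lo hi : Fin n → ℝ} (h : ∀ k, lo k ≤ hi k) :
    IsConvexBody (box lo hi) := by
  have himg : box lo hi = (EuclideanSpace.equiv (Fin n) ℝ).symm '' (Set.Icc lo hi) := by
    ext x
    constructor
    · intro hx
      exact ⟨x.ofLp, ⟨fun k => (hx k).1, fun k => (hx k).2⟩, rfl⟩
    · rintro ⟨y, hy, rfl⟩ k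
      exact ⟨hy.1 k, hy.2 k⟩
  rw [himg]
  refine ⟨(Set.nonempty_Icc.2 h).image _, isCompact_Icc.image 
    (EuclideanSpace.equiv (Fin n) ℝ).symm.continuous, ?_⟩
  exact (convex_Icc lo hi).linear_image (EuclideanSpace.equiv (Fin n) ℝ).symm.toLinearMap

def cube (n : ℕ) : Set (Rn n) := box (fun _ => 0) (fun _ => 1)

theorem body_cube (n : ℕ) : IsConvexBody (cube n) := body_box (fun _ => zero_le_one)

noncomputable abbrev pr {n : ℕ} (i : Fin n) : Rn n →L[ℝ] ℝ := EuclideanSpace.proj i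

theorem pr_apply {n : ℕ} (i : Fin n) (x : Rn n) : pr i x = x i := rfl

theorem pr_ne {n : ℕ} (i : Fin n) : pr i ≠ 0 := by
  intro h
  have := congrArg (fun f : Rn n →L[ℝ] ℝ => f (EuclideanSpace.single i 1)) h
  simp at this

noncomputable abbrev E1 {n : ℕ} (i : Fin n) : Rn n := EuclideanSpace.single i (1:ℝ)

theorem E1_apply {n : ℕ} (i k : Fin n) : (E1 i : Rn n) k = if k = i then 1 else 0 := by
  simp

/-- slab in coordinate `i` -/
noncomputable def slab {n : ℕ} (i : Fin n) (s : ℝ) : Set (Rn n) := 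
  box (fun _ => 0) (Function.update (fun _ => 1) i s)

theorem mem_slab {n : ℕ} {i : Fin n} {s : ℝ} {x : Rn n} : x ∈ slab i s ↔ 
    (∀ k, k ≠ i → 0 ≤ x k ∧ x k ≤ 1) ∧ 0 ≤ x i ∧ x i ≤ s := by
  constructor
  · intro h
    refine ⟨fun k hk => ?_, ?_⟩
    · have := h k; rwa [Function.update_of_ne hk] at this
    · have := h i; rwa [Function.update_self] at this
  · rintro ⟨h1, h2⟩ k
    by_cases hk : k = i
    · subst hk; rwa [Function.update_self]
    · rw [Function.update_of_ne hk]; exact h1 k hk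

theorem body_slab {n : ℕ} (i : Fin n) {s : ℝ} (hs : 0 ≤ s) : IsConvexBody (slab i s) := by
  refine body_box (fun k => ?_)
  by_cases hk : k = i
  · subst hk; simpa using hs
  · rw [Function.update_of_ne hk]; exact zero_le_one

theorem mem_add_sing {n : ℕ} {A : Set (Rn n)} {x v : Rn n} : x ∈ A + {v} ↔ x - v ∈ A := by
  simp [sub_eq_add_neg]

theorem slab_add {n : ℕ} {φ : TIValuation n} (h : Simple φ) (i : Fin n) {s t : ℝ} (hs : 0 ≤ s)
    (ht : 0 ≤ t) : φ.val (slab i (s + t)) = φ.val (slab i s) + φ.val (slab i t) := by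
  have h1 : slab i (s + t) ∩ {x | pr i x ≤ s} = slab i s := by
    ext x
    simp only [Set.mem_inter_iff, mem_slab, Set.mem_ofPred_eq, pr_apply]
    constructor
    · rintro ⟨⟨h1, h2, h3⟩, h4⟩; exact ⟨h1, h2, h4⟩
    · rintro ⟨h1, h2, h3⟩; exact ⟨⟨h1, h2, by linarith⟩, h3⟩
  have h2 : slab i (s + t) ∩ {x | s ≤ pr i x} = slab i t + {s • E1 i} := by
    ext x
    rw [mem_add_sing]
    simp only [Set.mem_inter_iff, mem_slab, Set.mem_ofPred_eq, pr_apply,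
      PiLp.sub_apply, PiLp.smul_apply, E1_apply, smul_eq_mul, if_true]
    constructor
    · rintro ⟨⟨h1, h2, h3⟩, h4⟩
      refine ⟨fun k hk => ?_, by linarith, by linarith⟩
      simpa [hk] using h1 k hk
    · rintro ⟨h1, h2, h3⟩
      refine ⟨⟨fun k hk => ?_, by linarith, by linarith⟩, by linarith⟩
      simpa [hk] using h1 k hk
  have hb1 := body_slab i hs
  have hb2 := body_add (body_slab i ht) (body_singleton (s • E1 i))
  rw [val_cut h (body_slab i (add_nonneg hs ht)) (pr_ne i) (c := s) (by rw [h1]; exact hb1.1)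
    (by rw [h2]; exact hb2.1), h1, h2, val_add_singleton φ (body_slab i ht)]

theorem mem_seg0 {n : ℕ} {v x : Rn n} : x ∈ segment ℝ 0 v ↔ ∃ s : ℝ, 0 ≤ s ∧ s ≤ 1 ∧ x = s • v := by
  rw [segment_eq_image']
  simp only [sub_zero, zero_add, Set.mem_image, Set.mem_Icc]
  constructor
  · rintro ⟨s, h, rfl⟩; exact ⟨s, h.1, h.2, rfl⟩
  · rintro ⟨s, h1, h2, rfl⟩; exact ⟨s, ⟨h1, h2⟩, rfl⟩

theorem slab_eq {n : ℕ} (i : Fin n) {s : ℝ} (hs : 0 ≤ s) :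
    slab i s = slab i 0 + s • segment ℝ 0 (E1 i) := by
  ext x
  constructor
  · intro hx
    rw [mem_slab] at hx
    refine ⟨x - x i • E1 i, ?_, x i • E1 i, ?_, by simp⟩
    · rw [mem_slab]
      refine ⟨fun k hk => ?_, ?_⟩
      · simpa [hk] using hx.1 k hk
      · simp
    · rcases hs.eq_or_lt with h0 | h0
      · have : x i = 0 := by linarith [hx.2.1, hx.2.2]
        rw [this, ← h0]
        exact ⟨0, mem_seg0.2 ⟨0, le_rfl, zero_le_one, by simp⟩, by simp⟩
      · refine ⟨(x i / s) • E1 i, mem_seg0.2 ⟨x i / s, div_nonneg hx.2.1 hs, ?_, rfl⟩, ?_⟩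
        · rw [div_le_one h0]; exact hx.2.2
        · simp only [smul_smul]; rw [mul_div_cancel₀ _ h0.ne']
  · rintro ⟨y, hy, _, ⟨z, hz, rfl⟩, rfl⟩
    obtain ⟨t, h0, h1, rfl⟩ := mem_seg0.1 hz
    rw [mem_slab] at hy ⊢
    refine ⟨fun k hk => ?_, ?_⟩
    · simpa [hk] using hy.1 k hk
    · have : y i = 0 := le_antisymm hy.2.2 hy.2.1
      simp [this]
      exact ⟨mul_nonneg hs h0, by nlinarith⟩

theorem slab_val {n : ℕ} {φ : TIValuation n} (h : Simple φ) (i : Fin n) {s : ℝ} (hs : 0 ≤ s) :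
    φ.val (slab i s) = s * φ.val (slab i 1) := by
  refine additive_linear (fun s => φ.val (slab i s)) (fun s t hs ht => slab_add h i hs ht) ?_ s hs
  intro s hs u hu hlim
  refine φ.continuity _ _ (fun k => body_slab i (hu k)) (body_slab i hs) ?_
  have h1 := (Conv.smul (body_segment (0 : Rn n) (E1 i)) hlim).add_left (slab i 0)
    (fun k => body_smul _ (body_segment _ _)) (body_smul _ (body_segment _ _))
  simp only [← slab_eq i (hu _), ← slab_eq i hs] at h1
  exact h1

theorem slab_one {n : ℕ} (i : Fin n) : slab i 1 = cube n := by
  rw [slab, cube, Function.update_eq_self_iff.2 rfl]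

/-! ### normalization -/

noncomputable abbrev mE {n : ℕ} (M : Matrix (Fin n) (Fin n) ℝ) : Rn n →L[ℝ] Rn n :=
  Matrix.toEuclideanCLM (𝕜 := ℝ) M

theorem mE_apply {n : ℕ} (M : Matrix (Fin n) (Fin n) ℝ) (x : Rn n) (k : Fin n) :
    mE M x k = ∑ l, M k l * x l := by
  simp [Matrix.mulVec, dotProduct]

def PM {n : ℕ} (M : Matrix (Fin n) (Fin n) ℝ) : Prop :=
  ∀ φ : TIValuation n, Simple φ → φ.val (cube n) = 0 → φ.val (mE M '' cube n) = 0

theorem PM.mul {n : ℕ} {A B : Matrix (Fin n) (Fin n) ℝ} (hA : PM A) (hB : PM B) : PM (A * B) := by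
  intro φ hφ h0
  have h1 := hA φ hφ h0
  have h2 := hB (lpull φ (mE A)) (hφ.lpull _) (by rw [lpull_val]; exact h1)
  rw [lpull_val, ← Set.image_comp] at h2
  rw [mE, map_mul]
  exact h2

theorem PM.one {n : ℕ} : PM (1 : Matrix (Fin n) (Fin n) ℝ) := by
  intro φ hφ h0
  have : mE (1 : Matrix (Fin n) (Fin n) ℝ) = ContinuousLinearMap.id ℝ (Rn n) := by
    rw [mE, map_one]; rfl
  simpa [this] using h0

theorem PM.scale {n : ℕ} (i : Fin n) (s : ℝ) : 
    PM (Matrix.diagonal (Function.update (fun _ => (1:ℝ)) i s)) := by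
  intro φ hφ h0
  have happ : ∀ (x : Rn n) k, mE (Matrix.diagonal (Function.update (fun _ => (1:ℝ)) i s)) x k 
      = (if k = i then s else 1) * x k := by
    intro x k
    rw [mE_apply]
    simp [Matrix.diagonal_apply, Function.update_apply]
  have himg : mE (Matrix.diagonal (Function.update (fun _ => (1:ℝ)) i s)) '' cube n =
      slab i |s| + {(min s 0) • E1 i} := by
    ext x
    rw [mem_add_sing, mem_slab]
    simp only [PiLp.sub_apply, PiLp.smul_apply, E1_apply, smul_eq_mul, if_true]
    constructor
    · rintro ⟨y, hy, rfl⟩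
      refine ⟨fun k hk => ?_, ?_⟩
      · rw [happ]; simpa [hk] using hy k
      · rw [happ]
        have := hy i
        simp only [if_true, mul_one] at this ⊢
        rcases le_total 0 s with hs | hs
        · rw [abs_of_nonneg hs, min_eq_right hs]; constructor <;> nlinarith
        · rw [abs_of_nonpos hs, min_eq_left hs]; constructor <;> nlinarith
    · rintro ⟨h1, h2⟩
      have h1' : ∀ k, k ≠ i → 0 ≤ x k ∧ x k ≤ 1 := fun k hk => by simpa [hk] using h1 k hk
      refine ⟨WithLp.toLp 2 (fun k => if k = i then (if s = 0 then 0 else x i / s) else x k), ?_, ?_⟩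
      · intro k
        by_cases hk : k = i
        · subst hk
          simp only [if_true, mul_one] at h2 ⊢
          by_cases hs : s = 0
          · simp [hs]
          · simp only [hs, if_false]
            rcases lt_or_gt_of_ne hs with hs' | hs'
            · rw [abs_of_neg hs', min_eq_left hs'.le] at h2
              constructor
              · exact div_nonneg_of_nonpos (by linarith) hs'.le
              · rw [div_le_one_of_neg hs']; linarith
            · rw [abs_of_pos hs', min_eq_right hs'.le] at h2
              constructor
              · exact div_nonneg (by linarith) hs'.le
              · rw [div_le_one hs']; linarith
        · simpa [hk] using h1' k hk
      · ext k
        rw [happ]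
        by_cases hk : k = i
        · subst hk
          by_cases hs : s = 0
          · simp [hs] at h2 ⊢; linarith
          · simp [hs, mul_div_cancel₀]
        · simp [hk]
  rw [himg, val_add_singleton φ (body_slab i (abs_nonneg s)), slab_val hφ i (abs_nonneg s),
    slab_one, h0, mul_zero]

theorem PM.diag {n : ℕ} (D : Fin n → ℝ) : PM (Matrix.diagonal D) := by
  classical
  have key : ∀ S : Finset (Fin n), PM (Matrix.diagonal fun k => if k ∈ S then D k else 1) := by
    intro S
    induction S using Finset.induction_on with
    | empty =>
      have : (Matrix.diagonal fun k : Fin n => if k ∈ (∅ : Finset (Fin n)) then D k else 1) = 1 := by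
        simp
      rw [this]; exact PM.one
    | insert i S hi ih =>
      have : (Matrix.diagonal fun k : Fin n => if k ∈ insert i S then D k else 1) =
          Matrix.diagonal (Function.update (fun _ => (1:ℝ)) i (D i)) * 
            (Matrix.diagonal fun k => if k ∈ S then D k else 1) := by
        rw [Matrix.diagonal_mul_diagonal]
        congr 1
        ext k
        by_cases hk : k = i
        · subst hk; simp [hi]
        · simp [hk]
      rw [this]
      exact (PM.scale i (D i)).mul ih
  have := key Finset.univ
  simpa using this

theorem PM.trans {n : ℕ} {i j : Fin n} (hij : i ≠ j) (c : ℝ) : 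
    PM (Matrix.transvection i j c) := by
  intro φ hφ h0
  have hf := hφ.toCut
  set f := ext0 φ with hfdef
  have happ : ∀ (x : Rn n) k, mE (Matrix.transvection i j c) x k 
      = x k + (if k = i then c * x j else 0) := by
    intro x k
    rw [mE_apply]
    simp only [Matrix.transvection, Matrix.add_apply, add_mul, Finset.sum_add_distrib]
    congr 1
    · simp [Matrix.one_apply]
    · simp only [Matrix.single_apply]
      by_cases hk : k = i
      · subst hk; simp
      · simp [hk, Ne.symm hk]
  set α : Rn n →L[ℝ] ℝ := pr i - c • pr j with hα
  have hαa : ∀ x : Rn n, α x = x i - c * x j := by intro x; simp [hα]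
  have hαne : α ≠ 0 := by
    intro h
    have h1 := hαa (E1 i)
    rw [h] at h1
    simp [E1_apply, hij.symm] at h1
  set M := |c| + 2 with hM
  set X := box (Function.update (fun _ => (0:ℝ)) i (-|c|)) (Function.update (fun _ => 1) i M) 
    ∩ {x | 0 ≤ α x} with hX
  have hmem : ∀ x, x ∈ X ↔ (∀ k, k ≠ i → 0 ≤ x k ∧ x k ≤ 1) ∧ (-|c| ≤ x i ∧ x i ≤ M) 
      ∧ 0 ≤ x i - c * x j := by
    intro x
    constructor
    · rintro ⟨h1, h2⟩
      refine ⟨fun k hk => ?_, ?_, ?_⟩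
      · have := h1 k; rwa [Function.update_of_ne hk, Function.update_of_ne hk] at this
      · have := h1 i; rwa [Function.update_self, Function.update_self] at this
      · rw [← hαa]; exact h2
    · rintro ⟨h1, h2, h3⟩
      refine ⟨fun k => ?_, ?_⟩
      · by_cases hk : k = i
        · subst hk; rwa [Function.update_self, Function.update_self]
        · rw [Function.update_of_ne hk, Function.update_of_ne hk]; exact h1 k hk
      · rw [← hαa] at h3; exact h3
  have hcj : ∀ x : Rn n, (0 ≤ x j ∧ x j ≤ 1) → -|c| ≤ c * x j ∧ c * x j ≤ |c| := by
    intro x hx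
    have h1 := neg_abs_le c
    have h2 := le_abs_self c
    have h3 := abs_nonneg c
    constructor <;> nlinarith
  have hc0 := abs_nonneg c
  have hX0 : (0 : Rn n) ∈ X := by
    rw [hmem]
    refine ⟨fun k hk => by simp, ?_, by simp⟩
    simp only [PiLp.zero_apply]
    constructor <;> linarith
  have hbX : IsConvexBody X := by
    refine body_ge (body_box fun k => ?_) α 0 ⟨0, hX0⟩
    by_cases hk : k = i
    · subst hk; rw [Function.update_self, Function.update_self]; linarith
    · rw [Function.update_of_ne hk, Function.update_of_ne hk]; exact zero_le_one
  have c1 := hf.cut X hbX α hαne 1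
  have c2 := hf.cut X hbX (pr i) (pr_ne i) (M - 1)
  have e1 : X ∩ {x | α x ≤ 1} = mE (Matrix.transvection i j c) '' cube n := by
    ext x
    simp only [Set.mem_inter_iff, hmem, Set.mem_ofPred_eq, hαa]
    constructor
    · rintro ⟨⟨h1, h2, h3⟩, h4⟩
      refine ⟨x - (c * x j) • E1 i, ?_, ?_⟩
      · intro k
        by_cases hk : k = i
        · subst hk; simp; constructor <;> linarith
        · simpa [hk] using h1 k hk
      · ext k
        rw [happ]
        by_cases hk : k = i
        · subst hk; simp [hij.symm]
        · simp [hk]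
    · rintro ⟨y, hy, rfl⟩
      simp only [happ, if_true, hij.symm, if_false, add_zero]
      have := hcj y (hy j)
      have hi := hy i
      simp only at hi
      refine ⟨⟨fun k hk => by simpa [hk] using hy k, ⟨by linarith, by linarith⟩, by linarith⟩,
        by linarith⟩
  have e2 : X ∩ {x | M - 1 ≤ pr i x} = cube n + {(M - 1) • E1 i} := by
    ext x
    rw [mem_add_sing]
    simp only [Set.mem_inter_iff, hmem, Set.mem_ofPred_eq, pr_apply]
    constructor
    · rintro ⟨⟨h1, h2, h3⟩, h4⟩ k
      by_cases hk : k = i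
      · subst hk; simp; constructor <;> linarith
      · simpa [hk] using h1 k hk
    · intro hx
      have hxk : ∀ k, k ≠ i → 0 ≤ x k ∧ x k ≤ 1 := fun k hk => by simpa [hk] using hx k
      have hxi := hx i
      simp at hxi
      have := hcj x (hxk j hij.symm)
      exact ⟨⟨hxk, ⟨by linarith, by linarith⟩, by linarith⟩, by linarith⟩
  have e3 : X ∩ {x | 1 ≤ α x} = (X ∩ {x | pr i x ≤ M - 1}) + {E1 i} := by
    ext x
    rw [mem_add_sing]
    simp only [Set.mem_inter_iff, hmem, Set.mem_ofPred_eq, pr_apply, hαa,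
      PiLp.sub_apply, E1_apply, if_true, hij.symm, if_false]
    constructor
    · rintro ⟨⟨h1, h2, h3⟩, h4⟩
      have := hcj x (h1 j hij.symm)
      refine ⟨⟨fun k hk => by simpa [hk] using h1 k hk, ⟨by linarith, by linarith⟩, by linarith⟩,
        by linarith⟩
    · rintro ⟨⟨h1, h2, h3⟩, h4⟩
      refine ⟨⟨fun k hk => by simpa [hk] using h1 k hk, ⟨by linarith, by linarith⟩, by linarith⟩,
        by linarith⟩
  have hbY : IsConvexBody (X ∩ {x | pr i x ≤ M - 1}) := by
    refine body_le hbX _ _ ⟨0, hX0, ?_⟩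
    simp
    linarith
  have hbe1 := body_image (mE (Matrix.transvection i j c)) (body_cube n)
  rw [e1, e3, hfdef, ext0_body φ hbX, ext0_body φ hbe1,
    ext0_body φ (body_add hbY (body_singleton _)), val_add_singleton φ hbY] at c1
  rw [e2, hfdef, ext0_body φ hbX, ext0_body φ hbY, 
    ext0_body φ (body_add (body_cube n) (body_singleton _)), val_add_singleton φ (body_cube n),
    h0] at c2
  rw [c2] at c1
  linear_combination -c1

theorem PM.all {n : ℕ} (M : Matrix (Fin n) (Fin n) ℝ) : PM M := by
  by_cases hdet : M.det = 0
  · intro φ hφ _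
    refine hφ _ (body_image _ (body_cube n)) ?_
    obtain ⟨v, hv, hv0⟩ := Matrix.exists_mulVec_eq_zero_iff.2 hdet
    refine flat_of_submodule 0 (LinearMap.range (mE M).toLinearMap) ?_ ?_
    · intro htop
      have hsurj := LinearMap.range_eq_top.1 htop
      have hinj := LinearMap.injective_iff_surjective.2 hsurj
      have h1 : (mE M).toLinearMap (WithLp.toLp 2 v) = (mE M).toLinearMap 0 := by
        rw [map_zero]
        have : mE M (WithLp.toLp 2 v) = 0 := by
          rw [mE, Matrix.toEuclideanCLM_toLp, hv0]; rfl
        exact this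
      have h2 := hinj h1
      apply hv
      ext k
      have := congrArg (fun x : Rn n => x k) h2
      simpa using this
    · rintro _ ⟨x, _, rfl⟩
      simp
  · exact Matrix.diagonal_transvection_induction_of_det_ne_zero PM M hdet (fun D _ => PM.diag D)
      (fun t => PM.trans t.hij t.c) (fun A B _ _ hA hB => hA.mul hB)

theorem vanish_cube_image {n : ℕ} {φ : TIValuation n} (h : Simple φ) (h0 : φ.val (cube n) = 0)
    (L : Rn n →L[ℝ] Rn n) : φ.val (L '' cube n) = 0 := by
  have := PM.all ((Matrix.toEuclideanCLM (𝕜 := ℝ) (n := Fin n)).symm L) φ h h0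
  simpa [mE] using this

theorem vol_cube_ne {n : ℕ} : (vol n).val (cube n) ≠ 0 := by
  rw [vol_val]
  have hb := body_cube n
  have hint : (interior (cube n)).Nonempty := by
    refine ⟨WithLp.toLp 2 (fun _ => 1/2), ?_⟩
    rw [mem_interior]
    refine ⟨⋂ k, {x : Rn n | 0 < x k ∧ x k < 1}, ?_, ?_, ?_⟩
    · intro x hx k
      have := Set.mem_iInter.1 hx k
      exact ⟨this.1.le, this.2.le⟩
    · refine isOpen_iInter_of_finite fun k => ?_
      exact (isOpen_lt continuous_const (pr k).continuous).inter
        (isOpen_lt (pr k).continuous continuous_const)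
    · simp only [Set.mem_iInter, Set.mem_ofPred_eq]; intro _; norm_num
  have h1 : 0 < volume (cube n) := 
    lt_of_lt_of_le (isOpen_interior.measure_pos volume hint) (measure_mono interior_subset)
  have h2 : 0 < (volume (cube n)).toReal := ENNReal.toReal_pos h1.ne' hb.2.1.measure_lt_top.ne
  exact_mod_cast h2.ne'

end KS


namespace KS

theorem flat_bottom {n : ℕ} {φ : TIValuation n} (h : Simple φ) {v : Rn n}
    (hF : ∀ F, IsConvexBody F → Flat F → φ.val (F + segment ℝ 0 v) = 0)
    {T : Set (Rn n)} (hT : IsConvexBody T) (α : Rn n →L[ℝ] ℝ) (c0 : ℝ) (hv : α v = 1)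
    (hge : ∀ x ∈ T, c0 ≤ α x) (hbot : ∀ x ∈ T, x - (α x - c0) • v ∈ T) :
    φ.val (T + segment ℝ 0 v) = φ.val T := by
  have hα : α ≠ 0 := by rintro rfl; simp at hv
  set F := T ∩ {x | α x ≤ c0} with hFdef
  have hbotF : ∀ x ∈ T, x - (α x - c0) • v ∈ F := by
    intro x hx
    refine ⟨hbot x hx, ?_⟩
    simp [hv]
  have hFne : F.Nonempty := by
    obtain ⟨x, hx⟩ := hT.1
    exact ⟨_, hbotF x hx⟩
  have hFb : IsConvexBody F := body_le hT α c0 hFne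
  have hFeq : ∀ x ∈ F, α x = c0 := fun x hx => le_antisymm hx.2 (hge x hx.1)
  have hFf : Flat F := ⟨α, hα, c0, hFeq⟩
  have e1 : (T + segment ℝ 0 v) ∩ {x | α x ≤ c0 + 1} = F + segment ℝ 0 v := by
    ext y
    constructor
    · rintro ⟨⟨x, hx, z, hz, rfl⟩, hy⟩
      obtain ⟨s, hs0, hs1, rfl⟩ := mem_seg0.1 hz
      simp only [Set.mem_ofPred_eq, map_add, map_smul, hv, smul_eq_mul, mul_one] at hy
      refine ⟨_, hbotF x hx, (α x - c0 + s) • v, mem_seg0.2 ⟨_, ?_, ?_, rfl⟩, ?_⟩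
      · linarith [hge x hx]
      · linarith
      · simp only; module
    · rintro ⟨x, hx, z, hz, rfl⟩
      obtain ⟨s, hs0, hs1, rfl⟩ := mem_seg0.1 hz
      refine ⟨⟨x, hx.1, _, hz, rfl⟩, ?_⟩
      simp only [Set.mem_ofPred_eq, map_add, map_smul, hv, smul_eq_mul, mul_one, hFeq x hx]
      linarith
  have e2 : (T + segment ℝ 0 v) ∩ {x | c0 + 1 ≤ α x} = T + {v} := by
    ext y
    rw [mem_add_sing]
    constructor
    · rintro ⟨⟨x, hx, z, hz, rfl⟩, hy⟩
      obtain ⟨s, hs0, hs1, rfl⟩ := mem_seg0.1 hz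
      simp only [Set.mem_ofPred_eq, map_add, map_smul, hv, smul_eq_mul, mul_one] at hy
      rcases (hge x hx).eq_or_lt with h0 | h0
      · have : s = 1 := by linarith
        rw [this]; simpa using hx
      · have hpos : 0 < α x - c0 := by linarith
        have q1 : 0 ≤ 1 - (1 - s) / (α x - c0) := by rw [sub_nonneg, div_le_one hpos]; linarith
        have q2 : 0 ≤ (1 - s) / (α x - c0) := div_nonneg (by linarith) hpos.le
        have := hT.2.2 hx (hbot x hx) q1 q2 (by ring)
        convert this using 1
        rw [smul_sub, smul_smul, div_mul_cancel₀ _ hpos.ne']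
        module
    · intro hy
      refine ⟨⟨y - v, hy, v, mem_seg0.2 ⟨1, zero_le_one, le_rfl, by simp⟩, by simp⟩, ?_⟩
      have := hge _ hy
      simp only [map_sub, hv] at this
      simp only [Set.mem_ofPred_eq]
      linarith
  have hb := body_add hT (body_segment 0 v)
  rw [val_cut h hb hα (c := c0 + 1) (by rw [e1]; exact (body_add hFb (body_segment 0 v)).1)
    (by rw [e2]; exact (body_add hT (body_singleton v)).1), e1, e2, hF F hFb hFf,
    val_add_singleton φ hT, zero_add]

theorem exists_coeffs {n : ℕ} {p : Fin (n + 1) → Rn n} (h : AffineIndependent ℝ p) (v : Rn n) :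
    ∃ c : Fin (n + 1) → ℝ, ∑ i, c i = 0 ∧ ∑ i, c i • p i = v := by
  have htop : affineSpan ℝ (Set.range p) = ⊤ := by
    rw [h.affineSpan_eq_top_iff_card_eq_finrank_add_one]
    simp
  let b : AffineBasis (Fin (n + 1)) ℝ (Rn n) := ⟨p, h, htop⟩
  refine ⟨fun i => b.coord i v - b.coord i 0, ?_, ?_⟩
  · rw [Finset.sum_sub_distrib, b.sum_coord_apply_eq_one, b.sum_coord_apply_eq_one, sub_self]
  · simp only [sub_smul, Finset.sum_sub_distrib]
    have h1 := b.linear_combination_coord_eq_self v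
    have h2 := b.linear_combination_coord_eq_self 0
    change ∑ i, b.coord i v • p i = v at h1
    change ∑ i, b.coord i 0 • p i = 0 at h2
    rw [h1, h2, sub_zero]

theorem seg_base {n : ℕ} {φ : TIValuation n} (h : Simple φ) {v : Rn n}
    (hF : ∀ F, IsConvexBody F → Flat F → φ.val (F + segment ℝ 0 v) = 0)
    (p : Fin (n + 1) → Rn n) {i j : Fin (n + 1)} (hij : i ≠ j) {c : ℝ} (hc : 0 < c) 
    (hv : v = c • (p i - p j)) :
    φ.val (convexHull ℝ (Set.range p) + segment ℝ 0 v) = φ.val (convexHull ℝ (Set.range p)) := by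
  classical
  by_cases hp : AffineIndependent ℝ p
  · obtain ⟨α, c0, hα⟩ := exists_functional hp (fun k => if k = i then 1 / c else 0)
    have hval : ∀ w : Fin (n + 1) → ℝ, ∑ k, w k = 1 → α (∑ k, w k • p k) = w i / c + c0 := by
      intro w hw
      simp only [map_sum, map_smul, hα, smul_eq_mul, mul_add, Finset.sum_add_distrib,
        ← Finset.sum_mul, hw]
      simp [div_eq_mul_inv]
    refine flat_bottom h hF (body_hull p) α c0 ?_ ?_ ?_
    · rw [hv, map_smul, map_sub, hα, hα]
      simp [hij.symm]
      field_simp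
    · intro x hx
      obtain ⟨w, hw0, hw1, rfl⟩ := mem_hull.1 hx
      rw [hval w hw1]
      have := div_nonneg (hw0 i) hc.le
      linarith
    · intro x hx
      obtain ⟨w, hw0, hw1, rfl⟩ := mem_hull.1 hx
      rw [hval w hw1, add_sub_cancel_right, hv, smul_smul, div_mul_cancel₀ _ hc.ne']
      refine mem_hull.2 ⟨fun k => if k = i then 0 else if k = j then w j + w i else w k, ?_, ?_, ?_⟩
      · intro k
        simp only
        split_ifs
        · exact le_rfl
        · exact add_nonneg (hw0 _) (hw0 _)
        · exact hw0 k
      · have : ∀ k, (if k = i then 0 else if k = j then w j + w i else w k) = 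
            w k + (if k = i then - w i else 0) + (if k = j then w i else 0) := by
          intro k
          by_cases hki : k = i
          · subst hki; simp [hij]
          · by_cases hkj : k = j
            · subst hkj; simp [hki]
            · simp [hki, hkj]
        simp only [this, Finset.sum_add_distrib, hw1]
        simp
      · have : ∀ k, (if k = i then 0 else if k = j then w j + w i else w k) • p k = 
            w k • p k + (if k = i then - w i • p i else 0) + (if k = j then w i • p j else 0) := by
          intro k
          by_cases hki : k = i
          · subst hki; simp [hij]
          · by_cases hkj : k = j
            · subst hkj; simp [hki]; module
            · simp [hki, hkj]
        simp only [this, Finset.sum_add_distrib]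
        simp
        module
  · have hFl := flat_hull hp
    rw [hF _ (body_hull p) hFl, h _ (body_hull p) hFl]

theorem sum_update_comb {n : ℕ} (p : Fin (n + 1) → Rn n) (c : Fin (n + 1) → ℝ) 
    {i j : Fin (n + 1)} (hij : i ≠ j) (x : Rn n) (d : ℝ) (hx : d • x = c i • p i + c j • p j) :
    ∑ k, (Function.update (Function.update c i 0) j d) k • (Function.update p j x) k =
      ∑ k, c k • p k := by
  classical
  have : ∀ k, (Function.update (Function.update c i 0) j d) k • (Function.update p j x) k = 
      c k • p k + (if k = i then - (c i • p i) else 0) + (if k = j then d • x - c j • p j else 0) := by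
    intro k
    by_cases hkj : k = j
    · subst hkj; simp [hij.symm]
    · by_cases hki : k = i
      · subst hki; simp [hij]
      · simp [hki, hkj]
  simp only [this, Finset.sum_add_distrib]
  simp [hx]

theorem sum_update_coef {n : ℕ} (c : Fin (n + 1) → ℝ) 
    {i j : Fin (n + 1)} (hij : i ≠ j) :
    ∑ k, (Function.update (Function.update c i 0) j (c i + c j)) k = ∑ k, c k := by
  classical
  have : ∀ k, (Function.update (Function.update c i 0) j (c i + c j)) k = 
      c k + (if k = i then - (c i) else 0) + (if k = j then c i else 0) := by
    intro k
    by_cases hkj : k = j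
    · subst hkj; simp [hij.symm, add_comm]
    · by_cases hki : k = i
      · subst hki; simp [hij]
      · simp [hki, hkj]
  simp only [this, Finset.sum_add_distrib]
  simp

open Classical in
theorem card_update_coef {n : ℕ} (c : Fin (n + 1) → ℝ) 
    {i j : Fin (n + 1)} (hij : i ≠ j) (hi : c i ≠ 0) (hj : c j ≠ 0) (d : ℝ) :
    (Finset.univ.filter fun k => Function.update (Function.update c i 0) j d k ≠ 0).card <
      (Finset.univ.filter fun k => c k ≠ 0).card := by
  apply Finset.card_lt_card
  refine (Finset.ssubset_iff_of_subset ?_).2 ⟨i, by simp [hi], by simp [hij]⟩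
  intro k hk
  simp only [Finset.mem_filter, Finset.mem_univ, true_and] at hk ⊢
  by_cases hkj : k = j
  · subst hkj; exact hj
  · by_cases hki : k = i
    · subst hki; exact hi
    · simpa [hki, hkj] using hk

open Classical in
theorem seg_simplex {n : ℕ} {φ : TIValuation n} (h : Simple φ) {v : Rn n}
    (hF : ∀ F, IsConvexBody F → Flat F → φ.val (F + segment ℝ 0 v) = 0)
    {f : TIValuation n} (hfs : Simple f) (hf : ∀ K, f.val K = φ.val (K + segment ℝ 0 v) - φ.val K)
    (N : ℕ) :
    ∀ (p : Fin (n + 1) → Rn n) (c : Fin (n + 1) → ℝ), ∑ i, c i = 0 → ∑ i, c i • p i = v →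
      (Finset.univ.filter fun i => c i ≠ 0).card ≤ N → f.val (convexHull ℝ (Set.range p)) = 0 := by
  induction N with
  | zero =>
    intro p c _ hv hN
    have : ∀ i, c i = 0 := by
      intro i
      by_contra hcon
      have : i ∈ (Finset.univ.filter fun i => c i ≠ 0) := by simp [hcon]
      rw [Finset.card_eq_zero.1 (Nat.le_zero.1 hN)] at this
      simp at this
    have hv0 : v = 0 := by rw [← hv]; simp [this]
    rw [hf, hv0]; simp
  | succ N ih =>
    intro p c hc hv hN
    by_cases hex : ∃ i j, i ≠ j ∧ 0 < c i * c j
    · obtain ⟨i, j, hij, hpos⟩ := hex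
      have hi : c i ≠ 0 := by rintro h0; simp [h0] at hpos
      have hj : c j ≠ 0 := by rintro h0; simp [h0] at hpos
      have hsum : c i + c j ≠ 0 := by
        intro h0
        have : c j = - c i := by linarith
        rw [this] at hpos
        nlinarith [sq_nonneg (c i)]
      set θ := c j / (c i + c j) with hθ
      have h1θ : 1 - θ = c i / (c i + c j) := by rw [hθ]; field_simp; ring
      have hposs : 0 < θ ∧ 0 < 1 - θ := by
        rw [h1θ, hθ]
        rcases lt_or_gt_of_ne hi with hi' | hi'
        · have hj' : c j < 0 := by nlinarith
          exact ⟨div_pos_of_neg_of_neg hj' (by linarith), div_pos_of_neg_of_neg hi' (by linarith)⟩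
        · have hj' : 0 < c j := by nlinarith
          exact ⟨div_pos hj' (by linarith), div_pos hi' (by linarith)⟩
      have hx : (c i + c j) • ((1 - θ) • p i + θ • p j) = c i • p i + c j • p j := by
        rw [h1θ, hθ, smul_add, smul_smul, smul_smul, mul_div_cancel₀ _ hsum, mul_div_cancel₀ _ hsum]
      have hcut := hfs.toCut.edge p hij hposs.1 (by linarith [hposs.2])
      rw [ext0_body f (body_hull p), ext0_body f (body_hull _), ext0_body f (body_hull _)] at hcut
      rw [hcut, ih _ (Function.update (Function.update c i 0) j (c i + c j)), 
        ih _ (Function.update (Function.update c j 0) i (c j + c i)), add_zero]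
      · rw [sum_update_coef c hij.symm, hc]
      · rw [sum_update_comb p c hij.symm, hv]
        rw [add_comm (c j), hx, add_comm]
      · exact Nat.le_of_lt_succ (lt_of_lt_of_le (card_update_coef c hij.symm hj hi _) hN)
      · rw [sum_update_coef c hij, hc]
      · rw [sum_update_comb p c hij _ _ hx, hv]
      · exact Nat.le_of_lt_succ (lt_of_lt_of_le (card_update_coef c hij hi hj _) hN)
    · push Not at hex
      by_cases hall : ∀ i, c i = 0
      · have hv0 : v = 0 := by rw [← hv]; simp [hall]
        rw [hf, hv0]; simp
      · have hex1 : ∃ i, 0 < c i := by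
          by_contra hcon
          push Not at hcon
          apply hall
          intro i
          exact (Finset.sum_eq_zero_iff_of_nonpos (fun k _ => hcon k)).1 hc i (Finset.mem_univ i)
        have hex2 : ∃ j, c j < 0 := by
          by_contra hcon
          push Not at hcon
          apply hall
          intro i
          exact (Finset.sum_eq_zero_iff_of_nonneg (fun k _ => hcon k)).1 hc i (Finset.mem_univ i)
        obtain ⟨i, hi⟩ := hex1
        obtain ⟨j, hj⟩ := hex2
        have hij : i ≠ j := by rintro rfl; linarith
        have hzero : ∀ k, k ≠ i → k ≠ j → c k = 0 := by
          intro k hki hkj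
          have h1 := hex k i hki
          have h2 := hex k j hkj
          nlinarith
        have hc' : ∀ k, c k = (if k = i then c i else 0) + (if k = j then c j else 0) := by
          intro k
          by_cases hki : k = i
          · subst hki; simp [hij]
          · by_cases hkj : k = j
            · subst hkj; simp [hki]
            · simp [hki, hkj, hzero k hki hkj]
        have hcij : c j = - c i := by
          have : ∑ k, c k = c i + c j := by
            conv_lhs => arg 2; ext k; rw [hc' k]
            rw [Finset.sum_add_distrib]; simp
          linarith
        have hvv : v = c i • (p i - p j) := by
          rw [← hv]
          conv_lhs => arg 2; ext k; rw [hc' k]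
          simp only [add_smul, Finset.sum_add_distrib, ite_smul, zero_smul]
          simp [hcij]
          module
        rw [hf, seg_base h hF p hij hi hvv, sub_self]

theorem seg_invariance {n : ℕ} {φ : TIValuation n} (h : Simple φ) {v : Rn n}
    (hF : ∀ F, IsConvexBody F → Flat F → φ.val (F + segment ℝ 0 v) = 0)
    {K : Set (Rn n)} (hK : IsConvexBody K) : φ.val (K + segment ℝ 0 v) = φ.val K := by
  let f := comb 1 (-1) 0 (pull φ (ContinuousLinearMap.id ℝ (Rn n)) (segment ℝ 0 v)
    (body_segment 0 v)) φ
  have hf : ∀ K, f.val K = φ.val (K + segment ℝ 0 v) - φ.val K := by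
    intro K
    simp [f]; ring
  have hfs : Simple f := by
    intro K hK hFl
    rw [hf, hF K hK hFl, h K hK hFl, sub_zero]
  have h0 := vanish_of_simplex hfs (fun p => by
    by_cases hp : AffineIndependent ℝ p
    · obtain ⟨c, hc, hv⟩ := exists_coeffs hp v
      exact seg_simplex h hF hfs hf _ p c hc hv le_rfl
    · exact hfs _ (body_hull p) (flat_hull hp)) hK
  rw [hf] at h0
  exact sub_eq_zero.1 h0

end KS

namespace KS

/-! ### Support functions -/

def IsSupp {n : ℕ} (Z : Set (Rn n)) (g : Rn n → ℝ) : Prop :=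
  (∀ x ∈ Z, ∀ u, inner ℝ x u ≤ g u) ∧ (∀ u, ∃ x ∈ Z, inner ℝ x u = g u)

def Sub {n : ℕ} (g : Rn n → ℝ) : Prop :=
  (∀ u v, g (u + v) ≤ g u + g v) ∧ (∀ t : ℝ, 0 ≤ t → ∀ u, g (t • u) = t * g u)

theorem IsSupp.sub {n : ℕ} {Z : Set (Rn n)} {g : Rn n → ℝ} (h : IsSupp Z g) : Sub g := by
  constructor
  · intro u v
    obtain ⟨x, hx, he⟩ := h.2 (u + v)
    rw [← he, inner_add_right]
    exact add_le_add (h.1 x hx u) (h.1 x hx v)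
  · intro t ht u
    apply le_antisymm
    · obtain ⟨x, hx, he⟩ := h.2 (t • u)
      rw [← he, real_inner_smul_right]
      exact mul_le_mul_of_nonneg_left (h.1 x hx u) ht
    · obtain ⟨x, hx, he⟩ := h.2 u
      rw [← he, ← real_inner_smul_right]
      exact h.1 x hx _

theorem body_supp {n : ℕ} {Z : Set (Rn n)} (hZ : IsConvexBody Z) : ∃ g, IsSupp Z g := by
  have : ∀ u : Rn n, ∃ x ∈ Z, ∀ y ∈ Z, inner ℝ y u ≤ inner ℝ x u := fun u =>
    hZ.2.1.exists_isMaxOn hZ.1 (f := fun y => inner ℝ y u) (by fun_prop)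
  choose x hx hm using this
  exact ⟨fun u => inner ℝ (x u) u, fun y hy u => hm u y hy, fun u => ⟨x u, hx u, rfl⟩⟩

theorem IsSupp.add {n : ℕ} {Z Z' : Set (Rn n)} {g g' : Rn n → ℝ} (h : IsSupp Z g)
    (h' : IsSupp Z' g') : IsSupp (Z + Z') (fun u => g u + g' u) := by
  constructor
  · rintro _ ⟨x, hx, y, hy, rfl⟩ u
    simp only [inner_add_left]
    exact add_le_add (h.1 x hx u) (h'.1 y hy u)
  · intro u
    obtain ⟨x, hx, he⟩ := h.2 u
    obtain ⟨y, hy, he'⟩ := h'.2 u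
    exact ⟨x + y, Set.add_mem_add hx hy, by rw [inner_add_left, he, he']⟩

theorem IsSupp.smul {n : ℕ} {Z : Set (Rn n)} {g : Rn n → ℝ} (h : IsSupp Z g) {t : ℝ}
    (ht : 0 ≤ t) : IsSupp (t • Z) (fun u => t * g u) := by
  constructor
  · rintro _ ⟨x, hx, rfl⟩ u
    simp only [real_inner_smul_left]
    exact mul_le_mul_of_nonneg_left (h.1 x hx u) ht
  · intro u
    obtain ⟨x, hx, he⟩ := h.2 u
    exact ⟨t • x, Set.smul_mem_smul_set hx, by rw [real_inner_smul_left, he]⟩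

theorem IsSupp.image {m n : ℕ} {Z : Set (Rn m)} {g : Rn m → ℝ} (h : IsSupp Z g)
    (P : Rn n →L[ℝ] Rn m) : IsSupp (P.adjoint '' Z) (fun u => g (P u)) := by
  constructor
  · rintro _ ⟨x, hx, rfl⟩ u
    rw [ContinuousLinearMap.adjoint_inner_left]
    exact h.1 x hx _
  · intro u
    obtain ⟨x, hx, he⟩ := h.2 (P u)
    exact ⟨_, ⟨x, hx, rfl⟩, by rw [ContinuousLinearMap.adjoint_inner_left, he]⟩

theorem Sub.zero {n : ℕ} {g : Rn n → ℝ} (h : Sub g) : g 0 = 0 := by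
  have := h.2 0 le_rfl 0
  simpa using this

theorem Sub.neg_le {n : ℕ} {g : Rn n → ℝ} (h : Sub g) (u : Rn n) : - g (-u) ≤ g u := by
  have := h.1 u (-u)
  rw [add_neg_cancel, h.zero] at this
  linarith

theorem Sub.sum_le {n : ℕ} {g : Rn n → ℝ} (h : Sub g) {ι : Type*} (s : Finset ι)
    (f : ι → Rn n) : g (∑ i ∈ s, f i) ≤ ∑ i ∈ s, g (f i) := by
  classical
  induction s using Finset.induction_on with
  | empty => simp [h.zero]
  | insert a s ha ih =>
    rw [Finset.sum_insert ha, Finset.sum_insert ha]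
    exact (h.1 _ _).trans (by linarith)

theorem Sub.bound {n : ℕ} {g : Rn n → ℝ} (h : Sub g) :
    ∃ C : ℝ, 0 ≤ C ∧ ∀ u, |g u| ≤ C * ‖u‖ := by
  have key : ∃ C : ℝ, 0 ≤ C ∧ ∀ u, g u ≤ C * ‖u‖ := by
    let b := EuclideanSpace.basisFun (Fin n) ℝ
    refine ⟨∑ i, (|g (b i)| + |g (-b i)|), by positivity, fun u => ?_⟩
    have h1 : u = ∑ i, u i • b i := by
      have := b.sum_repr u
      simpa [b] using this.symm
    calc g u = g (∑ i, u i • b i) := by rw [← h1]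
      _ ≤ ∑ i, g (u i • b i) := h.sum_le _ _
      _ ≤ ∑ i, (|g (b i)| + |g (-b i)|) * ‖u‖ := by
        apply Finset.sum_le_sum
        intro i _
        have hu : |u i| ≤ ‖u‖ := by
          have := PiLp.norm_apply_le u i
          simpa using this
        rcases le_total 0 (u i) with h0 | h0
        · rw [h.2 _ h0]
          rw [abs_of_nonneg h0] at hu
          calc u i * g (b i) ≤ u i * |g (b i)| := by gcongr; exact le_abs_self _
            _ ≤ ‖u‖ * |g (b i)| := by gcongr
            _ ≤ _ := by nlinarith [abs_nonneg (g (-b i)), norm_nonneg u]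
        · have e : u i • b i = (-u i) • (-b i) := by simp
          rw [e, h.2 _ (by linarith)]
          rw [abs_of_nonpos h0] at hu
          have : 0 ≤ -u i := by linarith
          calc -u i * g (-b i) ≤ -u i * |g (-b i)| := by gcongr; exact le_abs_self _
            _ ≤ ‖u‖ * |g (-b i)| := by gcongr
            _ ≤ _ := by nlinarith [abs_nonneg (g (b i)), norm_nonneg u]
      _ = _ := by rw [Finset.sum_mul]
  obtain ⟨C, hC, hb⟩ := key
  refine ⟨C, hC, fun u => abs_le.2 ⟨?_, hb u⟩⟩
  have := hb (-u)
  rw [norm_neg] at this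
  linarith [h.neg_le u]

theorem Sub.lip {n : ℕ} {g : Rn n → ℝ} (h : Sub g) :
    ∃ C : ℝ, 0 ≤ C ∧ (∀ u, |g u| ≤ C * ‖u‖) ∧ ∀ u v, |g u - g v| ≤ C * ‖u - v‖ := by
  obtain ⟨C, hC, hb⟩ := h.bound
  refine ⟨C, hC, hb, fun u v => ?_⟩
  have h1 := h.1 (u - v) v
  have h2 := h.1 (v - u) u
  rw [sub_add_cancel] at h1 h2
  have h3 := (le_abs_self _).trans (hb (u - v))
  have h4 := (le_abs_self _).trans (hb (v - u))
  rw [norm_sub_rev v u] at h4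
  rw [abs_le]
  constructor <;> linarith

theorem Sub.continuous {n : ℕ} {g : Rn n → ℝ} (h : Sub g) : Continuous g := by
  obtain ⟨C, hC, -, hl⟩ := h.lip
  refine LipschitzWith.continuous (K := ⟨C, hC⟩) (LipschitzWith.of_dist_le_mul fun u v => ?_)
  rw [Real.dist_eq, dist_eq_norm]
  exact hl u v

theorem Sub.exists_body {n : ℕ} {g : Rn n → ℝ} (h : Sub g) : ∃ Z, IsConvexBody Z ∧ IsSupp Z g := by
  obtain ⟨C, hC, hb⟩ := h.bound
  have hex : ∀ u, ∃ x : Rn n, (∀ v, inner ℝ x v ≤ g v) ∧ inner ℝ x u = g u := by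
    intro u
    obtain ⟨f, hf1, hf2⟩ : ∃ f : Rn n →ₗ[ℝ] ℝ, f u = g u ∧ ∀ v, f v ≤ g v := by
      rcases eq_or_ne u 0 with rfl | hu
      · obtain ⟨f, hf1, hf2⟩ := exists_extension_of_le_sublinear
          (⟨⊥, 0⟩ : Rn n →ₗ.[ℝ] ℝ) g (fun c hc x => h.2 c hc.le x) h.1 (by
            rintro ⟨x, hx⟩
            have : x = 0 := by simpa using hx
            subst this
            simp [h.zero])
        exact ⟨f, by simp [h.zero], hf2⟩
      · obtain ⟨f, hf1, hf2⟩ := exists_extension_of_le_sublinear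
          (LinearPMap.mkSpanSingleton u (g u) hu) g (fun c hc x => h.2 c hc.le x) h.1 (by
            rintro ⟨x, hx⟩
            obtain ⟨t, rfl⟩ := Submodule.mem_span_singleton.1 hx
            have e0 : LinearPMap.mkSpanSingleton u (g u) hu ⟨t • u, hx⟩ = t * g u :=
              LinearPMap.mkSpanSingleton'_apply u (g u) _ t hx
            rw [e0]
            change t * g u ≤ g (t • u)
            rcases le_total 0 t with ht | ht
            · rw [h.2 t ht]
            · have e : t • u = (-t) • (-u) := by simp
              rw [e, h.2 _ (by linarith)]
              nlinarith [h.neg_le u])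
        refine ⟨f, ?_, hf2⟩
        have := hf1 ⟨u, Submodule.mem_span_singleton_self u⟩
        rw [this]
        exact LinearPMap.mkSpanSingleton_apply ℝ ℝ hu (g u)
    let x := (InnerProductSpace.toDual ℝ (Rn n)).symm (LinearMap.toContinuousLinearMap f)
    have hx : ∀ v, inner ℝ x v = f v := fun v => by
      simp [x]
    exact ⟨x, fun v => (hx v).trans_le (hf2 v), (hx u).trans hf1⟩
  refine ⟨{x | ∀ v, inner ℝ x v ≤ g v}, ⟨?_, ?_, ?_⟩, ?_, ?_⟩
  · obtain ⟨x, hx, -⟩ := hex 0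
    exact ⟨x, hx⟩
  · apply Metric.isCompact_of_isClosed_isBounded
    · have : {x : Rn n | ∀ v, inner ℝ x v ≤ g v} = ⋂ v, {x | inner ℝ x v ≤ g v} := by
        ext; simp
      rw [this]
      exact isClosed_iInter fun v => isClosed_le (by fun_prop) continuous_const
    · refine (Metric.isBounded_closedBall (x := (0 : Rn n)) (r := C)).subset ?_
      intro x hx
      have h1 := (hx x).trans ((le_abs_self _).trans (hb x))
      rw [real_inner_self_eq_norm_sq] at h1
      rw [mem_closedBall_zero_iff]
      by_contra hc
      push Not at hc
      nlinarith [norm_nonneg x]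
  · intro x hx y hy a b ha hb' hab v
    rw [inner_add_left, real_inner_smul_left, real_inner_smul_left]
    have := hx v
    have := hy v
    calc a * inner ℝ x v + b * inner ℝ y v ≤ a * g v + b * g v := by gcongr
      _ = g v := by rw [← add_mul, hab, one_mul]
  · exact fun x hx => hx
  · exact fun u => (hex u).imp fun x hx => hx

theorem supp_hd {n : ℕ} {Z Z' : Set (Rn n)} {g g' : Rn n → ℝ} (hZ : IsConvexBody Z)
    (hZ' : IsConvexBody Z') (h : IsSupp Z g) (h' : IsSupp Z' g') {δ : ℝ} (hδ : 0 ≤ δ)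
    (hg : ∀ u, |g u - g' u| ≤ δ * ‖u‖) : hausdorffDist Z Z' ≤ δ := by
  have key : ∀ (Z Z' : Set (Rn n)) (g g' : Rn n → ℝ), IsConvexBody Z' → IsSupp Z g →
      IsSupp Z' g' → (∀ u, |g u - g' u| ≤ δ * ‖u‖) → ∀ x ∈ Z, ∃ y ∈ Z', dist x y ≤ δ := by
    intro Z Z' g g' hZ' h h' hg x hx
    obtain ⟨y, hy, he⟩ := exists_norm_eq_iInf_of_complete_convex hZ'.1 hZ'.2.1.isComplete
      hZ'.2.2 x
    have hp := (norm_eq_iInf_iff_real_inner_le_zero hZ'.2.2 hy).1 he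
    refine ⟨y, hy, ?_⟩
    obtain ⟨z, hz, hze⟩ := h'.2 (x - y)
    have h1 := hp z hz
    have h2 := h.1 x hx (x - y)
    have h3 := (abs_le.1 (hg (x - y))).2
    rw [inner_sub_right, real_inner_comm, hze, real_inner_comm] at h1
    have h4 : inner ℝ x (x - y) - inner ℝ y (x - y) = ‖x - y‖ ^ 2 := by
      rw [← inner_sub_left, real_inner_self_eq_norm_sq]
    rw [dist_eq_norm]
    by_contra hc
    push Not at hc
    nlinarith [norm_nonneg (x - y)]
  refine hd_le hδ (key Z Z' g g' hZ' h h' hg) (key Z' Z g' g hZ h' h fun u => ?_)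
  rw [abs_sub_comm]; exact hg u

theorem supp_unique {n : ℕ} {Z Z' : Set (Rn n)} {g : Rn n → ℝ} (hZ : IsConvexBody Z)
    (hZ' : IsConvexBody Z') (h : IsSupp Z g) (h' : IsSupp Z' g) : Z = Z' := by
  have key : ∀ (Z Z' : Set (Rn n)), IsConvexBody Z → IsConvexBody Z' → IsSupp Z g →
      IsSupp Z' g → Z ⊆ Z' := by
    intro Z Z' hZ hZ' h h' x hx
    obtain ⟨y, hy, hd⟩ := exists_dist_le_hd hZ hZ' hx
    have := supp_hd hZ hZ' h h' le_rfl (fun u => by simp)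
    have h0 : dist x y = 0 := le_antisymm (hd.trans this) dist_nonneg
    rw [dist_eq_zero.1 h0]; exact hy
  exact (key _ _ hZ hZ' h h').antisymm (key _ _ hZ' hZ h' h)

/-- abstract class of support functions -/
structure Cls (n : ℕ) (G : (Rn n → ℝ) → Prop) : Prop where
  sub : ∀ g, G g → Sub g
  add : ∀ g g', G g → G g' → G (fun u => g u + g' u)
  smul : ∀ (t : ℝ) g, 0 ≤ t → G g → G (fun u => t * g u)
  lim : ∀ g, Sub g → (∀ δ : ℝ, 0 < δ → ∃ g', G g' ∧ ∀ u, |g' u - g u| ≤ δ * ‖u‖) → G g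
  cancel : ∀ g g1 g2, Sub g → G g1 → G g2 → (∀ u, g u + g1 u = g2 u) → G g
  planar : ∀ (g : Rn 2 → ℝ) (P : Rn n →L[ℝ] Rn 2), Sub g → G (fun u => g (P u))

theorem cls_of_val {n : ℕ} (φ : TIValuation n) (ε : ℝ)
    (h : ∀ K, IsConvexBody K → ∀ L, IsConvexBody L → ∀ ι : Rn 2 →L[ℝ] Rn n,
      φ.val (K + (ι '' L + ε • (ι '' L))) = φ.val K) :
    Cls n (fun g => ∃ Z, IsConvexBody Z ∧ IsSupp Z g ∧ ∀ K, IsConvexBody K → ∀ t : ℝ, 0 ≤ t →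
      φ.val (K + (t • Z + ε • (t • Z))) = φ.val K) := by
  have hD : ∀ (Z : Set (Rn n)) (t : ℝ), IsConvexBody Z → IsConvexBody (t • Z + ε • (t • Z)) :=
    fun Z t hZ => body_add (body_smul _ hZ) (body_smul _ (body_smul _ hZ))
  have hsum : ∀ (K Z Z' : Set (Rn n)) (t : ℝ), K + (t • (Z + Z') + ε • (t • (Z + Z'))) =
      (K + (t • Z + ε • (t • Z))) + (t • Z' + ε • (t • Z')) := by
    intro K Z Z' t
    rw [smul_add, smul_add]; abel
  refine ⟨?_, ?_, ?_, ?_, ?_, ?_⟩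
  · rintro g ⟨Z, hZ, hs, -⟩
    exact hs.sub
  · rintro g g' ⟨Z, hZ, hs, hi⟩ ⟨Z', hZ', hs', hi'⟩
    refine ⟨Z + Z', body_add hZ hZ', hs.add hs', fun K hK t ht => ?_⟩
    rw [hsum, hi' _ (body_add hK (hD Z t hZ)) t ht, hi K hK t ht]
  · rintro s g hs ⟨Z, hZ, hsu, hi⟩
    refine ⟨s • Z, body_smul s hZ, hsu.smul hs, fun K hK t ht => ?_⟩
    rw [smul_smul t s]
    exact hi K hK _ (mul_nonneg ht hs)
  · intro g hg hlim
    obtain ⟨Z, hZ, hs⟩ := hg.exists_body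
    refine ⟨Z, hZ, hs, fun K hK t ht => ?_⟩
    have : ∀ i : ℕ, ∃ Zi, IsConvexBody Zi ∧ hausdorffDist Zi Z ≤ 1 / ((i : ℝ) + 1) ∧
        φ.val (K + (t • Zi + ε • (t • Zi))) = φ.val K := by
      intro i
      obtain ⟨g', ⟨Zi, hZi, hsi, hii⟩, hclose⟩ := hlim (1 / ((i : ℝ) + 1)) (by positivity)
      exact ⟨Zi, hZi, supp_hd hZi hZ hsi hs (by positivity) hclose, hii K hK t ht⟩
    choose Zi hZi hdi hvi using this
    have hc : Conv Zi Z := Conv.of_le hdi tendsto_one_div_add_atTop_nhds_zero_nat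
    have hmain : ∀ (A B : Set (Rn n)), IsConvexBody A → IsConvexBody B →
      hausdorffDist (K + (t • A + ε • (t • A))) (K + (t • B + ε • (t • B))) ≤
        (|t| + |ε| * |t|) * hausdorffDist A B := by
      have key : ∀ (A B : Set (Rn n)), IsConvexBody A → IsConvexBody B →
          ∀ x ∈ K + (t • A + ε • (t • A)), ∃ y ∈ K + (t • B + ε • (t • B)),
            dist x y ≤ (|t| + |ε| * |t|) * hausdorffDist A B := by
        rintro A B hA hB _ ⟨k, hk, _, ⟨_, ⟨a, ha, rfl⟩, _, ⟨_, ⟨a', ha', rfl⟩, rfl⟩, rfl⟩, rfl⟩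
        obtain ⟨b, hb, hbd⟩ := exists_dist_le_hd hA hB ha
        obtain ⟨b', hb', hbd'⟩ := exists_dist_le_hd hA hB ha'
        refine ⟨k + (t • b + ε • (t • b')), ⟨k, hk, _, ⟨_, ⟨b, hb, rfl⟩, _, ⟨_, ⟨b', hb', rfl⟩,
          rfl⟩, rfl⟩, rfl⟩, ?_⟩
        simp only [dist_add_left]
        refine (dist_add_add_le _ _ _ _).trans ?_
        simp only [dist_smul₀, Real.norm_eq_abs]
        rw [add_mul, mul_assoc]
        gcongr
      intro A B hA hB
      refine hd_le (mul_nonneg (by positivity) hausdorffDist_nonneg) (key A B hA hB) ?_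
      rw [hausdorffDist_comm]
      exact key B A hB hA
    have h1 := φ.continuity (fun i => K + (t • Zi i + ε • (t • Zi i))) (K + (t • Z + ε • (t • Z)))
      (fun i => body_add hK (hD _ t (hZi i))) (body_add hK (hD _ t hZ))
      (Conv.of_le (fun i => hmain _ _ (hZi i) hZ) (by simpa using hc.const_mul (|t| + |ε| * |t|)))
    simp only [hvi] at h1
    exact tendsto_nhds_unique h1 tendsto_const_nhds
  · rintro g g1 g2 hg ⟨Z1, hZ1, hs1, hi1⟩ ⟨Z2, hZ2, hs2, hi2⟩ he
    obtain ⟨Z, hZ, hs⟩ := hg.exists_body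
    have : Z + Z1 = Z2 := by
      refine supp_unique (body_add hZ hZ1) hZ2 (hs.add hs1) ?_
      have : (fun u => g u + g1 u) = g2 := funext he
      rwa [this]
    refine ⟨Z, hZ, hs, fun K hK t ht => ?_⟩
    rw [← hi1 _ (body_add hK (hD Z t hZ)) t ht, ← hsum, this, hi2 K hK t ht]
  · intro g P hg
    obtain ⟨Z, hZ, hs⟩ := hg.exists_body
    refine ⟨P.adjoint '' Z, body_image _ hZ, hs.image P, fun K hK t ht => ?_⟩
    have e : t • (P.adjoint '' Z) = P.adjoint '' (t • Z) := by
      rw [smul_eq_image, smul_eq_image, Set.image_image, Set.image_image]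
      simp
    rw [e]
    exact h K hK _ (body_smul t hZ) _

end KS

namespace KS

theorem Sub.smul {n : ℕ} {g : Rn n → ℝ} (h : Sub g) {t : ℝ} (ht : 0 ≤ t) :
    Sub (fun u => t * g u) := by
  constructor
  · intro u v
    rw [← mul_add]
    exact mul_le_mul_of_nonneg_left (h.1 u v) ht
  · intro s hs u
    simp only [h.2 s hs u]; ring

theorem Sub.add {n : ℕ} {g g' : Rn n → ℝ} (h : Sub g) (h' : Sub g') :
    Sub (fun u => g u + g' u) := by
  constructor
  · intro u v
    have := h.1 u v
    have := h'.1 u v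
    linarith
  · intro s hs u
    simp only [h.2 s hs u, h'.2 s hs u]; ring

theorem Sub.comp {m n : ℕ} {g : Rn m → ℝ} (h : Sub g) (P : Rn n →ₗ[ℝ] Rn m) :
    Sub (fun u => g (P u)) := by
  constructor
  · intro u v
    simp only [map_add]
    exact h.1 _ _
  · intro s hs u
    simp only [map_smul]
    exact h.2 s hs _

theorem hom_ext {n : ℕ} {g g' : Rn n → ℝ} (h : Sub g) (h' : Sub g') {δ : ℝ}
    (hd : ∀ u, ‖u‖ = 1 → |g u - g' u| ≤ δ) (u : Rn n) : |g u - g' u| ≤ δ * ‖u‖ := by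
  rcases eq_or_ne u 0 with rfl | hu
  · simp [h.zero, h'.zero]
  · have hn : 0 < ‖u‖ := norm_pos_iff.2 hu
    have e : u = ‖u‖ • (‖u‖⁻¹ • u) := by
      rw [smul_smul, mul_inv_cancel₀ hn.ne', one_smul]
    have h1 : ‖‖u‖⁻¹ • u‖ = 1 := by
      rw [norm_smul, norm_inv, norm_norm, inv_mul_cancel₀ hn.ne']
    have h2 := hd _ h1
    have e1 : g u = ‖u‖ * g (‖u‖⁻¹ • u) := by
      conv_lhs => rw [e]
      exact h.2 _ hn.le _
    have e2 : g' u = ‖u‖ * g' (‖u‖⁻¹ • u) := by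
      conv_lhs => rw [e]
      exact h'.2 _ hn.le _
    rw [e1, e2, ← mul_sub, abs_mul, abs_of_pos hn, mul_comm δ]
    gcongr

theorem hom_eq {n : ℕ} {g g' : Rn n → ℝ} (h : Sub g) (h' : Sub g') 
    (hd : ∀ u, ‖u‖ = 1 → g u = g' u) (u : Rn n) : g u = g' u := by
  have := hom_ext h h' (δ := 0) (fun u hu => by simp [hd u hu]) u
  rw [zero_mul] at this
  exact sub_eq_zero.1 (abs_eq_zero.1 (le_antisymm this (abs_nonneg _)))

section
variable {n : ℕ} {G : (Rn n → ℝ) → Prop}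

theorem sub_integral {Ω : Type*} [TopologicalSpace Ω] [MeasurableSpace Ω]
    [OpensMeasurableSpace Ω] [SecondCountableTopology Ω] (μ : Measure Ω) 
    (F : Ω → Rn n → ℝ) (hF : Continuous (Function.uncurry F)) (hG : ∀ ω, Sub (F ω))
    (b : Ω → ℝ) (hb : Integrable b μ) (hFb : ∀ ω u, |F ω u| ≤ b ω * ‖u‖) :
    Sub (fun u => ∫ ω, F ω u ∂μ) := by
  have hi : ∀ u, Integrable (fun ω => F ω u) μ := fun u =>
    (hb.mul_const ‖u‖).mono' (Continuous.aestronglyMeasurable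
      (hF.comp (Continuous.prodMk_left u))) (ae_of_all _ fun ω => hFb ω u)
  constructor
  · intro u v
    rw [← integral_add (hi u) (hi v)]
    exact integral_mono (hi _) ((hi u).add (hi v)) fun ω => (hG ω).1 u v
  · intro t ht u
    rw [← integral_const_mul]
    exact integral_congr_ae (ae_of_all _ fun ω => (hG ω).2 t ht u)

theorem Cls.integral (hC : Cls n G) {Ω : Type*} [TopologicalSpace Ω] [MeasurableSpace Ω]
    [OpensMeasurableSpace Ω] [SecondCountableTopology Ω] (μ : Measure Ω) [IsProbabilityMeasure μ]
    (F : Ω → Rn n → ℝ) (hF : Continuous (Function.uncurry F)) (hG : ∀ ω, G (F ω))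
    (b : Ω → ℝ) (hb : Integrable b μ) (hFb : ∀ ω u, |F ω u| ≤ b ω * ‖u‖) :
    G (fun u => ∫ ω, F ω u ∂μ) := by
  have hsub := sub_integral μ F hF (fun ω => hC.sub _ (hG ω)) b hb hFb
  refine hC.lim _ hsub fun δ hδ => ?_
  let S := sphere (0 : Rn n) 1
  let c0 : C(Ω × S, ℝ) := ⟨fun p => F p.1 p.2.1, hF.comp
    (continuous_fst.prodMk (continuous_subtype_val.comp continuous_snd))⟩
  let f : C(Ω, C(S, ℝ)) := c0.curry
  have hfi : Integrable f μ := by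
    refine hb.norm.mono' f.continuous.aestronglyMeasurable (ae_of_all _ fun ω => ?_)
    rw [ContinuousMap.norm_le _ (norm_nonneg _)]
    rintro ⟨x, hx⟩
    have := hFb ω x
    rw [mem_sphere_zero_iff_norm.1 hx, mul_one] at this
    exact this.trans (le_abs_self _)
  let T : Set C(S, ℝ) := {f | ∃ g, G g ∧ ∀ s : S, f s = g s}
  have hT : Convex ℝ T := by
    rintro f ⟨g, hg, hfg⟩ f' ⟨g', hg', hfg'⟩ a a' ha ha' -
    exact ⟨_, hC.add _ _ (hC.smul a g ha hg) (hC.smul a' g' ha' hg'), fun s => by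
      simp [hfg, hfg']⟩
  have hmem := hT.closure.integral_mem isClosed_closure
    (ae_of_all μ fun ω => subset_closure ⟨F ω, hG ω, fun s => rfl⟩) hfi
  obtain ⟨f', ⟨g, hg, hfg⟩, hd⟩ := Metric.mem_closure_iff.1 hmem δ hδ
  refine ⟨g, hg, hom_ext (hC.sub _ hg) hsub fun u hu => ?_⟩
  have h1 : (∫ ω, f ω ∂μ) ⟨u, mem_sphere_zero_iff_norm.2 hu⟩ = ∫ ω, F ω u ∂μ := 
    ContinuousMap.integral_apply hfi _
  have h2 := (ContinuousMap.dist_apply_le_dist (f := ∫ ω, f ω ∂μ) (g := f')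
    ⟨u, mem_sphere_zero_iff_norm.2 hu⟩).trans hd.le
  rw [h1, hfg, dist_comm] at h2
  exact h2

/-- differences -/
def D0 (G : (Rn n → ℝ) → Prop) (f : Rn n → ℝ) : Prop :=
  ∃ g1 g2, G g1 ∧ G g2 ∧ ∀ u, ‖u‖ = 1 → f u = g1 u - g2 u

theorem Cls.zero (hC : Cls n G) : G (fun _ => 0) :=
  hC.planar (fun _ => 0) 0 ⟨by simp, by simp⟩

theorem D0.of (hC : Cls n G) {g : Rn n → ℝ} (hg : G g) : D0 G g :=
  ⟨g, _, hg, hC.zero, by simp⟩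

theorem D0.congr {f f' : Rn n → ℝ} (h : D0 G f) (he : ∀ u, ‖u‖ = 1 → f' u = f u) : D0 G f' := by
  obtain ⟨g1, g2, h1, h2, h3⟩ := h
  exact ⟨g1, g2, h1, h2, fun u hu => (he u hu).trans (h3 u hu)⟩

theorem D0.add (hC : Cls n G) {f f' : Rn n → ℝ} (h : D0 G f) (h' : D0 G f') :
    D0 G (fun u => f u + f' u) := by
  obtain ⟨g1, g2, h1, h2, h3⟩ := h
  obtain ⟨g1', g2', h1', h2', h3'⟩ := h'
  exact ⟨_, _, hC.add _ _ h1 h1', hC.add _ _ h2 h2', fun u hu => by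
    simp only [h3 u hu, h3' u hu]; ring⟩

theorem D0.smul (hC : Cls n G) {f : Rn n → ℝ} (h : D0 G f) (t : ℝ) :
    D0 G (fun u => t * f u) := by
  obtain ⟨g1, g2, h1, h2, h3⟩ := h
  rcases le_total 0 t with ht | ht
  · exact ⟨_, _, hC.smul t _ ht h1, hC.smul t _ ht h2, fun u hu => by
        simp only [h3 u hu]; ring⟩
  · exact ⟨_, _, hC.smul (-t) _ (by linarith) h2, hC.smul (-t) _ (by linarith) h1,
      fun u hu => by
        simp only [h3 u hu]; ring⟩

theorem D0.sub (hC : Cls n G) {f f' : Rn n → ℝ} (h : D0 G f) (h' : D0 G f') :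
    D0 G (fun u => f u - f' u) :=
  (h.add hC (h'.smul hC (-1))).congr fun u _ => by ring

theorem D0.mem (hC : Cls n G) {g : Rn n → ℝ} (h : D0 G g) (hs : Sub g) : G g := by
  obtain ⟨g1, g2, h1, h2, h3⟩ := h
  refine hC.cancel g g2 g1 hs h2 h1 (hom_eq (hs.add (hC.sub _ h2)) (hC.sub _ h1) fun u hu => ?_)
  rw [h3 u hu]; ring

/-- signed weights -/
theorem D0.integral (hC : Cls n G) {Ω : Type*} [TopologicalSpace Ω] [MeasurableSpace Ω]
    [OpensMeasurableSpace Ω] [SecondCountableTopology Ω] (μ : Measure Ω) [IsProbabilityMeasure μ]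
    (F : Ω → Rn n → ℝ) (hF : Continuous (Function.uncurry F)) (hG : ∀ ω, G (F ω))
    (w : Ω → ℝ) (hw : Continuous w)
    (b : Ω → ℝ) (hb : Integrable b μ) (hFb : ∀ ω u, |w ω| * |F ω u| ≤ b ω * ‖u‖) :
    D0 G (fun u => ∫ ω, w ω * F ω u ∂μ) := by
  have key : ∀ v : Ω → ℝ, Continuous v → (∀ ω, 0 ≤ v ω) → (∀ ω, v ω ≤ |w ω|) →
      G (fun u => ∫ ω, v ω * F ω u ∂μ) ∧ ∀ u, Integrable (fun ω => v ω * F ω u) μ := by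
    intro v hv h0 h1
    have hc : Continuous (Function.uncurry fun ω u => v ω * F ω u) := 
      (hv.comp continuous_fst).mul hF
    have hbd : ∀ ω u, |v ω * F ω u| ≤ b ω * ‖u‖ := fun ω u => by
      rw [abs_mul, abs_of_nonneg (h0 ω)]
      exact (mul_le_mul_of_nonneg_right (h1 ω) (abs_nonneg _)).trans (hFb ω u)
    refine ⟨hC.integral μ _ hc (fun ω => hC.smul _ _ (h0 ω) (hG ω)) b hb hbd, fun u => ?_⟩
    exact (hb.mul_const ‖u‖).mono' (Continuous.aestronglyMeasurable
      (hc.comp (Continuous.prodMk_left u))) (ae_of_all _ fun ω => hbd ω u)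
  obtain ⟨p1, p2⟩ := key (fun ω => max (w ω) 0) (hw.max continuous_const)
    (fun ω => le_max_right _ _) (fun ω => max_le (le_abs_self _) (abs_nonneg _))
  obtain ⟨q1, q2⟩ := key (fun ω => max (-w ω) 0) (hw.neg.max continuous_const)
    (fun ω => le_max_right _ _) (fun ω => max_le (neg_le_abs _) (abs_nonneg _))
  refine ⟨_, _, p1, q1, fun u hu => ?_⟩
  rw [← integral_sub (p2 u) (q2 u)]
  refine integral_congr_ae (ae_of_all _ fun ω => ?_)
  change w ω * F ω u = max (w ω) 0 * F ω u - max (-w ω) 0 * F ω u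
  rw [← sub_mul]
  congr 1
  rcases le_total 0 (w ω) with h | h
  · rw [max_eq_left h, max_eq_right (by linarith)]; ring
  · rw [max_eq_right h, max_eq_left (by linarith)]; ring

end
end KS

namespace KS

/-! ### planar functions -/

noncomputable def fk (k : ℕ) (z : ℂ) : ℂ := ‖z‖ * (z / ‖z‖) ^ k

theorem norm_fk_le (k : ℕ) (z : ℂ) : ‖fk k z‖ ≤ ‖z‖ := by
  unfold fk
  rcases eq_or_ne z 0 with rfl | hz
  · simp
  · have : ‖z‖ ≠ 0 := norm_ne_zero_iff.2 hz
    rw [norm_mul, norm_pow, norm_div]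
    simp [div_self this]

theorem fk_hom (k : ℕ) (z : ℂ) {t : ℝ} (ht : 0 ≤ t) : fk k (t * z) = t * fk k z := by
  unfold fk
  rcases eq_or_lt_of_le ht with rfl | h
  · simp
  · rw [norm_mul, Complex.norm_real, Real.norm_of_nonneg ht]
    push_cast
    rw [mul_div_mul_left _ _ (by exact_mod_cast h.ne')]
    ring

theorem fk_conj (k : ℕ) (z : ℂ) : fk k z * (starRingEnd ℂ z) ^ k = ((‖z‖ ^ (k + 1) : ℝ) : ℂ) := by
  unfold fk
  rcases eq_or_ne z 0 with rfl | hz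
  · simp
  · have : (‖z‖ : ℂ) ≠ 0 := by exact_mod_cast norm_ne_zero_iff.2 hz
    rw [mul_assoc, ← mul_pow, div_mul_eq_mul_div, Complex.mul_conj, Complex.normSq_eq_norm_sq]
    push_cast
    rw [pow_two, mul_div_assoc, div_self this, mul_one, pow_succ]
    ring

theorem pow_sub_le (k : ℕ) (w : ℂ) (hw : ‖w‖ = 1) :
    ‖w ^ k - 1 - k * (w - 1)‖ ≤ (k : ℝ) ^ 2 * ‖w - 1‖ ^ 2 := by
  induction k with
  | zero => simp
  | succ k ih =>
    have e : w ^ (k + 1) - 1 - ((k + 1 : ℕ) : ℂ) * (w - 1) =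
        w * (w ^ k - 1 - k * (w - 1)) + k * (w - 1) ^ 2 := by
      push_cast; ring
    rw [e]
    refine (norm_add_le _ _).trans ?_
    rw [norm_mul, hw, one_mul, norm_mul, norm_pow, Complex.norm_natCast]
    push_cast
    nlinarith [sq_nonneg ‖w - 1‖, (Nat.cast_nonneg k : (0:ℝ) ≤ k)]

theorem pow_tangent (k : ℕ) (w : ℂ) (hw : ‖w‖ = 1) :
    ‖w ^ k - (w.re + Complex.I * k * w.im)‖ ≤ (2 * (k : ℝ) ^ 2 + k + 1) * (1 - w.re) := by
  have h1 : w.re ≤ 1 := (Complex.re_le_norm w).trans hw.le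
  have hsq : ‖w - 1‖ ^ 2 = 2 * (1 - w.re) := by
    have : w.re ^ 2 + w.im ^ 2 = 1 := by
      have := Complex.sq_norm w
      rw [hw, Complex.normSq_apply] at this
      nlinarith
    rw [Complex.sq_norm, Complex.normSq_apply]
    simp
    nlinarith
  have e : w ^ k - (w.re + Complex.I * k * w.im) = (w ^ k - 1 - k * (w - 1)) +
      (((k : ℝ) - 1) * (w.re - 1) : ℝ) := by
    apply Complex.ext <;> simp <;> ring
  rw [e]
  refine (norm_add_le _ _).trans ?_
  have h2 := pow_sub_le k w hw
  rw [hsq] at h2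
  have h3 : ‖((((k : ℝ) - 1) * (w.re - 1) : ℝ) : ℂ)‖ ≤ ((k : ℝ) + 1) * (1 - w.re) := by
    rw [Complex.norm_real, norm_mul, Real.norm_eq_abs, Real.norm_eq_abs, abs_sub_comm w.re,
      abs_of_nonneg (by linarith : 0 ≤ 1 - w.re)]
    have : |(k : ℝ) - 1| ≤ k + 1 := by
      rw [abs_le]; constructor <;> linarith [(Nat.cast_nonneg k : (0:ℝ) ≤ k)]
    have h0 : 0 ≤ 1 - w.re := by linarith
    gcongr
  linarith

/-- tangent functional -/
theorem fk_tangent (k : ℕ) (β : ℂ) (hβ : ‖β‖ ≤ 1) (z0 : ℂ) : ∃ l : ℂ →ₗ[ℝ] ℝ,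
    l z0 = (2 * (k : ℝ) ^ 2 + k + 1) * ‖z0‖ + (β * fk k z0).re ∧
    ∀ z, l z ≤ (2 * (k : ℝ) ^ 2 + k + 1) * ‖z‖ + (β * fk k z).re := by
  have hC : (1 : ℝ) ≤ 2 * (k : ℝ) ^ 2 + k + 1 := by nlinarith [(Nat.cast_nonneg k : (0:ℝ) ≤ k)]
  rcases eq_or_ne z0 0 with rfl | hz0
  · refine ⟨0, by simp [fk], fun z => ?_⟩
    have h1 : ‖β * fk k z‖ ≤ ‖z‖ := by
      rw [norm_mul]
      calc ‖β‖ * ‖fk k z‖ ≤ 1 * ‖z‖ := by gcongr; exact norm_fk_le k z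
        _ = _ := one_mul _
    have h2 := (Complex.abs_re_le_norm (β * fk k z)).trans h1
    have h3 := (abs_le.1 h2).1
    simp only [LinearMap.zero_apply]
    nlinarith [norm_nonneg z]
  · obtain ⟨w0, hw0, hz⟩ : ∃ w0 : ℂ, ‖w0‖ = 1 ∧ z0 = ‖z0‖ * w0 := by
      have : (‖z0‖ : ℂ) ≠ 0 := by exact_mod_cast norm_ne_zero_iff.2 hz0
      refine ⟨z0 / ‖z0‖, ?_, by field_simp⟩
      rw [norm_div]; simp [hz0]
    have hcc : w0 * starRingEnd ℂ w0 = 1 := by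
      rw [Complex.mul_conj, Complex.normSq_eq_norm_sq, hw0]; simp
    let C := 2 * (k : ℝ) ^ 2 + k + 1
    let l : ℂ →ₗ[ℝ] ℝ := 
      { toFun := fun z => C * (z * starRingEnd ℂ w0).re + (β * w0 ^ k *
          ((z * starRingEnd ℂ w0).re + Complex.I * k * (z * starRingEnd ℂ w0).im)).re
        map_add' := fun z z' => by
          simp only [add_mul, Complex.add_re, Complex.add_im, Complex.ofReal_add, mul_add]
          ring
        map_smul' := fun t z => by
          have e1 : ((t • z) * starRingEnd ℂ w0) = (t : ℂ) * (z * starRingEnd ℂ w0) := by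
            rw [Complex.real_smul]; ring
          rw [e1, Complex.re_ofReal_mul, Complex.im_ofReal_mul]
          have e2 : β * w0 ^ k * (((t * (z * starRingEnd ℂ w0).re : ℝ) : ℂ) + 
            Complex.I * k * ((t * (z * starRingEnd ℂ w0).im : ℝ) : ℂ)) = (t : ℂ) *
            (β * w0 ^ k * ((z * starRingEnd ℂ w0).re + 
              Complex.I * k * (z * starRingEnd ℂ w0).im)) := by push_cast; ring
          rw [e2, Complex.re_ofReal_mul]
          simp; ring }
    -- on rays
    have hray : ∀ (r : ℝ) (w : ℂ), 0 ≤ r → ‖w‖ = 1 → 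
        l (r * (w0 * w)) = r * (C * w.re + (β * w0 ^ k * (w.re + Complex.I * k * w.im)).re) := by
      intro r w hr hw
      have e1 : (r * (w0 * w)) * starRingEnd ℂ w0 = (r : ℂ) * w := by
        linear_combination r * w * hcc
      change C * ((r * (w0 * w)) * starRingEnd ℂ w0).re + (β * w0 ^ k *
          (((r * (w0 * w)) * starRingEnd ℂ w0).re + Complex.I * k * 
          ((r * (w0 * w)) * starRingEnd ℂ w0).im)).re = _
      rw [e1, Complex.re_ofReal_mul, Complex.im_ofReal_mul]
      have e2 : β * w0 ^ k * (((r * w.re : ℝ) : ℂ) + Complex.I * k * ((r * w.im : ℝ) : ℂ)) =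
          (r : ℂ) * (β * w0 ^ k * (w.re + Complex.I * k * w.im)) := by push_cast; ring
      rw [e2, Complex.re_ofReal_mul]; ring
    have hfr : ∀ (r : ℝ) (w : ℂ), 0 ≤ r → ‖w‖ = 1 → C * ‖(r * (w0 * w) : ℂ)‖ +
        (β * fk k (r * (w0 * w))).re = r * (C + (β * w0 ^ k * w ^ k).re) := by
      intro r w hr hw
      rw [fk_hom k _ hr, norm_mul, norm_mul, hw0, hw, Complex.norm_real, Real.norm_of_nonneg hr]
      have : fk k (w0 * w) = w0 ^ k * w ^ k := by
        simp [fk, hw0, hw, mul_pow]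
      rw [this]
      have e2 : β * (r * (w0 ^ k * w ^ k)) = (r : ℂ) * (β * w0 ^ k * w ^ k) := by ring
      rw [e2, Complex.re_ofReal_mul]; ring
    refine ⟨l, ?_, fun z => ?_⟩
    · have h1 := hray ‖z0‖ 1 (norm_nonneg _) (by simp)
      have h2 := hfr ‖z0‖ 1 (norm_nonneg _) (by simp)
      rw [mul_one, ← hz] at h1 h2
      rw [h1]
      refine Eq.trans ?_ h2.symm
      simp
    · obtain ⟨w, hw, hzw⟩ : ∃ w : ℂ, ‖w‖ = 1 ∧ z = ‖z‖ * (w0 * w) := by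
        rcases eq_or_ne z 0 with rfl | hz'
        · exact ⟨1, by simp, by simp⟩
        · have : (‖z‖ : ℂ) ≠ 0 := by exact_mod_cast norm_ne_zero_iff.2 hz'
          refine ⟨starRingEnd ℂ w0 * (z / ‖z‖), ?_, ?_⟩
          · rw [norm_mul, norm_div]; simp [hz', hw0]
          · rw [← mul_assoc w0, hcc, one_mul]; field_simp
      have h1 := hray ‖z‖ w (norm_nonneg _) hw
      have h2 := hfr ‖z‖ w (norm_nonneg _) hw
      rw [← hzw] at h1 h2
      change l z ≤ C * ‖z‖ + _
      rw [h1, h2]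
      refine mul_le_mul_of_nonneg_left ?_ (norm_nonneg z)
      have h3 := pow_tangent k w hw
      have h4 : ‖β * w0 ^ k * (w ^ k - (w.re + Complex.I * k * w.im))‖ ≤ C * (1 - w.re) := by
        rw [norm_mul, norm_mul, norm_pow, hw0, one_pow, mul_one]
        exact (mul_le_of_le_one_left (norm_nonneg _) hβ).trans h3
      have h5 := (abs_le.1 ((Complex.abs_re_le_norm _).trans h4)).1
      rw [mul_sub (β * w0 ^ k), Complex.sub_re] at h5
      linarith

theorem fk_sub_add (k : ℕ) (β : ℂ) (hβ : ‖β‖ ≤ 1) (z z' : ℂ) :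
    (2 * (k : ℝ) ^ 2 + k + 1) * ‖z + z'‖ + (β * fk k (z + z')).re ≤
    ((2 * (k : ℝ) ^ 2 + k + 1) * ‖z‖ + (β * fk k z).re) +
    ((2 * (k : ℝ) ^ 2 + k + 1) * ‖z'‖ + (β * fk k z').re) := by
  obtain ⟨l, h1, h2⟩ := fk_tangent k β hβ (z + z')
  rw [← h1, map_add]
  exact add_le_add (h2 z) (h2 z')

noncomputable def toC : Rn 2 →L[ℝ] ℂ :=
  LinearMap.toContinuousLinearMap
  { toFun := fun x => (x 0 : ℂ) + x 1 * Complex.I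
    map_add' := fun x y => by simp; ring
    map_smul' := fun t x => by simp; ring }

noncomputable def ofC : ℂ →L[ℝ] Rn 2 :=
  LinearMap.toContinuousLinearMap
  { toFun := fun z => !₂[z.re, z.im]
    map_add' := fun x y => by ext i; fin_cases i <;> simp
    map_smul' := fun t x => by ext i; fin_cases i <;> simp }

theorem toC_ofC (z : ℂ) : toC (ofC z) = z := by
  simp [toC, ofC]

theorem sub_fk (k : ℕ) (β : ℂ) (hβ : ‖β‖ ≤ 1) :
    Sub (fun x : Rn 2 => (2 * (k : ℝ) ^ 2 + k + 1) * ‖toC x‖ + (β * fk k (toC x)).re) := by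
  constructor
  · intro u v
    simp only [map_add]
    exact fk_sub_add k β hβ _ _
  · intro t ht u
    simp only [map_smul, Complex.real_smul, fk_hom k _ ht, norm_mul, Complex.norm_real,
      Real.norm_of_nonneg ht]
    have : β * (t * fk k (toC u)) = (t : ℂ) * (β * fk k (toC u)) := by ring
    rw [this, Complex.re_ofReal_mul]
    ring

theorem sub_normC : Sub (fun x : Rn 2 => ‖toC x‖) := by
  constructor
  · intro u v
    simp only [map_add]
    exact norm_add_le _ _
  · intro t ht u
    simp only [map_smul, norm_smul, Real.norm_of_nonneg ht]

theorem continuous_fk (k : ℕ) : Continuous (fk k) := by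
  have key : ∀ β : ℂ, ‖β‖ ≤ 1 → Continuous (fun z => (β * fk k z).re) := by
    intro β hβ
    have h1 := (sub_fk k β hβ).continuous.comp ofC.continuous
    have h2 : (fun z => (β * fk k z).re) = fun z => (fun x : Rn 2 => (2 * (k : ℝ) ^ 2 + k + 1) *
      ‖toC x‖ + (β * fk k (toC x)).re) (ofC z) - (2 * (k : ℝ) ^ 2 + k + 1) * ‖z‖ := by
      ext z
      simp only [toC_ofC]; ring
    rw [h2]
    exact h1.sub (by fun_prop)
  have h1 := key 1 (by simp)
  have h2 := key (-Complex.I) (by simp)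
  simp only [one_mul] at h1
  have h3 : fk k = fun z => ((fk k z).re : ℂ) + ((-Complex.I * fk k z).re : ℂ) * Complex.I := by
    ext z
    apply Complex.ext <;> simp
  rw [h3]
  fun_prop

end KS

namespace KS
open ProbabilityTheory

theorem gauss_int_pow {H : Type*} [NormedAddCommGroup H] [NormedSpace ℝ H] [MeasurableSpace H]
    [BorelSpace H] [CompleteSpace H] [SecondCountableTopology H] (μ : Measure H) [IsGaussian μ]
    (N : ℕ) : Integrable (fun ω => (1 + ‖ω‖) ^ N) μ := by
  have h1 : MemLp (fun ω : H => (1 : ℝ) + ‖ω‖) N μ := by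
    have := (memLp_const (1 : ℝ) (μ := μ) (p := (N : ENNReal))).add
      (IsGaussian.memLp_id μ N (by simp)).norm
    exact this
  have := h1.integrable_norm_pow'
  refine this.congr (ae_of_all _ fun ω => ?_)
  simp only
  rw [Real.norm_of_nonneg (by positivity)]

theorem gauss_int {H : Type*} [NormedAddCommGroup H] [NormedSpace ℝ H] [MeasurableSpace H]
    [BorelSpace H] [CompleteSpace H] [SecondCountableTopology H] (μ : Measure H) [IsGaussian μ]
    {F : Type*} [NormedAddCommGroup F] [SecondCountableTopology F] (f : H → F) (hf : Continuous f) 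
    (C : ℝ) (N : ℕ) (hb : ∀ ω, ‖f ω‖ ≤ C * (1 + ‖ω‖) ^ N) : Integrable f μ :=
  ((gauss_int_pow μ N).const_mul C).mono' hf.aestronglyMeasurable (ae_of_all _ hb)

theorem charFun_lin {H F : Type*} [NormedAddCommGroup H] [InnerProductSpace ℝ H]
    [MeasurableSpace H] [BorelSpace H] [FiniteDimensional ℝ H] [NormedAddCommGroup F]
    [InnerProductSpace ℝ F] [MeasurableSpace F] [BorelSpace F] [SecondCountableTopology F]
    (f : H → F) (hf : Continuous f) (v : F → H)
    (h : ∀ ω t, inner ℝ (f ω) t = inner ℝ ω (v t)) (t : F) :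
    charFun ((stdGaussian H).map f) t = Complex.exp (-(‖v t‖ : ℂ) ^ 2 / 2) := by
  rw [← charFun_stdGaussian, charFun_apply, charFun_apply, integral_map
    hf.measurable.aemeasurable (Continuous.aestronglyMeasurable (by fun_prop))]
  simp only [h]

abbrev Cn (n : ℕ) := EuclideanSpace ℂ (Fin n)

noncomputable def Zf {n : ℕ} (u : Rn n) (ω : Cn n) : ℂ := ∑ i, (u i : ℂ) * ω i

noncomputable def Tf {n : ℕ} (c : ℂ) (u : Rn n) (ω : Cn n) : Cn n :=
  WithLp.toLp 2 fun i => c * ω i + (1 - c) * Zf u ω * u i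

theorem Zf_unit {n : ℕ} {u : Rn n} (hu : ‖u‖ = 1) : ∑ i, (u i : ℂ) * u i = 1 := by
  have : ∑ i, u i * u i = 1 := by
    have := EuclideanSpace.real_norm_sq_eq u
    rw [hu] at this
    simp only [pow_two] at this
    linarith
  exact_mod_cast this

theorem Zf_Tf {n : ℕ} (c : ℂ) {u : Rn n} (hu : ‖u‖ = 1) (ω : Cn n) :
    Zf u (Tf c u ω) = Zf u ω := by
  have : Zf u (Tf c u ω) = ∑ i, (c * ((u i : ℂ) * ω i) + (1 - c) * Zf u ω * ((u i : ℂ) * u i)) := by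
    simp only [Zf, Tf]
    exact Finset.sum_congr rfl fun i _ => by ring
  rw [this, Finset.sum_add_distrib, ← Finset.mul_sum, ← Finset.mul_sum, Zf_unit hu]
  change c * Zf u ω + _ = _
  ring

theorem Tf_Tf {n : ℕ} (c d : ℂ) (hcd : c * d = 1) {u : Rn n} (hu : ‖u‖ = 1) (ω : Cn n) :
    Tf c u (Tf d u ω) = ω := by
  ext i
  change c * (Tf d u ω) i + (1 - c) * Zf u (Tf d u ω) * u i = ω i
  rw [Zf_Tf d hu]
  change c * (d * ω i + (1 - d) * Zf u ω * u i) + (1 - c) * Zf u ω * u i = ω i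
  linear_combination (ω i - Zf u ω * u i) * hcd

theorem inner_Cn {n : ℕ} (x y : Cn n) :
    inner ℝ x y = (∑ i, y i * starRingEnd ℂ (x i)).re := by
  rw [PiLp.inner_apply, Complex.re_sum]
  exact Finset.sum_congr rfl fun i _ => Complex.inner _ _

theorem Tf_adj {n : ℕ} (c : ℂ) (u : Rn n) (ω t : Cn n) :
    inner ℝ (Tf c u ω) t = inner ℝ ω (Tf (starRingEnd ℂ c) u t) := by
  rw [inner_Cn, inner_Cn]
  congr 1
  have e1 : ∑ i, t i * starRingEnd ℂ ((Tf c u ω) i) = 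
      starRingEnd ℂ c * ∑ i, t i * starRingEnd ℂ (ω i) + (1 - starRingEnd ℂ c) *
        (starRingEnd ℂ (Zf u ω) * Zf u t) := by
    rw [Zf, Zf, Finset.mul_sum, Finset.mul_sum, Finset.mul_sum, ← Finset.sum_add_distrib]
    refine Finset.sum_congr rfl fun i _ => ?_
    simp only [Tf, Zf, map_add, map_mul, map_sub, map_one, Complex.conj_ofReal]
    ring
  have e2 : ∑ i, (Tf (starRingEnd ℂ c) u t) i * starRingEnd ℂ (ω i) = 
      starRingEnd ℂ c * ∑ i, t i * starRingEnd ℂ (ω i) + (1 - starRingEnd ℂ c) *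
        (starRingEnd ℂ (Zf u ω) * Zf u t) := by
    have : starRingEnd ℂ (Zf u ω) = ∑ i, (u i : ℂ) * starRingEnd ℂ (ω i) := by
      simp [Zf]
    rw [this, Finset.sum_mul, Finset.mul_sum, Finset.mul_sum, ← Finset.sum_add_distrib]
    refine Finset.sum_congr rfl fun i _ => ?_
    simp only [Tf]
    ring
  rw [e1, e2]

theorem Tf_norm {n : ℕ} (c : ℂ) (hc : c * starRingEnd ℂ c = 1) {u : Rn n} (hu : ‖u‖ = 1)
    (t : Cn n) : ‖Tf c u t‖ = ‖t‖ := by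
  have : ‖Tf c u t‖ ^ 2 = ‖t‖ ^ 2 := by
    rw [← real_inner_self_eq_norm_sq, Tf_adj, Tf_Tf _ _ (by rw [mul_comm]; exact hc) hu,
      real_inner_self_eq_norm_sq]
  exact (sq_eq_sq₀ (norm_nonneg _) (norm_nonneg _)).1 this

theorem Zf_continuous {n : ℕ} : Continuous (fun p : Cn n × Rn n => Zf p.2 p.1) := by
  unfold Zf
  fun_prop

theorem Zf_cont {n : ℕ} (u : Rn n) : Continuous (Zf u) := by
  unfold Zf
  fun_prop

theorem Tf_continuous {n : ℕ} (c : ℂ) (u : Rn n) : Continuous (Tf c u) := by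
  have := Zf_cont u
  unfold Tf
  fun_prop

theorem Tf_map {n : ℕ} (c : ℂ) (hc : c * starRingEnd ℂ c = 1) {u : Rn n} (hu : ‖u‖ = 1) :
    (stdGaussian (Cn n)).map (Tf c u) = stdGaussian (Cn n) := by
  have := Measure.isProbabilityMeasure_map (μ := stdGaussian (Cn n))
    (Tf_continuous c u).measurable.aemeasurable
  apply Measure.ext_of_charFun
  ext t
  rw [charFun_lin _ (Tf_continuous c u) _ (Tf_adj c u) t, charFun_stdGaussian, Tf_norm _ _ hu]
  simpa [mul_comm] using hc

theorem Zf_norm_le {n : ℕ} (u : Rn n) (ω : Cn n) : ‖Zf u ω‖ ≤ (n : ℝ) * ‖ω‖ * ‖u‖ := by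
  unfold Zf
  refine (norm_sum_le _ _).trans ?_
  calc ∑ i, ‖(u i : ℂ) * ω i‖ ≤ ∑ i : Fin n, ‖ω‖ * ‖u‖ := by
        apply Finset.sum_le_sum
        intro i _
        rw [norm_mul, mul_comm, Complex.norm_real]
        gcongr
        · exact PiLp.norm_apply_le ω i
        · exact PiLp.norm_apply_le u i
    _ = _ := by simp; ring

theorem Zf_map {n : ℕ} {u : Rn n} (hu : ‖u‖ = 1) :
    (stdGaussian (Cn n)).map (Zf u) = stdGaussian ℂ := by
  have := Measure.isProbabilityMeasure_map (μ := stdGaussian (Cn n))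
    (Zf_cont u).measurable.aemeasurable
  apply Measure.ext_of_charFun
  ext t
  have hadj : ∀ (ω : Cn n) (t : ℂ), inner ℝ (Zf u ω) t = 
      inner ℝ ω (WithLp.toLp 2 (fun i => t * (u i : ℂ)) : Cn n) := by
    intro ω t
    rw [inner_Cn, Complex.inner]
    congr 1
    simp only [Zf, map_sum, map_mul, Complex.conj_ofReal, Finset.mul_sum]
    exact Finset.sum_congr rfl fun i _ => by ring
  rw [charFun_lin _ (Zf_cont u) _ hadj t, charFun_stdGaussian]
  have : ‖(WithLp.toLp 2 (fun i => t * (u i : ℂ)) : Cn n)‖ ^ 2 = ‖t‖ ^ 2 := by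
    rw [← real_inner_self_eq_norm_sq, inner_Cn]
    have e : ∑ i, (t * (u i : ℂ)) * starRingEnd ℂ (t * (u i : ℂ)) = 
        t * starRingEnd ℂ t * ∑ i, (u i : ℂ) * u i := by
      rw [Finset.mul_sum]
      refine Finset.sum_congr rfl fun i _ => ?_
      simp only [map_mul, Complex.conj_ofReal]; ring
    change (∑ i, (t * (u i : ℂ)) * starRingEnd ℂ (t * (u i : ℂ))).re = _
    rw [e, Zf_unit hu, mul_one, Complex.mul_conj, Complex.normSq_eq_norm_sq, Complex.ofReal_re]
  have h2 : ((‖(WithLp.toLp 2 (fun i => t * (u i : ℂ)) : Cn n)‖ : ℝ) : ℂ) ^ 2 = 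
      ((‖t‖ : ℝ) : ℂ) ^ 2 := by exact_mod_cast this
  rw [h2]

/-- the constant -/
noncomputable def ck (k : ℕ) : ℝ := ∫ z, ‖z‖ ^ (k + 1) ∂(stdGaussian ℂ)

theorem ck_ne (k : ℕ) : ck k ≠ 0 := by
  intro h
  have hi : Integrable (fun z : ℂ => ‖z‖ ^ (k + 1)) (stdGaussian ℂ) := by
    refine gauss_int _ _ (by fun_prop) 1 (k + 1) fun z => ?_
    rw [norm_pow, norm_norm, one_mul]
    gcongr
    linarith
  have h0 := (integral_eq_zero_iff_of_nonneg (fun z => by positivity) hi).1 h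
  have h1 : charFun (stdGaussian ℂ) 1 = 1 := by
    rw [charFun_apply]
    have : ∫ x, Complex.exp (↑(inner ℝ x (1 : ℂ)) * Complex.I) ∂(stdGaussian ℂ) =
        ∫ x, (1 : ℂ) ∂(stdGaussian ℂ) := by
      refine integral_congr_ae ?_
      filter_upwards [h0] with z hz
      have : z = 0 := by simpa using hz
      simp [this]
    rw [this]; simp
  rw [charFun_stdGaussian] at h1
  have h2 : Complex.exp (-(‖(1 : ℂ)‖ : ℂ) ^ 2 / 2) = ((Real.exp (-1 / 2) : ℝ) : ℂ) := by
    simp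
  rw [h2] at h1
  have h3 : Real.exp (-1 / 2) = 1 := by exact_mod_cast h1
  have := Real.exp_eq_one_iff (-1/2) |>.1 h3
  norm_num at this

theorem ck_eq {n : ℕ} (k : ℕ) {u : Rn n} (hu : ‖u‖ = 1) :
    ∫ ω, ‖Zf u ω‖ ^ (k + 1) ∂(stdGaussian (Cn n)) = ck k := by
  rw [ck, ← Zf_map hu, integral_map (Zf_cont u).measurable.aemeasurable
    (Continuous.aestronglyMeasurable (by fun_prop))]

end KS

namespace KS
open ProbabilityTheory

section
variable {n : ℕ} {G : (Rn n → ℝ) → Prop}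

noncomputable def Zlin (ω : Cn n) : Rn n →ₗ[ℝ] ℂ where
  toFun u := Zf u ω
  map_add' u v := by
    simp only [Zf, ← Finset.sum_add_distrib]
    exact Finset.sum_congr rfl fun i _ => by simp; ring
  map_smul' t u := by
    simp only [Zf, Finset.mul_sum, RingHom.id_apply, Complex.real_smul]
    exact Finset.sum_congr rfl fun i _ => by simp; ring

theorem G_fk (hC : Cls n G) (k : ℕ) (β : ℂ) (hβ : ‖β‖ ≤ 1) (ω : Cn n) :
    G (fun u => (2 * (k : ℝ) ^ 2 + k + 1) * ‖Zf u ω‖ + (β * fk k (Zf u ω)).re) := by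
  have := hC.planar _ (ofC.comp (Zlin ω).toContinuousLinearMap) (sub_fk k β hβ)
  simpa [toC_ofC, Zlin] using this

theorem G_norm (hC : Cls n G) (ω : Cn n) : G (fun u => ‖Zf u ω‖) := by
  have := hC.planar _ (ofC.comp (Zlin ω).toContinuousLinearMap) sub_normC
  simpa [toC_ofC, Zlin] using this

theorem coord_norm (ω : Cn n) (i : Fin n) : ‖ω i‖ ≤ ‖ω‖ := PiLp.norm_apply_le ω i

theorem prod_coord_norm {k : ℕ} (κ : Fin k → Fin n) (ω : Cn n) :
    ‖∏ j, starRingEnd ℂ (ω (κ j))‖ ≤ (1 + ‖ω‖) ^ k := by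
  rw [norm_prod]
  calc ∏ j, ‖starRingEnd ℂ (ω (κ j))‖ ≤ ∏ j : Fin k, (1 + ‖ω‖) := by
        apply Finset.prod_le_prod
        · intro i _; positivity
        · intro i _
          rw [RCLike.norm_conj]
          linarith [coord_norm ω (κ i)]
    _ = _ := by simp

/-- weighted integrals of `Re (β fk)` lie in `D0`. -/
theorem D0_fk (hC : Cls n G) (k : ℕ) (β : ℂ) (hβ : ‖β‖ ≤ 1) (w : Cn n → ℝ) (hw : Continuous w)
    (N : ℕ) (hb : ∀ ω, |w ω| ≤ (1 + ‖ω‖) ^ N) :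
    D0 G (fun u => ∫ ω, w ω * (β * fk k (Zf u ω)).re ∂(stdGaussian (Cn n))) := by
  set C : ℝ := 2 * (k : ℝ) ^ 2 + k + 1 with hCdef
  have hC0 : 0 ≤ C := by positivity
  have hn0 : (0 : ℝ) ≤ n := Nat.cast_nonneg n
  have hZc := Zf_continuous (n := n)
  have hre : ∀ (u : Rn n) (ω : Cn n), |(β * fk k (Zf u ω)).re| ≤ ‖Zf u ω‖ := fun u ω => by
    refine (Complex.abs_re_le_norm _).trans ?_
    rw [norm_mul]
    calc ‖β‖ * ‖fk k (Zf u ω)‖ ≤ 1 * ‖Zf u ω‖ := by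
          gcongr
          exact norm_fk_le _ _
      _ = _ := one_mul _
  have hfc := continuous_fk k
  have hbint : Integrable (fun ω : Cn n => ((C + 1) * n) * (1 + ‖ω‖) ^ (N + 1)) (stdGaussian (Cn n)) :=
    (gauss_int_pow _ _).const_mul _
  have hZb : ∀ ω u, (1 + ‖ω‖) ^ N * ((C + 1) * ‖Zf u ω‖) ≤ 
      ((C + 1) * n) * (1 + ‖ω‖) ^ (N + 1) * ‖u‖ := fun ω u => by
    calc (1 + ‖ω‖) ^ N * ((C + 1) * ‖Zf u ω‖) ≤ (1 + ‖ω‖) ^ N * ((C + 1) * (n * (1 + ‖ω‖) * ‖u‖)) := by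
          gcongr
          refine (Zf_norm_le u ω).trans ?_
          gcongr
          linarith
      _ = _ := by ring
  have h1 : D0 G (fun u => ∫ ω, w ω * (C * ‖Zf u ω‖ + (β * fk k (Zf u ω)).re) ∂(stdGaussian (Cn n))) := by
    refine D0.integral hC (stdGaussian (Cn n)) (fun ω u => C * ‖Zf u ω‖ + (β * fk k (Zf u ω)).re) ?_
      (fun ω => G_fk hC k β hβ ω) w hw _ hbint fun ω u => ?_
    · exact (continuous_const.mul hZc.norm).add (Complex.continuous_re.comp
        (continuous_const.mul (hfc.comp hZc)))
    · refine le_trans ?_ (hZb ω u)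
      refine mul_le_mul (hb ω) ?_ (abs_nonneg _) (by positivity)
      refine (abs_add_le _ _).trans ?_
      rw [abs_of_nonneg (by positivity)]
      linarith [hre u ω]
  have h2 : D0 G (fun u => ∫ ω, w ω * ‖Zf u ω‖ ∂(stdGaussian (Cn n))) := by
    refine D0.integral hC (stdGaussian (Cn n)) (fun ω u => ‖Zf u ω‖) ?_
      (fun ω => G_norm hC ω) w hw _ hbint fun ω u => ?_
    · unfold Function.uncurry
      fun_prop
    · refine le_trans ?_ (hZb ω u)
      refine mul_le_mul (hb ω) ?_ (abs_nonneg _) (by positivity)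
      rw [abs_of_nonneg (by positivity)]
      nlinarith [norm_nonneg (Zf u ω)]
  have hi : ∀ u, Integrable (fun ω => w ω * ‖Zf u ω‖) (stdGaussian (Cn n)) := fun u => by
    have := Zf_cont u
    refine (hbint.mul_const ‖u‖).mono' (Continuous.aestronglyMeasurable (by fun_prop)) (ae_of_all _ fun ω => ?_)
    refine le_trans ?_ (hZb ω u)
    rw [norm_mul, norm_norm, Real.norm_eq_abs]
    refine mul_le_mul (hb ω) ?_ (norm_nonneg _) (by positivity)
    nlinarith [norm_nonneg (Zf u ω)]
  have hi2 : ∀ u, Integrable (fun ω => w ω * (β * fk k (Zf u ω)).re) (stdGaussian (Cn n)) := fun u => by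
    have := Zf_cont u
    refine (hbint.mul_const ‖u‖).mono' (Continuous.aestronglyMeasurable (hw.mul (Complex.continuous_re.comp (continuous_const.mul (hfc.comp this))))) (ae_of_all _ fun ω => ?_)
    refine le_trans ?_ (hZb ω u)
    rw [norm_mul, Real.norm_eq_abs, Real.norm_eq_abs]
    refine mul_le_mul (hb ω) ?_ (abs_nonneg _) (by positivity)
    nlinarith [norm_nonneg (Zf u ω), hre u ω]
  refine (h1.sub hC (h2.smul hC C)).congr fun u _ => ?_
  rw [← integral_const_mul, ← integral_sub]
  · exact integral_congr_ae (ae_of_all _ fun ω => by simp only; ring)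
  · refine (((hi u).const_mul C).add (hi2 u)).congr (ae_of_all _ fun ω => ?_)
    simp only [Pi.add_apply]; ring
  · exact (hi u).const_mul C

theorem int_fk {k : ℕ} (u : Rn n) (W : Cn n → ℂ) (hW : Continuous W) (C : ℝ) (N : ℕ)
    (hb : ∀ ω, ‖W ω‖ ≤ C * (1 + ‖ω‖) ^ N) :
    Integrable (fun ω => fk k (Zf u ω) * W ω) (stdGaussian (Cn n)) := by
  have h1 := Zf_cont u
  have h2 := continuous_fk k
  refine gauss_int _ _ (by fun_prop) (n * ‖u‖ * C) (N + 1) fun ω => ?_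
  rw [norm_mul]
  calc ‖fk k (Zf u ω)‖ * ‖W ω‖ ≤ (n * (1 + ‖ω‖) * ‖u‖) * (C * (1 + ‖ω‖) ^ N) := by
        refine mul_le_mul ((norm_fk_le _ _).trans ((Zf_norm_le u ω).trans ?_)) (hb ω)
          (norm_nonneg _) (by positivity)
        gcongr
        linarith
    _ = _ := by ring

theorem D0_J (hC : Cls n G) {k : ℕ} (κ : Fin k → Fin n) :
    D0 G (fun u => (∫ ω, fk k (Zf u ω) * ∏ j, starRingEnd ℂ (ω (κ j)) ∂(stdGaussian (Cn n))).re) := by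
  have hWc : Continuous (fun ω : Cn n => ∏ j, starRingEnd ℂ (ω (κ j))) := by
    refine continuous_finsetProd _ fun j _ => Complex.continuous_conj.comp (by fun_prop)
  have h1 := D0_fk hC k 1 (by simp) (fun ω : Cn n => (∏ j, starRingEnd ℂ (ω (κ j))).re)
    (by fun_prop) k (fun ω => (Complex.abs_re_le_norm _).trans (prod_coord_norm κ ω))
  have h2 := D0_fk hC k Complex.I (by simp) (fun ω : Cn n => (∏ j, starRingEnd ℂ (ω (κ j))).im)
    (by fun_prop) k (fun ω => (Complex.abs_im_le_norm _).trans (prod_coord_norm κ ω))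
  refine (h1.add hC h2).congr fun u _ => ?_
  have hi := int_fk (k := k) u _ hWc 1 k (fun ω => by rw [one_mul]; exact prod_coord_norm κ ω)
  have hfc := (continuous_fk k).comp (Zf_cont u)
  have e1 : (∫ ω, fk k (Zf u ω) * ∏ j, starRingEnd ℂ (ω (κ j)) ∂(stdGaussian (Cn n))).re = 
      ∫ ω, (fk k (Zf u ω) * ∏ j, starRingEnd ℂ (ω (κ j))).re ∂(stdGaussian (Cn n)) := by
    exact (integral_re hi).symm
  rw [e1, ← integral_add]
  · refine integral_congr_ae (ae_of_all _ fun ω => ?_)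
    simp only [Complex.mul_re, Complex.one_re, Complex.one_im, Complex.I_re, Complex.I_im]
    ring
  · refine ((int_fk (k := k) u (fun ω => (((∏ j, starRingEnd ℂ (ω (κ j))).re : ℝ) : ℂ)) (by fun_prop) 1 k (fun ω => by
      rw [one_mul, Complex.norm_real]; exact (Complex.abs_re_le_norm _).trans (prod_coord_norm κ ω))).re).congr
        (ae_of_all _ fun ω => ?_)
    simp; ring
  · refine ((int_fk (k := k) u (fun ω => Complex.I * (((∏ j, starRingEnd ℂ (ω (κ j))).im : ℝ) : ℂ)) (by fun_prop) 1 k (fun ω => by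
      rw [one_mul, norm_mul, Complex.norm_I, one_mul, Complex.norm_real]
      exact (Complex.abs_im_le_norm _).trans (prod_coord_norm κ ω))).re).congr
        (ae_of_all _ fun ω => ?_)
    simp; ring

/-- The main integral computation. -/
theorem J_eq {k : ℕ} (κ : Fin k → Fin n) {u : Rn n} (hu : ‖u‖ = 1) :
    ∫ ω, fk k (Zf u ω) * ∏ j, starRingEnd ℂ (ω (κ j)) ∂(stdGaussian (Cn n)) =
      ((ck k * ∏ j, u (κ j) : ℝ) : ℂ) := by
  classical
  let P : Cn n → Fin k → ℂ := fun ω j => starRingEnd ℂ (ω (κ j)) - u (κ j) * starRingEnd ℂ (Zf u ω)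
  let T : Finset (Fin k) → Cn n → ℂ := fun S ω => 
    (∏ j ∈ Finset.univ \ S, ((u (κ j) : ℂ) * starRingEnd ℂ (Zf u ω))) * ∏ j ∈ S, P ω j
  have hZ := Zf_cont u
  have hPc : ∀ j, Continuous (fun ω => P ω j) := fun j => by
    have h1 : Continuous (fun ω : Cn n => starRingEnd ℂ (ω (κ j))) :=
      Complex.continuous_conj.comp (by fun_prop)
    have h2 : Continuous (fun ω : Cn n => starRingEnd ℂ (Zf u ω)) :=
      Complex.continuous_conj.comp hZ
    fun_prop
  have hQc : ∀ j, Continuous (fun ω => (u (κ j) : ℂ) * starRingEnd ℂ (Zf u ω)) := fun j => by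
    have h2 : Continuous (fun ω : Cn n => starRingEnd ℂ (Zf u ω)) :=
      Complex.continuous_conj.comp hZ
    fun_prop
  have hTc : ∀ S, Continuous (T S) := fun S => 
    (continuous_finsetProd _ fun j _ => hQc j).mul (continuous_finsetProd _ fun j _ => hPc j)
  have hexp : ∀ ω : Cn n, ∏ j, starRingEnd ℂ (ω (κ j)) = ∑ S ∈ (Finset.univ : Finset (Fin k)).powerset, T S ω := by
    intro ω
    have := Finset.prod_add (P ω) (fun j => (u (κ j) : ℂ) * starRingEnd ℂ (Zf u ω)) (Finset.univ : Finset (Fin k))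
    rw [← Finset.prod_congr rfl (fun j _ => sub_add_cancel (starRingEnd ℂ (ω (κ j))) ((u (κ j) : ℂ) * starRingEnd ℂ (Zf u ω)))]
    rw [this]
    refine Finset.sum_congr rfl fun S _ => mul_comm _ _
  have hQb : ∀ ω j, ‖(u (κ j) : ℂ) * starRingEnd ℂ (Zf u ω)‖ ≤ (1 + n) * (1 + ‖ω‖) := fun ω j => by
    rw [norm_mul, RCLike.norm_conj, Complex.norm_real]
    have h1 : ‖u (κ j)‖ ≤ 1 := (PiLp.norm_apply_le u _).trans hu.le
    have h2 := Zf_norm_le u ω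
    rw [hu, mul_one] at h2
    have : ‖u (κ j)‖ * ‖Zf u ω‖ ≤ 1 * (n * ‖ω‖) := mul_le_mul h1 h2 (norm_nonneg _) zero_le_one
    nlinarith [norm_nonneg ω, (Nat.cast_nonneg n : (0:ℝ) ≤ n)]
  have hPb : ∀ ω j, ‖P ω j‖ ≤ (1 + n) * (1 + ‖ω‖) := fun ω j => by
    refine (norm_sub_le _ _).trans ?_
    rw [norm_mul, RCLike.norm_conj, RCLike.norm_conj, Complex.norm_real]
    have h1 : ‖u (κ j)‖ ≤ 1 := (PiLp.norm_apply_le u _).trans hu.le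
    have h2 := Zf_norm_le u ω
    rw [hu, mul_one] at h2
    have : ‖u (κ j)‖ * ‖Zf u ω‖ ≤ 1 * (n * ‖ω‖) := mul_le_mul h1 h2 (norm_nonneg _) zero_le_one
    nlinarith [norm_nonneg ω, (Nat.cast_nonneg n : (0:ℝ) ≤ n), coord_norm ω (κ j)]
  have hTb : ∀ S ω, ‖T S ω‖ ≤ (1 + n) ^ k * (1 + ‖ω‖) ^ k := by
    intro S ω
    rw [← mul_pow, norm_mul, norm_prod, norm_prod]
    have hcard : (Finset.univ \ S).card + S.card = k := by
      have := Finset.card_sdiff_add_card_eq_card (Finset.subset_univ S)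
      simpa using this
    calc (∏ j ∈ Finset.univ \ S, ‖(u (κ j) : ℂ) * starRingEnd ℂ (Zf u ω)‖) * ∏ j ∈ S, ‖P ω j‖ ≤ 
        (∏ j ∈ Finset.univ \ S, ((1 + n) * (1 + ‖ω‖))) * ∏ j ∈ S, ((1 + n) * (1 + ‖ω‖)) := by
          gcongr with j _ j _
          · exact hQb ω j
          · exact hPb ω j
      _ = _ := by rw [Finset.prod_const, Finset.prod_const, ← pow_add, hcard]
  have hTi : ∀ S, Integrable (fun ω => fk k (Zf u ω) * T S ω) (stdGaussian (Cn n)) := fun S => 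
    int_fk u (T S) (hTc S) _ k (hTb S)
  have hS : ∀ S : Finset (Fin k), S.Nonempty → 
      ∫ ω, fk k (Zf u ω) * T S ω ∂(stdGaussian (Cn n)) = 0 := by
    intro S hS
    have hm : 0 < S.card := hS.card_pos
    set m := S.card with hmdef
    set c : ℂ := Complex.exp ((Real.pi / m : ℝ) * Complex.I) with hc
    have hcc : starRingEnd ℂ c = Complex.exp (-((Real.pi / m : ℝ) * Complex.I)) := by
      rw [hc, ← Complex.exp_conj]
      simp
    have hc1 : c * starRingEnd ℂ c = 1 := by
      rw [hcc, hc, ← Complex.exp_add]; simp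
    have hcm : (starRingEnd ℂ c) ^ m = -1 := by
      rw [← map_pow, hc, ← Complex.exp_nat_mul]
      have : (m : ℂ) * (((Real.pi / m : ℝ) : ℂ) * Complex.I) = Real.pi * Complex.I := by
        have : (m : ℂ) ≠ 0 := by exact_mod_cast hm.ne'
        push_cast; field_simp
      rw [this, Complex.exp_pi_mul_I]; simp
    have hPT : ∀ ω j, P (Tf c u ω) j = starRingEnd ℂ c * P ω j := by
      intro ω j
      simp only [P, Zf_Tf c hu]
      change starRingEnd ℂ (c * ω (κ j) + (1 - c) * Zf u ω * u (κ j)) - _ = _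
      simp only [map_add, map_mul, map_sub, map_one, Complex.conj_ofReal]
      ring
    have h1 : ∫ ω, fk k (Zf u ω) * T S ω ∂(stdGaussian (Cn n)) = 
        ∫ ω, -(fk k (Zf u ω) * T S ω) ∂(stdGaussian (Cn n)) := by
      conv_lhs => rw [← Tf_map c hc1 hu]
      rw [integral_map (Tf_continuous c u).measurable.aemeasurable
        (show AEStronglyMeasurable (fun ω => fk k (Zf u ω) * T S ω) _ from
          Continuous.aestronglyMeasurable (((continuous_fk k).comp hZ).mul (hTc S)))]
      refine integral_congr_ae (ae_of_all _ fun ω => ?_)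
      simp only [T, Zf_Tf c hu, hPT, Finset.prod_mul_distrib, Finset.prod_const, ← hmdef, hcm]
      ring
    rw [integral_neg] at h1
    exact self_eq_neg.1 h1
  have h0 : ∫ ω, fk k (Zf u ω) * T ∅ ω ∂(stdGaussian (Cn n)) = ((ck k * ∏ j, u (κ j) : ℝ) : ℂ) := by
    have : ∀ ω, fk k (Zf u ω) * T ∅ ω = ((‖Zf u ω‖ ^ (k + 1) * ∏ j, u (κ j) : ℝ) : ℂ) := by
      intro ω
      simp only [T, Finset.sdiff_empty, Finset.prod_empty, mul_one, Finset.prod_mul_distrib, Finset.prod_const,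
        Finset.card_univ, Fintype.card_fin]
      rw [Complex.ofReal_mul, ← fk_conj]
      push_cast; ring
    simp only [this]
    rw [integral_complex_ofReal, integral_mul_const, ck_eq k hu]
  simp only [hexp, Finset.mul_sum]
  rw [integral_finsetSum _ (fun S _ => hTi S), Finset.sum_eq_single ∅, h0]
  · intro S _ hSne
    exact hS S (Finset.nonempty_iff_ne_empty.2 hSne)
  · simp

theorem D0_prod (hC : Cls n G) {k : ℕ} (κ : Fin k → Fin n) : D0 G (fun u => ∏ j, u (κ j)) := by
  refine ((D0_J hC κ).smul hC (ck k)⁻¹).congr fun u hu => ?_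
  simp only [J_eq κ hu, Complex.ofReal_re]
  rw [inv_mul_cancel_left₀ (ck_ne k)]

end
end KS

namespace KS
open ProbabilityTheory

theorem g1_exp_int (s : ℝ) :
    Integrable (fun x : ℝ => Real.exp (s * |x|) * (1 + |x|)) (gaussianReal 0 1) := by
  have h1 := (integrable_exp_mul_gaussianReal (μ := 0) (v := 1) (s + 1)).add
    (integrable_exp_mul_gaussianReal (μ := 0) (v := 1) (-(s + 1)))
  refine h1.mono' (Continuous.aestronglyMeasurable (by fun_prop)) (ae_of_all _ fun x => ?_)
  rw [Real.norm_of_nonneg (by positivity)]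
  have h2 : Real.exp (s * |x|) * (1 + |x|) ≤ Real.exp ((s + 1) * |x|) := by
    rw [add_mul, Real.exp_add, one_mul]
    gcongr
    linarith [Real.add_one_le_exp |x|]
  refine h2.trans ?_
  simp only [Pi.add_apply]
  rcases abs_cases x with ⟨h, _⟩ | ⟨h, _⟩ <;> rw [h]
  · linarith [Real.exp_pos (-(s + 1) * x)]
  · have : (s + 1) * -x = -(s + 1) * x := by ring
    rw [this]
    linarith [Real.exp_pos ((s + 1) * x)]

theorem g1_mul_exp (s : ℝ) :
    ∫ x, x * Real.exp (s * x) ∂(gaussianReal 0 1) = s * Real.exp (s ^ 2 / 2) := by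
  have hset : integrableExpSet (id : ℝ → ℝ) (gaussianReal 0 1) = Set.univ := by
    ext t; simp only [Set.mem_univ, iff_true]
    exact integrable_exp_mul_gaussianReal t
  have h1 := hasDerivAt_mgf (X := (id : ℝ → ℝ)) (μ := gaussianReal 0 1) (t := s) (by
    rw [hset]; simp)
  have h2 : mgf (id : ℝ → ℝ) (gaussianReal 0 1) = fun t => Real.exp (t ^ 2 / 2) := by
    ext t
    rw [mgf_gaussianReal (μ := 0) (v := 1) (Measure.map_id)]
    simp
  rw [h2] at h1
  have h3 : HasDerivAt (fun t : ℝ => Real.exp (t ^ 2 / 2)) (Real.exp (s ^ 2 / 2) * (2 * s / 2)) s := by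
    have := ((hasDerivAt_pow 2 s).div_const 2).exp
    simpa using this
  have := h1.unique h3
  simp only [id] at this
  rw [this]; ring

theorem g1_int_exp (s : ℝ) :
    ∫ x, Real.exp (s * x) ∂(gaussianReal 0 1) = Real.exp (s ^ 2 / 2) := by
  have := mgf_gaussianReal (μ := 0) (v := 1) (X := (id : ℝ → ℝ)) (p := gaussianReal 0 1)
    (Measure.map_id) s
  simpa [mgf] using this

theorem g1_key (δ : ℝ) (hδ : 0 < δ) : ∃ s : ℝ, 0 ≤ s ∧
    0 < ∫ x, Real.exp (s * x) * (δ * max x 0 - (max (-x) 0 + 1)) ∂(gaussianReal 0 1) := by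
  refine ⟨3 / δ + 1, by positivity, ?_⟩
  set s := 3 / δ + 1 with hs
  have hs1 : 1 ≤ s := by rw [hs]; have : 0 < 3 / δ := by positivity
                         linarith
  have hsd : 3 ≤ δ * s := by
    rw [hs, mul_add, mul_div_cancel₀ _ hδ.ne']; linarith
  have hi1 : Integrable (fun x : ℝ => x * Real.exp (s * x)) (gaussianReal 0 1) := by
    refine (g1_exp_int s).mono' (Continuous.aestronglyMeasurable (by fun_prop)) (ae_of_all _ fun x => ?_)
    rw [norm_mul, Real.norm_eq_abs, Real.norm_of_nonneg (Real.exp_pos _).le, mul_comm]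
    gcongr
    · exact le_abs_self x
    · linarith
  have hi2 := integrable_exp_mul_gaussianReal (μ := 0) (v := 1) s
  have hlow : ∫ x, (δ * (x * Real.exp (s * x)) - Real.exp (s * x) - 1) ∂(gaussianReal 0 1) ≤
      ∫ x, Real.exp (s * x) * (δ * max x 0 - (max (-x) 0 + 1)) ∂(gaussianReal 0 1) := by
    refine integral_mono (((hi1.const_mul δ).sub hi2).sub (integrable_const _)) ?_ fun x => ?_
    · refine ((g1_exp_int s).const_mul (δ + 1)).mono' (Continuous.aestronglyMeasurable (by fun_prop)) (ae_of_all _ fun x => ?_)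
      rw [norm_mul, Real.norm_of_nonneg (Real.exp_pos _).le]
      have h1 : Real.exp (s * x) ≤ Real.exp (s * |x|) := by
        gcongr; exact le_abs_self x
      have h2 : ‖δ * max x 0 - (max (-x) 0 + 1)‖ ≤ (δ + 1) * (1 + |x|) := by
        rw [Real.norm_eq_abs, abs_le]
        have a1 : max x 0 ≤ |x| := max_le (le_abs_self _) (abs_nonneg _)
        have a2 : max (-x) 0 ≤ |x| := max_le (neg_le_abs _) (abs_nonneg _)
        have a3 : 0 ≤ max x 0 := le_max_right _ _
        have a4 : 0 ≤ max (-x) 0 := le_max_right _ _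
        have a5 := abs_nonneg x
        constructor <;> nlinarith
      calc _ ≤ Real.exp (s * |x|) * ((δ + 1) * (1 + |x|)) := mul_le_mul h1 h2 (norm_nonneg _) (Real.exp_pos _).le
        _ = _ := by ring
    · simp only
      rcases le_total 0 x with hx | hx
      · rw [max_eq_left hx, max_eq_right (by linarith)]
        nlinarith
      · rw [max_eq_right hx, max_eq_left (by linarith)]
        have h1 : Real.exp (s * x) ≤ Real.exp x := by gcongr; nlinarith
        have h2 : (-x) * Real.exp x ≤ 1 := by
          have h3 : -x ≤ Real.exp (-x) := by linarith [Real.add_one_le_exp (-x)]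
          calc (-x) * Real.exp x ≤ Real.exp (-x) * Real.exp x := by gcongr
            _ = 1 := by rw [← Real.exp_add]; simp
        have h4 : (-x) * Real.exp (s * x) ≤ 1 := (mul_le_mul_of_nonneg_left h1 (by linarith)).trans h2
        have h5 : δ * (x * Real.exp (s * x)) ≤ 0 := by
          have := mul_nonneg (mul_nonneg hδ.le (by linarith : 0 ≤ -x)) (Real.exp_pos (s * x)).le
          nlinarith
        nlinarith
  refine lt_of_lt_of_le ?_ hlow
  rw [integral_sub (show Integrable (fun x : ℝ => δ * (x * Real.exp (s * x)) - Real.exp (s * x)) _ from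
      (hi1.const_mul δ).sub hi2) (integrable_const _), integral_sub (hi1.const_mul δ) hi2,
    integral_const_mul, g1_mul_exp, g1_int_exp]
  simp only [integral_const, probReal_univ, smul_eq_mul, mul_one]
  have : 1 ≤ Real.exp (s ^ 2 / 2) := Real.one_le_exp (by positivity)
  nlinarith

theorem g1_poly (δ : ℝ) (hδ : 0 < δ) : ∃ (s : ℝ) (m : ℕ), 
    0 < ∫ x, (1 + s * x) ^ (2 * m) * (δ * max x 0 - (max (-x) 0 + 1)) ∂(gaussianReal 0 1) := by
  obtain ⟨s, hs0, hs⟩ := g1_key δ hδ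
  have hlim : Tendsto (fun m : ℕ => ∫ x, (1 + (s * x) / ((2 * m : ℕ) : ℝ)) ^ (2 * m) *
      (δ * max x 0 - (max (-x) 0 + 1)) ∂(gaussianReal 0 1)) atTop
      (𝓝 (∫ x, Real.exp (s * x) * (δ * max x 0 - (max (-x) 0 + 1)) ∂(gaussianReal 0 1))) := by
    refine tendsto_integral_of_dominated_convergence _ (fun m => Continuous.aestronglyMeasurable (by fun_prop))
      ((g1_exp_int s).const_mul (δ + 1)) (fun m => ae_of_all _ fun x => ?_) (ae_of_all _ fun x => ?_)
    · rw [norm_mul, norm_pow, Real.norm_eq_abs]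
      have h1 : |1 + (s * x) / ((2 * m : ℕ) : ℝ)| ^ (2 * m) ≤ Real.exp (s * |x|) := by
        rcases Nat.eq_zero_or_pos m with rfl | hm
        · simp; positivity
        · have hm' : (0 : ℝ) < ((2 * m : ℕ) : ℝ) := by exact_mod_cast (by omega : 0 < 2 * m)
          have h2 : |1 + (s * x) / ((2 * m : ℕ) : ℝ)| ≤ Real.exp (s * |x| / ((2 * m : ℕ) : ℝ)) := by
            refine (abs_add_le _ _).trans ?_
            rw [abs_div, abs_mul, abs_of_nonneg hs0, abs_of_pos hm', abs_one]
            linarith [Real.add_one_le_exp (s * |x| / ((2 * m : ℕ) : ℝ))]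
          calc _ ≤ Real.exp (s * |x| / ((2 * m : ℕ) : ℝ)) ^ (2 * m) := by gcongr
            _ = _ := by rw [← Real.exp_nat_mul]; congr 1; field_simp
      have h2 : ‖δ * max x 0 - (max (-x) 0 + 1)‖ ≤ (δ + 1) * (1 + |x|) := by
        rw [Real.norm_eq_abs, abs_le]
        have a1 : max x 0 ≤ |x| := max_le (le_abs_self _) (abs_nonneg _)
        have a2 : max (-x) 0 ≤ |x| := max_le (neg_le_abs _) (abs_nonneg _)
        have a3 : 0 ≤ max x 0 := le_max_right _ _
        have a4 : 0 ≤ max (-x) 0 := le_max_right _ _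
        have a5 := abs_nonneg x
        constructor <;> nlinarith
      calc _ ≤ Real.exp (s * |x|) * ((δ + 1) * (1 + |x|)) := mul_le_mul h1 h2 (norm_nonneg _) (Real.exp_pos _).le
        _ = _ := by ring
    · refine Tendsto.mul_const _ ?_
      exact (Real.tendsto_one_add_div_pow_exp (s * x)).comp
        (tendsto_id.const_mul_atTop' (by norm_num : 0 < 2))
  obtain ⟨m, hm⟩ := (hlim.eventually (lt_mem_nhds hs)).exists
  refine ⟨s / ((2 * m : ℕ) : ℝ), m, ?_⟩
  refine hm.trans_le (le_of_eq (integral_congr_ae (ae_of_all _ fun x => ?_)))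
  simp only
  rw [div_mul_eq_mul_div]

section
variable {H : Type*} [NormedAddCommGroup H] [InnerProductSpace ℝ H]
    [MeasurableSpace H] [BorelSpace H] [FiniteDimensional ℝ H]

theorem indep_proj (e : H) (he : ‖e‖ = 1) : 
    IndepFun (fun ω => inner ℝ ω e) (fun ω => ω - inner ℝ ω e • e) (stdGaussian H) := by
  have hee : inner ℝ e e = (1 : ℝ) := by rw [real_inner_self_eq_norm_sq, he]; norm_num
  have c1 : Continuous (fun ω : H => (inner ℝ ω e : ℝ)) := by fun_prop
  have c2 : Continuous (fun ω : H => ω - (inner ℝ ω e : ℝ) • e) := by fun_prop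
  have hsc : SecondCountableTopology H := (inferInstance)
  rw [indepFun_iff_charFun_prod c1.measurable.aemeasurable c2.measurable.aemeasurable]
  intro t
  have c3 : Continuous (fun ω : H => (WithLp.toLp 2 ((inner ℝ ω e : ℝ), ω - (inner ℝ ω e : ℝ) • e) : WithLp 2 (ℝ × H))) := by fun_prop
  rw [charFun_lin _ c1 (fun t => t • e) (fun ω t => by rw [inner_smul_right]; simp),
    charFun_lin _ c2 (fun t => t - (inner ℝ t e : ℝ) • e) (fun ω t => by
      simp only [inner_sub_left, inner_sub_right, inner_smul_left, inner_smul_right]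
      rw [real_inner_comm e t]; simp; ring),
    charFun_lin _ c3 (fun t => t.ofLp.1 • e + (t.ofLp.2 - (inner ℝ t.ofLp.2 e : ℝ) • e)) (fun ω t => by
      rw [WithLp.prod_inner_apply]
      simp only [inner_add_right, inner_sub_left, inner_sub_right, inner_smul_left, inner_smul_right]
      rw [real_inner_comm e t.ofLp.2]; simp; ring), ← Complex.exp_add]
  congr 1
  have hn : ‖t.ofLp.1 • e + (t.ofLp.2 - (inner ℝ t.ofLp.2 e : ℝ) • e)‖ ^ 2 = 
      ‖t.ofLp.1 • e‖ ^ 2 + ‖t.ofLp.2 - (inner ℝ t.ofLp.2 e : ℝ) • e‖ ^ 2 := by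
    rw [norm_add_sq_real]
    have : inner ℝ (t.ofLp.1 • e) (t.ofLp.2 - (inner ℝ t.ofLp.2 e : ℝ) • e) = 0 := by
      simp only [inner_sub_right, inner_smul_left, inner_smul_right, hee]
      rw [real_inner_comm e t.ofLp.2]; simp; ring
    rw [this]; ring
  have hn' : ((‖t.ofLp.1 • e + (t.ofLp.2 - (inner ℝ t.ofLp.2 e : ℝ) • e)‖ : ℝ) : ℂ) ^ 2 = 
      ((‖t.ofLp.1 • e‖ : ℝ) : ℂ) ^ 2 + ((‖t.ofLp.2 - (inner ℝ t.ofLp.2 e : ℝ) • e‖ : ℝ) : ℂ) ^ 2 := by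
    exact_mod_cast hn
  rw [hn']; ring

theorem law_proj (e : H) (he : ‖e‖ = 1) : 
    (stdGaussian H).map (fun ω => inner ℝ ω e) = gaussianReal 0 1 := by
  have c1 : Continuous (fun ω : H => (inner ℝ ω e : ℝ)) := by fun_prop
  have := Measure.isProbabilityMeasure_map (μ := stdGaussian H) c1.measurable.aemeasurable
  apply Measure.ext_of_charFun
  ext t
  rw [charFun_lin _ c1 (fun t => t • e) (fun ω t => by rw [inner_smul_right]; simp),
    charFun_gaussianReal, norm_smul, he]
  congr 1
  have : ((|t| : ℝ) : ℂ) ^ 2 = (t : ℂ) ^ 2 := by exact_mod_cast sq_abs t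
  simp [this]; ring

/-- the law of `(Φ ω, ⟪ω,e⟫ - ⟪Φ ω, Φ e⟫)` depends only on `‖Φ e‖`. -/
theorem law_pair {F : Type*} [NormedAddCommGroup F] [InnerProductSpace ℝ F]
    [MeasurableSpace F] [BorelSpace F] [FiniteDimensional ℝ F]
    (e : H) (he : ‖e‖ = 1) (Φ Ψ : H →L[ℝ] F) (Φs Ψs : F →L[ℝ] H)
    (h1 : ∀ ω t, inner ℝ (Φ ω) t = inner ℝ ω (Φs t)) (h2 : ∀ t, Φ (Φs t) = t)
    (h1' : ∀ ω t, inner ℝ (Ψ ω) t = inner ℝ ω (Ψs t)) (h2' : ∀ t, Ψ (Ψs t) = t)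
    (h3 : ‖Φ e‖ = ‖Ψ e‖) :
    (stdGaussian H).map (fun ω => (WithLp.toLp 2 (Φ ω, inner ℝ ω e - inner ℝ (Φ ω) (Φ e)) : WithLp 2 (F × ℝ))) = 
    (stdGaussian H).map (fun ω => (WithLp.toLp 2 (Ψ ω, inner ℝ ω e - inner ℝ (Ψ ω) (Ψ e)) : WithLp 2 (F × ℝ))) := by
  have key : ∀ (Φ : H →L[ℝ] F) (Φs : F →L[ℝ] H), (∀ ω t, inner ℝ (Φ ω) t = inner ℝ ω (Φs t)) →
      (∀ t, Φ (Φs t) = t) → ∀ t : WithLp 2 (F × ℝ), 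
      charFun ((stdGaussian H).map (fun ω => (WithLp.toLp 2 (Φ ω, inner ℝ ω e - inner ℝ (Φ ω) (Φ e)) : WithLp 2 (F × ℝ)))) t =
      Complex.exp (-((‖t.ofLp.1‖ ^ 2 + t.ofLp.2 ^ 2 * (1 - ‖Φ e‖ ^ 2) : ℝ) : ℂ) / 2) := by
    intro Φ Φs h1 h2 t
    have c3 : Continuous (fun ω => (WithLp.toLp 2 (Φ ω, inner ℝ ω e - inner ℝ (Φ ω) (Φ e)) : WithLp 2 (F × ℝ))) := by fun_prop
    rw [charFun_lin _ c3 (fun t => Φs t.ofLp.1 + t.ofLp.2 • (e - Φs (Φ e))) (fun ω t => by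
      rw [WithLp.prod_inner_apply]
      simp only [inner_add_right, inner_sub_right, inner_smul_right, ← h1]
      simp)]
    congr 2
    have : ‖Φs t.ofLp.1 + t.ofLp.2 • (e - Φs (Φ e))‖ ^ 2 = ‖t.ofLp.1‖ ^ 2 + t.ofLp.2 ^ 2 * (1 - ‖Φ e‖ ^ 2) := by
      have e1 : inner ℝ (Φs t.ofLp.1) (e - Φs (Φ e)) = (0 : ℝ) := by
        rw [real_inner_comm, ← h1, map_sub, h2, sub_self, inner_zero_left]
      have e2 : ‖Φs t.ofLp.1‖ ^ 2 = ‖t.ofLp.1‖ ^ 2 := by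
        rw [← real_inner_self_eq_norm_sq, ← h1, h2, real_inner_self_eq_norm_sq]
      have e3 : ‖e - Φs (Φ e)‖ ^ 2 = 1 - ‖Φ e‖ ^ 2 := by
        have e4 : inner ℝ (e - Φs (Φ e)) (Φs (Φ e)) = (0 : ℝ) := by
          rw [← h1, map_sub, h2, sub_self, inner_zero_left]
        rw [← real_inner_self_eq_norm_sq, inner_sub_right, e4, inner_sub_left, real_inner_comm e (Φs (Φ e)),
          ← h1, real_inner_self_eq_norm_sq, real_inner_self_eq_norm_sq, he]; ring
      rw [norm_add_sq_real, inner_smul_right, e1, e2, norm_smul, mul_pow, e3]; simp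
    rw [← this]; push_cast; ring
  have i1 := Measure.isProbabilityMeasure_map (μ := stdGaussian H)
    (f := fun ω => (WithLp.toLp 2 (Φ ω, inner ℝ ω e - inner ℝ (Φ ω) (Φ e)) : WithLp 2 (F × ℝ)))
    (Continuous.measurable (by fun_prop)).aemeasurable
  have i2 := Measure.isProbabilityMeasure_map (μ := stdGaussian H)
    (f := fun ω => (WithLp.toLp 2 (Ψ ω, inner ℝ ω e - inner ℝ (Ψ ω) (Ψ e)) : WithLp 2 (F × ℝ)))
    (Continuous.measurable (by fun_prop)).aemeasurable
  apply Measure.ext_of_charFun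
  ext t
  rw [key Φ Φs h1 h2, key Ψ Ψs h1' h2', h3]

end
end KS

namespace KS
open ProbabilityTheory

section PB
variable {H : Type*} [NormedAddCommGroup H] [InnerProductSpace ℝ H]

/-- continuous with polynomial growth -/
def PB (w : H → ℝ) : Prop := Continuous w ∧ ∃ (C : ℝ) (N : ℕ), 0 ≤ C ∧ ∀ ω, |w ω| ≤ C * (1 + ‖ω‖) ^ N

theorem PB.lin {w : H → ℝ} (hw : Continuous w) (C : ℝ) (hC : 0 ≤ C) (h : ∀ ω, |w ω| ≤ C * ‖ω‖) : PB w :=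
  ⟨hw, C, 1, hC, fun ω => (h ω).trans (by rw [pow_one]; gcongr; linarith)⟩

theorem PB.const (c : ℝ) : PB (fun _ : H => c) :=
  ⟨continuous_const, |c|, 0, abs_nonneg _, fun ω => by simp⟩

theorem PB.mul {w w' : H → ℝ} (h : PB w) (h' : PB w') : PB (fun ω => w ω * w' ω) := by
  obtain ⟨hc, C, N, hC, hb⟩ := h
  obtain ⟨hc', C', N', hC', hb'⟩ := h'
  refine ⟨hc.mul hc', C * C', N + N', by positivity, fun ω => ?_⟩
  rw [abs_mul]
  calc _ ≤ (C * (1 + ‖ω‖) ^ N) * (C' * (1 + ‖ω‖) ^ N') := mul_le_mul (hb ω) (hb' ω) (abs_nonneg _) (by positivity)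
    _ = _ := by ring

theorem PB.add {w w' : H → ℝ} (h : PB w) (h' : PB w') : PB (fun ω => w ω + w' ω) := by
  obtain ⟨hc, C, N, hC, hb⟩ := h
  obtain ⟨hc', C', N', hC', hb'⟩ := h'
  refine ⟨hc.add hc', C + C', N + N', by positivity, fun ω => ?_⟩
  have h1 : (1 : ℝ) ≤ 1 + ‖ω‖ := by linarith [norm_nonneg ω]
  calc |w ω + w' ω| ≤ C * (1 + ‖ω‖) ^ N + C' * (1 + ‖ω‖) ^ N' := 
        (abs_add_le _ _).trans (add_le_add (hb ω) (hb' ω))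
    _ ≤ C * (1 + ‖ω‖) ^ (N + N') + C' * (1 + ‖ω‖) ^ (N + N') := by
        gcongr <;> first | exact h1 | omega
    _ = _ := by ring

theorem PB.pow {w : H → ℝ} (h : PB w) (m : ℕ) : PB (fun ω => w ω ^ m) := by
  induction m with
  | zero => simpa using PB.const 1
  | succ m ih => simpa [pow_succ] using ih.mul h

theorem PB.sum {ι : Type*} (s : Finset ι) {w : ι → H → ℝ} (h : ∀ i, PB (w i)) : 
    PB (fun ω => ∑ i ∈ s, w i ω) := by
  classical
  induction s using Finset.induction_on with
  | empty => simpa using PB.const 0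
  | insert a s ha ih => simpa [Finset.sum_insert ha] using (h a).add ih

theorem PB.int [MeasurableSpace H] [BorelSpace H] [FiniteDimensional ℝ H] {w : H → ℝ} (h : PB w) :
    Integrable w (stdGaussian H) := by
  obtain ⟨hc, C, N, hC, hb⟩ := h
  exact gauss_int _ w hc C N hb

end PB

section
variable {n : ℕ} {G : (Rn n → ℝ) → Prop}

theorem D0.zero (hC : Cls n G) : D0 G (fun _ => 0) := D0.of hC hC.zero

theorem D0.sum (hC : Cls n G) {ι : Type*} (s : Finset ι) (f : ι → Rn n → ℝ) (h : ∀ i, D0 G (f i)) : 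
    D0 G (fun u => ∑ i ∈ s, f i u) := by
  classical
  induction s using Finset.induction_on with
  | empty => simpa using D0.zero hC
  | insert a s ha ih => simpa [Finset.sum_insert ha] using (h a).add hC ih

theorem D0_expand (hC : Cls n G) {H : Type*} [NormedAddCommGroup H] [InnerProductSpace ℝ H]
    [MeasurableSpace H] [BorelSpace H] [FiniteDimensional ℝ H] (α : H → ℝ) (hα : PB α)
    (β : Fin n → H → ℝ) (hβ : ∀ i, PB (β i)) (m : ℕ) : ∀ (w : H → ℝ), PB w → ∀ (k : ℕ) (κ : Fin k → Fin n), 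
    D0 G (fun u => (∏ j, u (κ j)) * ∫ ω, w ω * (α ω + ∑ i, u i * β i ω) ^ m ∂(stdGaussian H)) := by
  induction m with
  | zero =>
    intro w hw k κ
    simpa [mul_comm] using (D0_prod hC κ).smul hC (∫ ω, w ω ∂(stdGaussian H))
  | succ m ih =>
    intro w hw k κ
    have h1 := ih _ (hw.mul hα) k κ
    have h2 := D0.sum hC Finset.univ _ (fun i => ih _ (hw.mul (hβ i)) (k + 1) (Fin.cons i κ))
    refine (h1.add hC h2).congr fun u _ => ?_
    simp only [Fin.prod_univ_succ, Fin.cons_zero, Fin.cons_succ]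
    have hq : PB (fun ω => (α ω + ∑ i, u i * β i ω) ^ m) :=
      (hα.add (PB.sum _ fun i => (PB.const _).mul (hβ i))).pow m
    have e : ∫ ω, w ω * (α ω + ∑ i, u i * β i ω) ^ (m + 1) ∂(stdGaussian H) = 
        ∫ ω, w ω * α ω * (α ω + ∑ i, u i * β i ω) ^ m ∂(stdGaussian H) +
        ∑ i, u i * ∫ ω, w ω * β i ω * (α ω + ∑ i, u i * β i ω) ^ m ∂(stdGaussian H) := by
      simp only [← integral_const_mul]
      rw [← integral_finsetSum _ (fun i _ => (((hw.mul (hβ i)).mul hq).int).const_mul _),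
        ← integral_add ((hw.mul hα).mul hq).int
        (integrable_finsetSum _ fun i _ => (((hw.mul (hβ i)).mul hq).int).const_mul _)]
      refine integral_congr_ae (ae_of_all _ fun ω => ?_)
      simp only
      rw [pow_succ]
      have : ∑ i, u i * (w ω * β i ω * (α ω + ∑ i, u i * β i ω) ^ m) = 
          w ω * (α ω + ∑ i, u i * β i ω) ^ m * ∑ i, u i * β i ω := by
        rw [Finset.mul_sum]
        exact Finset.sum_congr rfl fun i _ => by ring
      rw [this]; ring
    rw [e, mul_add, Finset.mul_sum]
    congr 1
    exact Finset.sum_congr rfl fun i _ => by ring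

abbrev En (n : ℕ) := EuclideanSpace ℝ (Fin n × Fin n)

noncomputable def Ph (u : Rn n) : En n →L[ℝ] Rn n := LinearMap.toContinuousLinearMap
  { toFun := fun ω => WithLp.toLp 2 fun j => ∑ i, u i * ω (i, j)
    map_add' := fun x y => by
      ext j; simp [mul_add, Finset.sum_add_distrib]
    map_smul' := fun t x => by
      ext j; simp only [PiLp.smul_apply, smul_eq_mul, RingHom.id_apply, Finset.mul_sum]
      exact Finset.sum_congr rfl fun i _ => by ring }

noncomputable def Phs (u : Rn n) : Rn n →L[ℝ] En n := LinearMap.toContinuousLinearMap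
  { toFun := fun a => WithLp.toLp 2 fun p => u p.1 * a p.2
    map_add' := fun x y => by
      ext j; simp [mul_add]
    map_smul' := fun t x => by
      ext j; simp only [PiLp.smul_apply, smul_eq_mul, RingHom.id_apply]; ring }

theorem Ph_apply (u : Rn n) (ω : En n) (j : Fin n) : Ph u ω j = ∑ i, u i * ω (i, j) := rfl
theorem Phs_apply (u a : Rn n) (p : Fin n × Fin n) : Phs u a p = u p.1 * a p.2 := rfl

theorem Ph_adj (u : Rn n) (ω : En n) (t : Rn n) : inner ℝ (Ph u ω) t = inner ℝ ω (Phs u t) := by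
  simp only [PiLp.inner_apply, Ph_apply, Phs_apply, Fintype.sum_prod_type, RCLike.inner_apply, conj_trivial,
    Finset.mul_sum]
  rw [Finset.sum_comm]
  exact Finset.sum_congr rfl fun i _ => Finset.sum_congr rfl fun j _ => by ring

theorem Ph_Phs {u : Rn n} (hu : ‖u‖ = 1) (t : Rn n) : Ph u (Phs u t) = t := by
  ext j
  simp only [Ph_apply, Phs_apply]
  have h1 : ∑ i, u i * u i = 1 := by
    have := Zf_unit hu
    exact_mod_cast this
  calc _ = (∑ i, u i * u i) * t j := by
        rw [Finset.sum_mul]; exact Finset.sum_congr rfl fun i _ => by ring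
    _ = _ := by rw [h1, one_mul]

theorem Ph_le {u : Rn n} (hu : ‖u‖ = 1) (ω : En n) : ‖Ph u ω‖ ≤ ‖ω‖ := by
  have h1 : ‖Ph u ω‖ ^ 2 ≤ ‖ω‖ * ‖Ph u ω‖ := by
    have h2 : ‖Phs u (Ph u ω)‖ = ‖Ph u ω‖ := by
      have : ‖Phs u (Ph u ω)‖ ^ 2 = ‖Ph u ω‖ ^ 2 := by
        rw [← real_inner_self_eq_norm_sq, ← Ph_adj, Ph_Phs hu, real_inner_self_eq_norm_sq]
      exact (sq_eq_sq₀ (norm_nonneg _) (norm_nonneg _)).1 this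
    rw [← real_inner_self_eq_norm_sq, Ph_adj]
    refine (real_inner_le_norm _ _).trans ?_
    rw [h2]
  rcases (norm_nonneg (Ph u ω)).eq_or_lt with h | h
  · rw [← h]; exact norm_nonneg _
  · nlinarith

noncomputable def ee (n : ℕ) : En n := WithLp.toLp 2 fun p => if p.1 = p.2 then (Real.sqrt n)⁻¹ else 0

theorem ee_norm (hn : 0 < n) : ‖ee n‖ = 1 := by
  have h : ‖ee n‖ ^ 2 = 1 := by
    rw [EuclideanSpace.real_norm_sq_eq, Fintype.sum_prod_type]
    simp only [ee]
    have : (0 : ℝ) < n := by exact_mod_cast hn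
    have h2 : Real.sqrt n ^ 2 = n := Real.sq_sqrt this.le
    simp [ite_pow, h2, this.ne']
  nlinarith [norm_nonneg (ee n)]

theorem Ph_ee (u : Rn n) : Ph u (ee n) = (Real.sqrt n)⁻¹ • u := by
  ext j
  simp [Ph_apply, ee, mul_comm]

theorem Ph_lin (u : Rn n) (ω : En n) : ‖Ph u ω‖ ≤ ‖ω‖ * ‖u‖ := by
  rcases eq_or_ne u 0 with rfl | hu
  · have : Ph (0 : Rn n) ω = 0 := by ext j; simp [Ph_apply]
    simp [this]
  · have hn : 0 < ‖u‖ := norm_pos_iff.2 hu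
    have h1 : ‖‖u‖⁻¹ • u‖ = 1 := by
      rw [norm_smul, norm_inv, norm_norm, inv_mul_cancel₀ hn.ne']
    have h2 : Ph u ω = ‖u‖ • Ph (‖u‖⁻¹ • u) ω := by
      ext j
      simp only [Ph_apply, PiLp.smul_apply, smul_eq_mul, Finset.mul_sum]
      exact Finset.sum_congr rfl fun i _ => by field_simp
    rw [h2, norm_smul, norm_norm, mul_comm]
    gcongr
    exact Ph_le h1 ω

theorem Ph_cont : Continuous (fun p : En n × Rn n => Ph p.2 p.1) := by
  have : (fun p : En n × Rn n => Ph p.2 p.1) = fun p => WithLp.toLp 2 fun j => ∑ i, p.2 i * p.1 (i, j) := rfl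
  rw [this]
  fun_prop

noncomputable def Phl (ω : En n) : Rn n →ₗ[ℝ] Rn n where
  toFun u := Ph u ω
  map_add' u v := by ext j; simp [Ph_apply, add_mul, Finset.sum_add_distrib]
  map_smul' t u := by
    ext j; simp only [Ph_apply, PiLp.smul_apply, smul_eq_mul, RingHom.id_apply, Finset.mul_sum]
    exact Finset.sum_congr rfl fun i _ => by ring

/-- the polynomially weighted Gaussian average of `h` is in the class. -/
theorem avg_mem (hC : Cls n G) (hn : 0 < n) {h : Rn n → ℝ} (hh : Sub h) (s : ℝ) (m : ℕ) :
    G (fun u => ∫ ω, h (Ph u ω) * (1 + s * inner ℝ ω (ee n)) ^ (2 * m) ∂(stdGaussian (En n))) := by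
  obtain ⟨C, hC0, hb, -⟩ := hh.lip
  have hhc := hh.continuous
  have hτ : PB (fun ω : En n => (inner ℝ ω (ee n) : ℝ)) := 
    PB.lin (by fun_prop) 1 zero_le_one fun ω => by
      refine (abs_real_inner_le_norm _ _).trans ?_
      rw [ee_norm hn]; linarith
  have hP : PB (fun ω : En n => (1 + s * inner ℝ ω (ee n)) ^ (2 * m)) :=
    ((PB.const 1).add ((PB.const s).mul hτ)).pow _
  have hPpos : ∀ ω : En n, 0 ≤ (1 + s * inner ℝ ω (ee n)) ^ (2 * m) := fun ω => by
    rw [pow_mul]; positivity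
  have hsub : Sub (fun u => ∫ ω, h (Ph u ω) * (1 + s * inner ℝ ω (ee n)) ^ (2 * m) ∂(stdGaussian (En n))) := by
    refine sub_integral (stdGaussian (En n)) (fun ω u => h (Ph u ω) * (1 + s * inner ℝ ω (ee n)) ^ (2 * m)) ?_ ?_
      (fun ω => C * ‖ω‖ * (1 + s * inner ℝ ω (ee n)) ^ (2 * m)) ?_ ?_
    · refine (hhc.comp Ph_cont).mul (hP.1.comp continuous_fst)
    · intro ω
      have := (hh.comp (Phl ω)).smul (hPpos ω)
      simpa [Phl, mul_comm] using this
    · exact (((PB.lin (by fun_prop) C hC0 fun ω => by rw [abs_of_nonneg (by positivity)]) : PB (fun ω : En n => C * ‖ω‖)).mul hP).int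
    · intro ω u
      rw [abs_mul, abs_of_nonneg (hPpos ω)]
      calc _ ≤ C * (‖ω‖ * ‖u‖) * (1 + s * inner ℝ ω (ee n)) ^ (2 * m) := by
            refine mul_le_mul_of_nonneg_right ((hb _).trans ?_) (hPpos ω)
            gcongr
            exact Ph_lin u ω
        _ = _ := by ring
  refine D0.mem hC ?_ hsub
  let i0 : Fin n := ⟨0, hn⟩
  let u0 : Rn n := EuclideanSpace.single i0 1
  have hu0 : ‖u0‖ = 1 := by simp [u0]
  set r : ℝ := (Real.sqrt n)⁻¹ with hr
  have hy : ∀ i, PB (fun ω : En n => Ph u0 ω i) := fun i => 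
    PB.lin (by fun_prop) 1 zero_le_one fun ω => by
      rw [one_mul]
      exact (PiLp.norm_apply_le (Ph u0 ω) i).trans (Ph_le hu0 ω)
  have hb0 : PB (fun ω : En n => inner ℝ ω (ee n) - inner ℝ (Ph u0 ω) (Ph u0 (ee n))) := by
    refine PB.lin (by fun_prop) 2 zero_le_two fun ω => ?_
    have h1 := abs_real_inner_le_norm ω (ee n)
    have h2 := abs_real_inner_le_norm (Ph u0 ω) (Ph u0 (ee n))
    have h3 := Ph_le hu0 ω
    have h4 := Ph_le hu0 (ee n)
    rw [ee_norm hn] at h1 h4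
    have h5 : ‖Ph u0 ω‖ * ‖Ph u0 (ee n)‖ ≤ ‖ω‖ * 1 := mul_le_mul h3 h4 (norm_nonneg _) (norm_nonneg _)
    have := abs_sub (inner ℝ ω (ee n)) (inner ℝ (Ph u0 ω) (Ph u0 (ee n)))
    linarith
  have hw : PB (fun ω : En n => h (Ph u0 ω)) := 
    PB.lin (by fun_prop) C hC0 fun ω => (hb _).trans (by gcongr; exact Ph_le hu0 ω)
  have hα := (PB.const 1).add ((PB.const s).mul hb0)
  have hβ := fun i => (PB.const (s * r)).mul (hy i)
  have hD := D0_expand hC _ hα _ hβ (2 * m) _ hw 0 Fin.elim0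
  refine hD.congr fun u hu => ?_
  simp only [Finset.univ_eq_empty, Finset.prod_empty, one_mul]
  have hlaw := law_pair (ee n) (ee_norm hn) (Ph u) (Ph u0) (Phs u) (Phs u0) (Ph_adj u) (Ph_Phs hu)
    (Ph_adj u0) (Ph_Phs hu0) (by rw [Ph_ee, Ph_ee, norm_smul, norm_smul, hu, hu0])
  let Q : WithLp 2 (Rn n × ℝ) → ℝ := fun p => h p.ofLp.1 * (1 + s * (p.ofLp.2 + r * inner ℝ p.ofLp.1 u)) ^ (2 * m)
  have hQ : Continuous Q := by fun_prop
  have hint : ∀ v : Rn n, ∫ p, Q p ∂((stdGaussian (En n)).map (fun ω => (WithLp.toLp 2 (Ph v ω, inner ℝ ω (ee n) - inner ℝ (Ph v ω) (Ph v (ee n))) : WithLp 2 (Rn n × ℝ)))) = 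
      ∫ ω, Q (WithLp.toLp 2 (Ph v ω, inner ℝ ω (ee n) - inner ℝ (Ph v ω) (Ph v (ee n)))) ∂(stdGaussian (En n)) := fun v => 
    integral_map (Continuous.measurable (by fun_prop)).aemeasurable hQ.aestronglyMeasurable
  have e1 := hint u
  rw [hlaw, hint u0] at e1
  calc _ = ∫ ω, Q (WithLp.toLp 2 (Ph u ω, inner ℝ ω (ee n) - inner ℝ (Ph u ω) (Ph u (ee n)))) ∂(stdGaussian (En n)) := by
        refine integral_congr_ae (ae_of_all _ fun ω => ?_)
        simp only [Q, Ph_ee, inner_smul_right, ← hr, sub_add_cancel]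
    _ = _ := e1.symm
    _ = _ := by
        refine integral_congr_ae (ae_of_all _ fun ω => ?_)
        simp only [Q]
        congr 2
        have : inner ℝ (Ph u0 ω) u = ∑ i, u i * Ph u0 ω i := by
          simp [PiLp.inner_apply]
        rw [this, mul_add, ← add_assoc, ← mul_assoc, Finset.mul_sum]
        congr 1
        exact Finset.sum_congr rfl fun i _ => by ring

theorem all_mem (hC : Cls n G) {h : Rn n → ℝ} (hh : Sub h) : G h := by
  rcases Nat.eq_zero_or_pos n with rfl | hn
  · have : h = fun _ => 0 := by
      ext u; rw [Subsingleton.elim u 0]; exact hh.zero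
    rw [this]; exact hC.zero
  obtain ⟨C, hC0, hb, hl⟩ := hh.lip
  have hhc := hh.continuous
  set r : ℝ := (Real.sqrt n)⁻¹ with hr
  have hr0 : 0 < r := by
    have : (0 : ℝ) < n := by exact_mod_cast hn
    positivity
  let μ := stdGaussian (En n)
  let τ : En n → ℝ := fun ω => inner ℝ ω (ee n)
  let ω0 : En n → En n := fun ω => ω - (inner ℝ ω (ee n) : ℝ) • ee n
  set M : ℝ := ∫ ω, ‖ω0 ω‖ ∂μ with hM
  have hM0 : 0 ≤ M := integral_nonneg fun _ => norm_nonneg _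
  refine hC.lim h hh fun δ hδ => ?_
  set B : ℝ := C * (r + M) + 1 with hB
  have hB0 : 0 < B := by positivity
  obtain ⟨s, m, hsm⟩ := g1_poly (δ * r / B) (by positivity)
  let P : ℝ → ℝ := fun x => (1 + s * x) ^ (2 * m)
  have hPpos : ∀ x, 0 ≤ P x := fun x => by simp only [P]; rw [pow_mul]; positivity
  have hPc : Continuous P := by fun_prop
  have hτ : PB τ := 
    PB.lin (by fun_prop) 1 zero_le_one fun ω => by
      refine (abs_real_inner_le_norm _ _).trans ?_
      rw [ee_norm hn]; linarith
  have hPB : PB (fun ω => P (τ ω)) := ((PB.const 1).add ((PB.const s).mul hτ)).pow _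
  have hτ1 : PB (fun ω => max (τ ω) 0) := by
    obtain ⟨h1, D, N, h2, h3⟩ := hτ
    refine ⟨by fun_prop, D, N, h2, fun ω => le_trans ?_ (h3 ω)⟩
    rw [abs_of_nonneg (le_max_right _ _)]
    exact max_le (le_abs_self _) (abs_nonneg _)
  have hτ2 : PB (fun ω => max (-τ ω) 0) := by
    obtain ⟨h1, D, N, h2, h3⟩ := hτ
    refine ⟨by fun_prop, D, N, h2, fun ω => le_trans ?_ (h3 ω)⟩
    rw [abs_of_nonneg (le_max_right _ _)]
    exact max_le (neg_le_abs _) (abs_nonneg _)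
  have hω0 : PB (fun ω => ‖ω0 ω‖) := by
    refine PB.lin (by fun_prop) 2 zero_le_two fun ω => ?_
    rw [abs_of_nonneg (norm_nonneg _)]
    refine (norm_sub_le _ _).trans ?_
    rw [norm_smul, ee_norm hn]
    have := abs_real_inner_le_norm ω (ee n)
    rw [ee_norm hn] at this
    rw [Real.norm_eq_abs]; linarith
  -- transfer
  have htr : ∫ x, P x * (δ * r / B * max x 0 - (max (-x) 0 + 1)) ∂(gaussianReal 0 1) = 
      δ * r / B * ∫ ω, P (τ ω) * max (τ ω) 0 ∂μ - (∫ ω, P (τ ω) * max (-τ ω) 0 ∂μ + ∫ ω, P (τ ω) ∂μ) := by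
    rw [← law_proj (ee n) (ee_norm hn), integral_map (Continuous.measurable (by fun_prop)).aemeasurable
      (Continuous.aestronglyMeasurable (by fun_prop)), ← integral_const_mul, 
      ← integral_add (hPB.mul hτ2).int hPB.int, ← integral_sub ((hPB.mul hτ1).int.const_mul _) ((hPB.mul hτ2).add hPB).int]
    refine integral_congr_ae (ae_of_all _ fun ω => ?_)
    simp only [τ]; ring
  have hsm' : 0 < δ * r / B * ∫ ω, P (τ ω) * max (τ ω) 0 ∂μ - (∫ ω, P (τ ω) * max (-τ ω) 0 ∂μ + ∫ ω, P (τ ω) ∂μ) := by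
    rw [← htr]; exact hsm
  set a := ∫ ω, P (τ ω) * max (τ ω) 0 ∂μ with ha
  set b := ∫ ω, P (τ ω) * max (-τ ω) 0 ∂μ with hbdef
  set c := ∫ ω, P (τ ω) ∂μ with hc
  have hb0 : 0 ≤ b := integral_nonneg fun ω => mul_nonneg (hPpos _) (le_max_right _ _)
  have hc0 : 0 ≤ c := integral_nonneg fun ω => hPpos _
  have ha0 : 0 < a := by
    by_contra hneg
    push Not at hneg
    have : δ * r / B * a ≤ 0 := mul_nonpos_of_nonneg_of_nonpos (by positivity) hneg
    linarith
  have hind : ∫ ω, P (τ ω) * ‖ω0 ω‖ ∂μ = c * M := by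
    have := (indep_proj (ee n) (ee_norm hn)).comp (φ := P) (ψ := fun x => ‖x‖) hPc.measurable continuous_norm.measurable
    exact this.integral_fun_mul_eq_mul_integral (hPB.1.aestronglyMeasurable) hω0.1.aestronglyMeasurable
  have hmem := avg_mem hC hn hh s m
  have hg2 := hC.smul (r * a)⁻¹ _ (by positivity) hmem
  refine ⟨_, hg2, hom_ext (hC.sub _ hg2) hh fun u hu => ?_⟩
  have hhu : PB (fun ω : En n => h (Ph u ω)) := 
    PB.lin (by fun_prop) C hC0 fun ω => (hb _).trans (by gcongr; exact Ph_le hu ω)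
  have hu1 : |h u| ≤ C := by simpa [hu] using hb u
  have hu2 : |h (-u)| ≤ C := by simpa [hu] using hb (-u)
  have hpt : ∀ ω : En n, |h (Ph u ω) - r * max (τ ω) 0 * h u| ≤ C * ‖ω0 ω‖ + C * r * max (-τ ω) 0 := by
    intro ω
    have e1 : Ph u ω = (r * τ ω) • u + Ph u (ω0 ω) := by
      simp only [ω0, τ, map_sub, map_smul, Ph_ee, smul_smul, ← hr]
      rw [mul_comm r]; abel
    have h1 : |h (Ph u ω) - h ((r * τ ω) • u)| ≤ C * ‖ω0 ω‖ := by
      refine (hl _ _).trans ?_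
      rw [e1, add_sub_cancel_left]
      gcongr
      exact Ph_le hu _
    have h2 : h ((r * τ ω) • u) = r * max (τ ω) 0 * h u + r * max (-τ ω) 0 * h (-u) := by
      rcases le_total 0 (τ ω) with ht | ht
      · rw [hh.2 _ (by positivity), max_eq_left ht, max_eq_right (by linarith)]; ring
      · have : (r * τ ω) • u = (r * (-τ ω)) • (-u) := by simp
        rw [this, hh.2 _ (mul_nonneg hr0.le (by linarith)), max_eq_right ht, max_eq_left (by linarith)]; ring
    have h3 : |r * max (-τ ω) 0 * h (-u)| ≤ C * r * max (-τ ω) 0 := by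
      have h4 : 0 ≤ r * max (-τ ω) 0 := mul_nonneg hr0.le (le_max_right _ _)
      rw [abs_mul, abs_of_nonneg h4]
      nlinarith
    have e2 : h (Ph u ω) - r * max (τ ω) 0 * h u = (h (Ph u ω) - h ((r * τ ω) • u)) + r * max (-τ ω) 0 * h (-u) := by
      rw [h2]; ring
    rw [e2]
    exact (abs_add_le _ _).trans (add_le_add h1 h3)
  have hmain : |(∫ ω, h (Ph u ω) * P (τ ω) ∂μ) - r * a * h u| ≤ C * (c * M) + C * r * b := by
    have e1 : (∫ ω, h (Ph u ω) * P (τ ω) ∂μ) - r * a * h u = 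
        ∫ ω, P (τ ω) * (h (Ph u ω) - r * max (τ ω) 0 * h u) ∂μ := by
      have : r * a * h u = ∫ ω, (r * h u) * (P (τ ω) * max (τ ω) 0) ∂μ := by
        rw [integral_const_mul]; ring
      rw [this, ← integral_sub (hhu.mul hPB).int ((hPB.mul hτ1).int.const_mul _)]
      refine integral_congr_ae (ae_of_all _ fun ω => ?_)
      simp only; ring
    have e2 : C * (c * M) + C * r * b = ∫ ω, (C * (P (τ ω) * ‖ω0 ω‖) + C * r * (P (τ ω) * max (-τ ω) 0)) ∂μ := by
      rw [integral_add ((hPB.mul hω0).int.const_mul _) ((hPB.mul hτ2).int.const_mul _), integral_const_mul,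
        integral_const_mul, hind]
    rw [e1, e2, ← Real.norm_eq_abs]
    refine norm_integral_le_of_norm_le (((PB.const C).mul (hPB.mul hω0)).add ((PB.const (C * r)).mul (hPB.mul hτ2))).int
      (ae_of_all _ fun ω => ?_)
    rw [norm_mul, Real.norm_of_nonneg (hPpos _), Real.norm_eq_abs]
    have := mul_le_mul_of_nonneg_left (hpt ω) (hPpos (τ ω))
    nlinarith
  have hra : 0 < r * a := by positivity
  have e3 : (r * a)⁻¹ * (∫ ω, h (Ph u ω) * P (τ ω) ∂μ) - h u = 
      (r * a)⁻¹ * ((∫ ω, h (Ph u ω) * P (τ ω) ∂μ) - r * a * h u) := by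
    rw [mul_sub, inv_mul_cancel_left₀ hra.ne']
  change |(r * a)⁻¹ * (∫ ω, h (Ph u ω) * P (τ ω) ∂μ) - h u| ≤ δ
  rw [e3, abs_mul, abs_of_pos (inv_pos.2 hra), inv_mul_le_iff₀ hra]
  refine hmain.trans ?_
  have h5 : B * (b + c) ≤ δ * r * a := by
    have : b + c ≤ δ * r / B * a := by linarith
    have h6 := mul_le_mul_of_nonneg_left this hB0.le
    have : B * (δ * r / B * a) = δ * r * a := by field_simp
    linarith
  have h7 : C * (c * M) + C * r * b ≤ B * (b + c) := by
    rw [hB]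
    nlinarith [mul_nonneg (mul_nonneg hC0 hM0) hb0, mul_nonneg (mul_nonneg hC0 hr0.le) hc0]
  linarith
end

/-- Theorem D -/
theorem minkowski_invariance {n : ℕ} (φ : TIValuation n) (ε : ℝ)
    (h : ∀ K, IsConvexBody K → ∀ L, IsConvexBody L → ∀ ι : Rn 2 →L[ℝ] Rn n,
      φ.val (K + (ι '' L + ε • (ι '' L))) = φ.val K) (K Z : Set (Rn n)) (hK : IsConvexBody K) (hZ : IsConvexBody Z) :
    φ.val (K + (Z + ε • Z)) = φ.val K := by
  obtain ⟨g, hg⟩ := body_supp hZ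
  obtain ⟨Z', hZ', hg', hv⟩ := all_mem (cls_of_val φ ε h) hg.sub
  have := hv K hK 1 zero_le_one
  rw [supp_unique hZ hZ' hg hg']
  simpa using this

end KS

namespace KS

theorem flat_eq {n : ℕ} {F : Set (Rn (n+1))} (hF : IsConvexBody F) (h : Flat F) :
    ∃ (ι : Rn n →L[ℝ] Rn (n+1)) (A : Set (Rn n)) (p : Rn (n+1)), IsConvexBody A ∧ F = ι '' A + {p} := by
  obtain ⟨a, ha, c, hc⟩ := h
  obtain ⟨p, hp⟩ := hF.1
  have h1 : a.toLinearMap ≠ 0 := by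
    intro h; apply ha; ext x; exact congrArg (fun f => f x) h
  have h2 : Module.finrank ℝ (LinearMap.ker a.toLinearMap) = n := by
    have h3 := LinearMap.finrank_range_add_finrank_ker a.toLinearMap
    rw [LinearMap.range_eq_top.2 (LinearMap.surjective h1)] at h3
    simp at h3
    omega
  let e : Rn n ≃ₗ[ℝ] LinearMap.ker a.toLinearMap := LinearEquiv.ofFinrankEq _ _ (by rw [h2]; simp)
  let ι0 : Rn n →ₗ[ℝ] Rn (n+1) := (LinearMap.ker a.toLinearMap).subtype ∘ₗ e.toLinearMap
  have hι : LinearMap.ker ι0 = ⊥ := by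
    rw [LinearMap.ker_eq_bot]
    exact (Submodule.subtype_injective _).comp e.injective
  obtain ⟨Q, hQ⟩ := LinearMap.exists_leftInverse_of_injective ι0 hι
  refine ⟨LinearMap.toContinuousLinearMap ι0, (LinearMap.toContinuousLinearMap Q) '' (F + {-p}), p,
    body_image _ (body_add hF (body_singleton _)), ?_⟩
  have key : ∀ x ∈ F, ι0 (Q (x - p)) = x - p := by
    intro x hx
    have hk : x - p ∈ LinearMap.ker a.toLinearMap := by
      simp [hc x hx, hc p hp]
    have h4 : ι0 (e.symm ⟨x - p, hk⟩) = x - p := by simp [ι0]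
    have h5 : Q (ι0 (e.symm ⟨x - p, hk⟩)) = e.symm ⟨x - p, hk⟩ := by
      have := congrArg (fun f => f (e.symm ⟨x - p, hk⟩)) hQ
      simpa using this
    rw [h4] at h5
    rw [h5, h4]
  ext x
  rw [mem_add_sing]
  constructor
  · intro hx
    refine ⟨Q (x - p), ⟨x - p, ?_, rfl⟩, key x hx⟩
    rw [mem_add_sing]; simpa using hx
  · rintro ⟨_, ⟨y, hy, rfl⟩, hxy⟩
    rw [mem_add_sing, sub_neg_eq_add] at hy
    have := key _ hy
    simp only [LinearMap.coe_toContinuousLinearMap', add_sub_cancel_right] at this hxy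
    rw [this] at hxy
    have : x = y + p := by rw [hxy]; simp
    rwa [this]

theorem line_body {A : Set (Rn 1)} (hA : IsConvexBody A) : ∃ p q, A = segment ℝ p q := by
  obtain ⟨p, hp, hp'⟩ := hA.2.1.exists_isMinOn hA.1 (pr (0 : Fin 1)).continuous.continuousOn
  obtain ⟨q, hq, hq'⟩ := hA.2.1.exists_isMaxOn hA.1 (pr (0 : Fin 1)).continuous.continuousOn
  refine ⟨p, q, Set.Subset.antisymm ?_ (hA.2.2.segment_subset hp hq)⟩
  intro x hx
  have h1 : p 0 ≤ x 0 := hp' hx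
  have h2 : x 0 ≤ q 0 := hq' hx
  have h3 : x 0 ∈ segment ℝ (p 0) (q 0) := by
    rw [segment_eq_Icc (h1.trans h2)]; exact ⟨h1, h2⟩
  obtain ⟨a, b, ha, hb, hab, hx'⟩ := h3
  refine ⟨a, b, ha, hb, hab, ?_⟩
  ext i
  have : i = 0 := Subsingleton.elim _ _
  subst this
  simpa using hx'

theorem seg_trans {n : ℕ} (p q : Rn n) : segment ℝ p q = segment ℝ 0 (q - p) + {p} := by
  rw [segment_eq_image', segment_eq_image']
  ext x
  simp only [Set.add_singleton, Set.mem_image, sub_zero, zero_add, exists_exists_and_eq_and]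
  constructor <;> rintro ⟨t, ht, rfl⟩ <;> exact ⟨t, ht, by abel⟩

theorem seg_image {m n : ℕ} (f : Rn m →L[ℝ] Rn n) (p q : Rn m) : f '' segment ℝ p q = segment ℝ (f p) (f q) :=
  image_segment ℝ f.toLinearMap.toAffineMap p q

theorem flat_planar {L : Set (Rn 2)} (hL : IsConvexBody L) (h : Flat L) :
    ∃ v p, L = segment ℝ 0 v + {p} := by
  obtain ⟨ι, A, p, hA, rfl⟩ := flat_eq hL h
  obtain ⟨a, b, rfl⟩ := line_body hA
  refine ⟨ι b - ι a, ι a + p, ?_⟩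
  rw [seg_image, seg_trans, add_assoc, Set.singleton_add_singleton]

/-- segment as an image of the 1-dim cube -/
theorem seg_eq_image {n : ℕ} (v : Rn n) : ∃ κ : Rn 1 →L[ℝ] Rn n, segment ℝ 0 v = κ '' cube 1 := by
  refine ⟨(pr 0).smulRight v, ?_⟩
  ext x
  rw [mem_seg0]
  constructor
  · rintro ⟨s, h0, h1, rfl⟩
    refine ⟨s • E1 0, ?_, ?_⟩
    · intro k
      have : k = 0 := Subsingleton.elim _ _
      subst this
      simp [h0, h1]
    · simp
  · rintro ⟨y, hy, rfl⟩
    exact ⟨y 0, (hy 0).1, (hy 0).2, by simp⟩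

theorem image_cube_two {n : ℕ} (ι : Rn 2 →L[ℝ] Rn n) :
    ι '' cube 2 = segment ℝ 0 (ι (E1 0)) + segment ℝ 0 (ι (E1 1)) := by
  have hx : ∀ y : Rn 2, y = y 0 • E1 0 + y 1 • E1 1 := by
    intro y; ext i; fin_cases i <;> simp 
  ext x
  constructor
  · rintro ⟨y, hy, rfl⟩
    refine ⟨y 0 • ι (E1 0), mem_seg0.2 ⟨_, (hy 0).1, (hy 0).2, rfl⟩,
      y 1 • ι (E1 1), mem_seg0.2 ⟨_, (hy 1).1, (hy 1).2, rfl⟩, ?_⟩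
    conv_rhs => rw [hx y]
    simp only [map_add, map_smul]
  · rintro ⟨a, ha, b, hb, rfl⟩
    obtain ⟨s, h0, h1, rfl⟩ := mem_seg0.1 ha
    obtain ⟨t, h0', h1', rfl⟩ := mem_seg0.1 hb
    refine ⟨s • E1 0 + t • E1 1, ?_, by simp only [map_add, map_smul]⟩
    intro k
    fin_cases k <;> simp [h0, h1, h0', h1']

/-- concatenation of linear maps -/
theorem exists_concat {k l n : ℕ} (f : Rn k →L[ℝ] Rn n) (g : Rn l →L[ℝ] Rn n) :
    ∃ L : Rn (k + l) →L[ℝ] Rn n, f '' cube k + g '' cube l = L '' cube (k + l) := by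
  let P : Rn (k + l) →ₗ[ℝ] Rn k :=
    { toFun := fun x => WithLp.toLp 2 fun i => x (Fin.castAdd l i)
      map_add' := fun x y => by ext i; simp
      map_smul' := fun x y => by ext i; simp }
  let Q : Rn (k + l) →ₗ[ℝ] Rn l :=
    { toFun := fun x => WithLp.toLp 2 fun i => x (Fin.natAdd k i)
      map_add' := fun x y => by ext i; simp
      map_smul' := fun x y => by ext i; simp }
  refine ⟨LinearMap.toContinuousLinearMap (f.toLinearMap ∘ₗ P + g.toLinearMap ∘ₗ Q), ?_⟩
  ext x
  constructor
  · rintro ⟨_, ⟨a, ha, rfl⟩, _, ⟨b, hb, rfl⟩, rfl⟩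
    refine ⟨WithLp.toLp 2 (Fin.append a b), ?_, ?_⟩
    · intro i
      refine Fin.addCases (fun j => ?_) (fun j => ?_) i
      · simpa using ha j
      · simpa using hb j
    · simp [P, Q]
  · rintro ⟨y, hy, rfl⟩
    refine ⟨f (P y), ⟨_, fun i => ?_, rfl⟩, g (Q y), ⟨_, fun i => ?_, rfl⟩, ?_⟩
    · exact hy _
    · exact hy _
    · simp

/-! ### Planar step -/

noncomputable def planar {n : ℕ} (φ : TIValuation n) (ι : Rn 2 →L[ℝ] Rn n) (K : Set (Rn n)) (hK : IsConvexBody K) :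
    TIValuation 2 :=
  comb 1 0 (-φ.val K) (pull φ ι K hK) (pull φ ι K hK)

theorem planar_val {n : ℕ} (φ : TIValuation n) (ι : Rn 2 →L[ℝ] Rn n) (K : Set (Rn n)) (hK : IsConvexBody K)
    (L : Set (Rn 2)) : (planar φ ι K hK).val L = φ.val (ι '' L + K) - φ.val K := by
  simp [planar, sub_eq_add_neg]

theorem planar_simple {n : ℕ} {φ : TIValuation n}
    (hseg : ∀ v K, IsConvexBody K → φ.val (K + segment ℝ 0 v) = φ.val K)
    (ι : Rn 2 →L[ℝ] Rn n) (K : Set (Rn n)) (hK : IsConvexBody K) : Simple (planar φ ι K hK) := by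
  intro L hL hF
  obtain ⟨v, p, rfl⟩ := flat_planar hL hF
  rw [planar_val, Set.image_add, seg_image, Set.image_singleton, map_zero, add_comm, ← add_assoc,
    val_add_singleton φ (body_add hK (body_segment _ _)), hseg _ _ hK, sub_self]

theorem planar_cube {n : ℕ} {φ : TIValuation n}
    (hseg : ∀ v K, IsConvexBody K → φ.val (K + segment ℝ 0 v) = φ.val K)
    (ι : Rn 2 →L[ℝ] Rn n) (K : Set (Rn n)) (hK : IsConvexBody K) : (planar φ ι K hK).val (cube 2) = 0 := by
  rw [planar_val, image_cube_two, add_comm, ← add_assoc, hseg _ _ (body_add hK (body_segment _ _)),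
    hseg _ _ hK, sub_self]

/-! ### Standard simplex -/

def Dl (n : ℕ) : Set (Rn n) := {x | (∀ i, 0 ≤ x i) ∧ ∑ i, x i ≤ 1}

theorem hull_eq {n : ℕ} (p : Fin (n + 1) → Rn n) :
    ∃ M : Rn n →L[ℝ] Rn n, convexHull ℝ (Set.range p) = M '' Dl n + {p 0} := by
  refine ⟨∑ i, (pr i).smulRight (p i.succ - p 0), ?_⟩
  ext x
  rw [mem_hull, mem_add_sing]
  constructor
  · rintro ⟨w, hw, hw1, rfl⟩
    rw [Fin.sum_univ_succ] at hw1
    refine ⟨WithLp.toLp 2 fun i => w i.succ, ⟨fun i => hw _, ?_⟩, ?_⟩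
    · have := hw 0
      simp only; linarith
    · have h0 : w 0 = 1 - ∑ i : Fin n, w i.succ := by linarith
      rw [Fin.sum_univ_succ, h0]
      simp [smul_sub, Finset.sum_sub_distrib, sub_smul, Finset.sum_smul]
      abel
  · rintro ⟨y, ⟨hy0, hy1⟩, hy⟩
    refine ⟨Fin.cons (1 - ∑ i, y i) y, ?_, ?_, ?_⟩
    · intro i
      refine Fin.cases ?_ (fun j => ?_) i
      · simpa using hy1
      · simpa using hy0 j
    · simp [Fin.sum_univ_succ]
    · have hx : x = (∑ i, (pr i).smulRight (p i.succ - p 0)) y + p 0 := by rw [hy]; simp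
      rw [Fin.sum_univ_succ, hx]
      simp [smul_sub, Finset.sum_sub_distrib, sub_smul, Finset.sum_smul]
      abel

theorem body_Dl (n : ℕ) : IsConvexBody (Dl n) := by
  have : Dl n = cube n ∩ {x | (∑ i, pr i) x ≤ 1} := by
    ext x
    simp only [Dl, cube, box, Set.mem_ofPred_eq, Set.mem_inter_iff]
    simp only [sum_apply, pr_apply]
    constructor
    · rintro ⟨h0, h1⟩
      refine ⟨fun k => ⟨h0 k, ?_⟩, h1⟩
      exact (Finset.single_le_sum (fun i _ => h0 i) (Finset.mem_univ k)).trans h1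
    · rintro ⟨h0, h1⟩
      exact ⟨fun k => (h0 k).1, h1⟩
  rw [this]
  refine body_le (body_cube n) _ _ ⟨0, ?_, ?_⟩
  · intro k; simp
  · simp

end KS

namespace KS

theorem neg_image {m n : ℕ} (f : Rn m →L[ℝ] Rn n) (A : Set (Rn m)) : f '' (-A) = -(f '' A) := by
  ext x; constructor
  · rintro ⟨y, hy, rfl⟩; exact ⟨-y, hy, by simp⟩
  · rintro ⟨y, hy, h⟩; exact ⟨-y, by simpa using hy, by rw [map_neg, h, neg_neg]⟩

def EvenThm (n : ℕ) : Prop := ∀ φ : TIValuation n, Simple φ →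
  (∀ K, IsConvexBody K → φ.val (-K) = φ.val K) → φ.val (cube n) = 0 →
  ∀ K, IsConvexBody K → φ.val K = 0

theorem sum_pr_apply {n : ℕ} (x : Rn n) : (∑ i, pr i) x = ∑ i, x i := by
  simp only [sum_apply, pr_apply]

/-- The simplex value. -/
theorem even_of_sym {n : ℕ} (hn : 2 ≤ n) {φ : TIValuation n} (h : Simple φ)
    (heven : ∀ K, IsConvexBody K → φ.val (-K) = φ.val K) (hc : φ.val (cube n) = 0)
    (hS : ∀ S, IsConvexBody S → S ⊆ {x | 1 ≤ ∑ i, x i ∧ ∑ i, x i ≤ (n:ℝ) - 1} →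
      (∃ u, S = -S + {u}) → φ.val S = 0) : φ.val (Dl n) = 0 := by
  have hn' : (2:ℝ) ≤ n := by exact_mod_cast hn
  let i0 : Fin n := ⟨0, by omega⟩
  have ha : (∑ i, pr i : Rn n →L[ℝ] ℝ) ≠ 0 := by
    intro h0
    have := congrArg (fun f => f (E1 i0)) h0
    simp only [sum_pr_apply, E1_apply] at this
    simp at this
  let one : Rn n := WithLp.toLp 2 fun _ => 1
  have hle : ∀ x : Rn n, (∀ i, 0 ≤ x i) → ∀ k, x k ≤ ∑ i, x i := fun x hx k =>
    Finset.single_le_sum (fun i _ => hx i) (Finset.mem_univ k)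
  have e1 : cube n ∩ {x | (∑ i, pr i) x ≤ 1} = Dl n := by
    ext x
    simp only [Dl, cube, box, Set.mem_ofPred_eq, Set.mem_inter_iff, sum_pr_apply]
    constructor
    · rintro ⟨h0, h1⟩
      exact ⟨fun k => (h0 k).1, h1⟩
    · rintro ⟨h0, h1⟩
      exact ⟨fun k => ⟨h0 k, (hle x h0 k).trans h1⟩, h1⟩
  set C1 := cube n ∩ {x | 1 ≤ (∑ i, pr i) x} with hC1
  have m0 : E1 i0 ∈ cube n := by
    intro k; rw [E1_apply]; split_ifs <;> norm_num
  have s0 : (∑ i, pr i) (E1 i0) = 1 := by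
    simp only [sum_pr_apply, E1_apply]; simp
  have m1 : one ∈ cube n := by
    intro k; simp [one]
  have s1 : (∑ i, pr i) one = n := by
    simp only [sum_pr_apply]; simp [one]
  have nC1 : C1.Nonempty := ⟨E1 i0, m0, by simp [s0]⟩
  have bC1 : IsConvexBody C1 := body_ge (body_cube n) _ _ nC1
  set S := C1 ∩ {x | (∑ i, pr i) x ≤ (n:ℝ) - 1} with hSdef
  have nS : S.Nonempty := ⟨E1 i0, ⟨m0, by simp [s0]⟩, by rw [Set.mem_ofPred_eq, s0]; linarith⟩
  have bS : IsConvexBody S := body_le bC1 _ _ nS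
  set T := C1 ∩ {x | (n:ℝ) - 1 ≤ (∑ i, pr i) x} with hT
  have nT : T.Nonempty := ⟨one, ⟨m1, by rw [Set.mem_ofPred_eq, s1]; linarith⟩, by rw [Set.mem_ofPred_eq, s1]; linarith⟩
  have eT : T = -Dl n + {one} := by
    ext x
    rw [mem_add_sing, Set.mem_neg]
    simp only [hT, hC1, Dl, cube, box, Set.mem_ofPred_eq, Set.mem_inter_iff, sum_pr_apply, neg_sub]
    simp only [PiLp.sub_apply, one, Finset.sum_sub_distrib, Finset.sum_const, Finset.card_univ, Fintype.card_fin,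
      nsmul_eq_mul, mul_one]
    constructor
    · rintro ⟨⟨h0, h1⟩, h2⟩
      exact ⟨fun k => by linarith [(h0 k).2], by linarith⟩
    · rintro ⟨h0, h1⟩
      refine ⟨⟨fun k => ⟨?_, by linarith [h0 k]⟩, by linarith⟩, by linarith⟩
      have := hle (one - x) (fun i => by simpa [one] using h0 i) k
      simp only [PiLp.sub_apply, one, Finset.sum_sub_distrib, Finset.sum_const, Finset.card_univ, Fintype.card_fin,
      nsmul_eq_mul, mul_one] at this
      linarith
  have eS : S = -S + {one} := by
    ext x
    rw [mem_add_sing, Set.mem_neg]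
    simp only [hSdef, hC1, cube, box, Set.mem_ofPred_eq, Set.mem_inter_iff, sum_pr_apply, neg_sub]
    simp only [PiLp.sub_apply, one, Finset.sum_sub_distrib, Finset.sum_const, Finset.card_univ, Fintype.card_fin,
      nsmul_eq_mul, mul_one]
    constructor
    · rintro ⟨⟨h0, h1⟩, h2⟩
      exact ⟨⟨fun k => ⟨by linarith [(h0 k).2], by linarith [(h0 k).1]⟩, by linarith⟩, by linarith⟩
    · rintro ⟨⟨h0, h1⟩, h2⟩
      exact ⟨⟨fun k => ⟨by linarith [(h0 k).2], by linarith [(h0 k).1]⟩, by linarith⟩, by linarith⟩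
  have v1 := val_cut h (body_cube n) ha (c := 1) (by rw [e1]; exact (body_Dl n).1) nC1
  have v2 := val_cut h bC1 ha (c := (n:ℝ) - 1) nS nT
  rw [e1, ← hC1, hc, v2, ← hSdef, ← hT, eT, val_add_singleton φ (body_neg (body_Dl n)), heven _ (body_Dl n),
    hS S bS ?_ ⟨_, eS⟩] at v1
  · have : 2 * φ.val (Dl n) = 0 := by rw [two_mul]; simpa using v1.symm
    simpa using this
  · rintro x ⟨⟨_, h1⟩, h2⟩
    simp only [Set.mem_ofPred_eq, sum_pr_apply] at h1 h2
    exact ⟨h1, h2⟩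

theorem lpull_even {n : ℕ} {φ : TIValuation n}
    (heven : ∀ K, IsConvexBody K → φ.val (-K) = φ.val K) (M : Rn n →L[ℝ] Rn n) :
    ∀ K, IsConvexBody K → (lpull φ M).val (-K) = (lpull φ M).val K := by
  intro K hK
  rw [lpull_val, lpull_val, neg_image, heven _ (body_image M hK)]

/-- reduction of the even theorem to the standard simplex -/
theorem even_of_Dl {n : ℕ} (H : ∀ φ : TIValuation n, Simple φ →
    (∀ K, IsConvexBody K → φ.val (-K) = φ.val K) → φ.val (cube n) = 0 → φ.val (Dl n) = 0) : EvenThm n := by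
  intro φ h he hc K hK
  refine vanish_of_simplex h (fun p => ?_) hK
  obtain ⟨M, hM⟩ := hull_eq p
  rw [hM, val_add_singleton φ (body_image M (body_Dl n)), ← lpull_val]
  refine H _ (h.lpull M) (lpull_even he M) ?_
  rw [lpull_val]
  exact vanish_cube_image h hc M

theorem even_zero : EvenThm 0 := by
  refine even_of_Dl fun φ h he hc => ?_
  have : Dl 0 = cube 0 := by
    ext x; simp [Dl, cube, box]
  rw [this, hc]

theorem even_one : EvenThm 1 := by
  refine even_of_Dl fun φ h he hc => ?_
  have : Dl 1 = cube 1 := by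
    ext x; simp [Dl, cube, box]
  rw [this, hc]

theorem even_two : EvenThm 2 := by
  refine even_of_Dl fun φ h he hc => ?_
  refine even_of_sym le_rfl h he hc fun S hS hsub _ => ?_
  refine h S hS ⟨∑ i, pr i, ?_, 1, fun x hx => ?_⟩
  · intro h0
    have := congrArg (fun f => f (E1 0)) h0
    simp only [sum_pr_apply, E1_apply] at this
    simp at this
  · have := hsub hx
    rw [sum_pr_apply]
    simp only [Set.mem_ofPred_eq] at this
    norm_num at this ⊢
    linarith

theorem neg_seg {n : ℕ} (v : Rn n) : segment ℝ 0 v = -segment ℝ 0 v + {v} := by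
  ext x
  rw [mem_add_sing, Set.mem_neg, mem_seg0, mem_seg0]
  constructor
  · rintro ⟨s, h0, h1, rfl⟩
    exact ⟨1 - s, by linarith, by linarith, by rw [sub_smul]; simp⟩
  · rintro ⟨s, h0, h1, h⟩
    refine ⟨1 - s, by linarith, by linarith, ?_⟩
    rw [sub_smul, ← h]; simp

theorem even_seg {m : ℕ} (hE : EvenThm m) {φ : TIValuation (m+1)} (h : Simple φ)
    (he : ∀ K, IsConvexBody K → φ.val (-K) = φ.val K) (hc : φ.val (cube (m+1)) = 0) (v : Rn (m+1))
    (K) (hK : IsConvexBody K) : φ.val (K + segment ℝ 0 v) = φ.val K := by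
  refine seg_invariance h (fun F hF hFl => ?_) hK
  obtain ⟨ι, A, p, hA, rfl⟩ := flat_eq hF hFl
  have hs := body_segment 0 v
  obtain ⟨κ, hκ⟩ := seg_eq_image v
  rw [add_right_comm, val_add_singleton φ (body_add (body_image _ hA) hs)]
  refine hE (pull φ ι _ hs) ?_ ?_ ?_ A hA
  · intro B hB hBf
    rw [pull_val]
    refine h _ (body_add (body_image _ hB) hs) ?_
    rw [hκ]
    exact flat_add_image ι κ _ hBf le_rfl
  · intro B hB
    rw [pull_val, pull_val, ← he _ (body_add (body_image _ hB) hs), neg_image]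
    conv_lhs => rw [neg_seg v, ← add_assoc]
    rw [val_add_singleton φ (body_add (body_neg (body_image _ hB)) (body_neg hs)), neg_add]
  · rw [pull_val, hκ]
    obtain ⟨L, hL⟩ := exists_concat ι κ
    rw [hL]
    exact vanish_cube_image h hc L

theorem planar_odd {n : ℕ} {φ : TIValuation n}
    (hseg : ∀ v K, IsConvexBody K → φ.val (K + segment ℝ 0 v) = φ.val K)
    (ι : Rn 2 →L[ℝ] Rn n) (K : Set (Rn n)) (hK : IsConvexBody K) (L) (hL : IsConvexBody L) :
    (planar φ ι K hK).val L + (planar φ ι K hK).val (-L) = 0 := by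
  set η := planar φ ι K hK
  have h1 : Simple η := planar_simple hseg ι K hK
  have h2 : η.val (cube 2) = 0 := planar_cube hseg ι K hK
  have h3 := even_two (comb 1 1 0 η (lpull η (-ContinuousLinearMap.id ℝ (Rn 2)))) (h1.comb (h1.lpull _) 1 1)
    (fun K hK => by
      simp only [comb_val, lpull_val, ← neg_eq_image, neg_neg]; ring)
    (by 
      simp only [comb_val, lpull_val]
      rw [h2, vanish_cube_image h1 h2]; simp) L hL
  simpa [comb_val, lpull_val, ← neg_eq_image] using h3

theorem even_step {m : ℕ} (hm : 1 ≤ m) (hE : EvenThm m) : EvenThm (m+1) := by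
  refine even_of_Dl fun φ h he hc => ?_
  refine even_of_sym (by omega) h he hc fun S hS _ hsym => ?_
  obtain ⟨u, hu⟩ := hsym
  have hseg := even_seg hE h he hc
  have hD := minkowski_invariance φ (-1) (fun K hK L hL ι => by
    have hLL : IsConvexBody (L + -L) := body_add hL (body_neg hL)
    have h1 := planar_odd hseg ι K hK (L + -L) hLL
    have h2 : -(L + -L) = L + -L := by rw [neg_add, neg_neg, add_comm]
    rw [h2, ← two_mul] at h1
    have h3 := (mul_eq_zero.1 h1).resolve_left two_ne_zero
    rw [planar_val, Set.image_add, neg_image, sub_eq_zero] at h3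
    rw [← h3, add_comm K]; simp)
  set Z : Set (Rn (m+1)) := (1/2 : ℝ) • S with hZ
  have hZb : IsConvexBody Z := body_smul _ hS
  have h4 := hD {0} Z (body_singleton 0) hZb
  have h5 : S = {0} + (Z + (-1:ℝ) • Z) + {(1/2:ℝ) • u} := by
    have e1 : (-1:ℝ) • Z + {(1/2:ℝ) • u} = Z := by
      conv_rhs => rw [hZ, hu]
      rw [hZ, smul_add, Set.smul_set_singleton]; congr 1; simp
    rw [add_assoc, add_assoc, e1, hZ, ← hS.2.2.add_smul (by norm_num) (by norm_num)]
    norm_num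
  have hb : IsConvexBody ({0} + (Z + (-1:ℝ) • Z)) := body_add (body_singleton 0) (body_add hZb (body_smul _ hZb))
  rw [h5, val_add_singleton φ hb, h4]
  have : Flat ({0} : Set (Rn (m+1))) := ⟨pr 0, pr_ne 0, 0, by simp⟩
  exact h _ (body_singleton 0) this

theorem even_all (n : ℕ) : EvenThm n := by
  rcases Nat.eq_zero_or_pos n with rfl | hn
  · exact even_zero
  · induction n, hn using Nat.le_induction with
    | base => exact even_one
    | succ m hm ih => exact even_step hm ih

end KS

namespace KS

def Ord (n : ℕ) (r : ℝ) : Set (Rn n) := {x | (∀ i j, i ≤ j → x j ≤ x i) ∧ ∀ i, 0 ≤ x i ∧ x i ≤ r}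

theorem body_Ord (n : ℕ) {r : ℝ} (hr : 0 ≤ r) : IsConvexBody (Ord n r) := by
  refine ⟨⟨0, ?_, ?_⟩, ?_, ?_⟩
  · intro i j _; simp
  · intro i; simpa using hr
  · refine (body_box (n := n) (lo := fun _ => 0) (hi := fun _ => r) (fun _ => hr)).2.1.of_isClosed_subset ?_
      (fun x hx => hx.2)
    have : Ord n r = (⋂ i, ⋂ j, ⋂ (_ : i ≤ j), {x : Rn n | x j ≤ x i}) ∩ ⋂ i, ({x : Rn n | 0 ≤ x i} ∩ {x : Rn n | x i ≤ r}) := by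
      ext x; simp [Ord]
    rw [this]
    refine IsClosed.inter (isClosed_iInter fun i => isClosed_iInter fun j => isClosed_iInter fun _ => ?_)
      (isClosed_iInter fun i => ?_)
    · exact isClosed_le (pr j).continuous (pr i).continuous
    · exact (isClosed_le continuous_const (pr i).continuous).inter (isClosed_le (pr i).continuous continuous_const)
  · intro x hx y hy a b ha hb hab
    refine ⟨fun i j hij => ?_, fun i => ⟨?_, ?_⟩⟩
    · simp only [PiLp.add_apply, PiLp.smul_apply, smul_eq_mul]
      have := mul_le_mul_of_nonneg_left (hx.1 i j hij) ha
      have := mul_le_mul_of_nonneg_left (hy.1 i j hij) hb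
      linarith
    · simp only [PiLp.add_apply, PiLp.smul_apply, smul_eq_mul]
      have := mul_nonneg ha (hx.2 i).1
      have := mul_nonneg hb (hy.2 i).1
      linarith
    · simp only [PiLp.add_apply, PiLp.smul_apply, smul_eq_mul]
      have := mul_le_mul_of_nonneg_left (hx.2 i).2 ha
      have := mul_le_mul_of_nonneg_left (hy.2 i).2 hb
      have : a * r + b * r = r := by rw [← add_mul, hab, one_mul]
      linarith

theorem Ord_smul (n : ℕ) {r : ℝ} (hr : 0 ≤ r) : r • Ord n 1 = Ord n r := by
  ext x
  rw [Set.mem_smul_set]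
  constructor
  · rintro ⟨y, ⟨h1, h2⟩, rfl⟩
    refine ⟨fun i j hij => ?_, fun i => ⟨?_, ?_⟩⟩
    · simpa using mul_le_mul_of_nonneg_left (h1 i j hij) hr
    · simpa using mul_nonneg hr (h2 i).1
    · simpa using mul_le_mul_of_nonneg_left (h2 i).2 hr
  · rintro ⟨h1, h2⟩
    rcases hr.eq_or_lt with rfl | hr
    · refine ⟨0, ⟨fun i j _ => by simp, fun i => by simp⟩, ?_⟩
      ext i
      simpa using le_antisymm (h2 i).1 (h2 i).2
    · refine ⟨r⁻¹ • x, ⟨fun i j hij => ?_, fun i => ⟨?_, ?_⟩⟩, by rw [smul_smul, mul_inv_cancel₀ hr.ne', one_smul]⟩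
      · simpa using mul_le_mul_of_nonneg_left (h1 i j hij) (inv_nonneg.2 hr.le)
      · simpa using mul_nonneg (inv_nonneg.2 hr.le) (h2 i).1
      · have := mul_le_mul_of_nonneg_left (h2 i).2 (inv_nonneg.2 hr.le)
        rw [inv_mul_cancel₀ hr.ne'] at this
        simpa using this

noncomputable def xt {n : ℕ} (x : Rn n) (k : ℕ) : ℝ := if h : k < n then x ⟨k, h⟩ else 0

theorem xt_fin {n : ℕ} (x : Rn n) (i : Fin n) : xt x i = x i := by simp [xt]

theorem Dl_eq (n : ℕ) : ∃ N : Rn n →L[ℝ] Rn n, Dl n = N '' Ord n 1 := by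
  let N : Rn n →ₗ[ℝ] Rn n :=
    { toFun := fun y => WithLp.toLp 2 fun i : Fin n => xt y i - xt y (i + 1)
      map_add' := fun x y => by
        ext i
        simp only [xt, PiLp.add_apply]
        split_ifs <;> ring
      map_smul' := fun c y => by
        ext i
        simp only [xt, PiLp.smul_apply, smul_eq_mul, RingHom.id_apply]
        split_ifs <;> ring }
  refine ⟨LinearMap.toContinuousLinearMap N, ?_⟩
  have hNa : ∀ y i, N y i = xt y i - xt y (i + 1) := fun y i => rfl
  have hNs : ∀ y, ∑ i, N y i = xt y 0 := by
    intro y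
    simp only [hNa]
    rw [Fin.sum_univ_eq_sum_range (fun k => xt y k - xt y (k+1)), Finset.sum_range_sub']
    simp [xt]
  ext x
  constructor
  · rintro ⟨h0, h1⟩
    have hx0 : ∀ k, 0 ≤ xt x k := by
      intro k; rw [xt]; split_ifs with h
      · exact h0 _
      · exact le_rfl
    let y : Rn n := WithLp.toLp 2 fun i : Fin n => ∑ j ∈ Finset.Ico (i:ℕ) n, xt x j
    have hy : ∀ k, k ≤ n → xt y k = ∑ j ∈ Finset.Ico k n, xt x j := by
      intro k hk
      rw [xt]; split_ifs with h
      · rfl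
      · have : k = n := by omega
        simp [this]
    refine ⟨y, ⟨fun i j hij => ?_, fun i => ⟨?_, ?_⟩⟩, ?_⟩
    · change ∑ k ∈ Finset.Ico (j:ℕ) n, xt x k ≤ ∑ k ∈ Finset.Ico (i:ℕ) n, xt x k
      exact Finset.sum_le_sum_of_subset_of_nonneg (Finset.Ico_subset_Ico_left (Fin.le_def.1 hij)) (fun k _ _ => hx0 k)
    · change 0 ≤ ∑ k ∈ Finset.Ico (i:ℕ) n, xt x k
      exact Finset.sum_nonneg fun k _ => hx0 k
    · refine le_trans ?_ h1
      have e : ∑ i, x i = ∑ j ∈ Finset.Ico 0 n, xt x j := by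
        rw [← Finset.range_eq_Ico, ← Fin.sum_univ_eq_sum_range]
        simp only [xt_fin]
      rw [e]
      exact Finset.sum_le_sum_of_subset_of_nonneg (Finset.Ico_subset_Ico_left (Nat.zero_le _)) (fun k _ _ => hx0 k)
    · ext i
      change N y i = x i
      rw [hNa, hy _ i.2.le, hy _ i.2, Finset.sum_eq_sum_Ico_succ_bot i.2, xt_fin]
      ring
  · rintro ⟨y, ⟨h1, h2⟩, rfl⟩
    refine ⟨fun i => ?_, ?_⟩
    · change 0 ≤ N y i
      rw [hNa, xt_fin, xt]
      split_ifs with h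
      · exact sub_nonneg.2 (h1 _ _ (by simp [Fin.le_def]))
      · simpa using (h2 i).1
    · change ∑ i, N y i ≤ 1
      rw [hNs, xt]
      split_ifs
      · exact (h2 _).2
      · exact zero_le_one

theorem hull_eq' {n : ℕ} (p : Fin (n + 1) → Rn n) :
    ∃ M : Rn n →L[ℝ] Rn n, convexHull ℝ (Set.range p) = M '' Ord n 1 + {p 0} := by
  obtain ⟨M, hM⟩ := hull_eq p
  obtain ⟨N, hN⟩ := Dl_eq n
  refine ⟨M.comp N, ?_⟩
  rw [hM, hN, Set.image_image]; rfl

def ProdZero {n : ℕ} (ψ : TIValuation n) : Prop :=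
  ∀ k l, 1 ≤ k → 1 ≤ l → k + l = n → ∀ (ι : Rn k →L[ℝ] Rn n) (κ : Rn l →L[ℝ] Rn n) (A : Set (Rn k)) (B : Set (Rn l)),
    IsConvexBody A → IsConvexBody B → ψ.val (ι '' A + κ '' B) = 0

theorem ProdZero.lpull {n : ℕ} {ψ : TIValuation n} (h : ProdZero ψ) (M : Rn n →L[ℝ] Rn n) : ProdZero (lpull ψ M) := by
  intro k l hk hl hkl ι κ A B hA hB
  rw [lpull_val, Set.image_add, Set.image_image, Set.image_image]
  exact h k l hk hl hkl (M.comp ι) (M.comp κ) A B hA hB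

def RR (n : ℕ) (s t : ℝ) (k : ℕ) : Set (Rn n) := {x | x ∈ Ord n (s + t) ∧ ∀ i : Fin n, (i : ℕ) < k → s ≤ x i}

def PP (n : ℕ) (s t : ℝ) (k : ℕ) : Set (Rn n) := 
  {x | x ∈ Ord n (s + t) ∧ (∀ i : Fin n, (i : ℕ) < k → s ≤ x i) ∧ ∀ i : Fin n, k ≤ (i : ℕ) → x i ≤ s}

theorem RR_le {n : ℕ} (s t : ℝ) (k : Fin n) : RR n s t k ∩ {x | pr k x ≤ s} = PP n s t k := by
  ext x
  simp only [RR, PP, Set.mem_inter_iff, Set.mem_ofPred_eq, pr_apply]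
  constructor
  · rintro ⟨⟨h1, h2⟩, h3⟩
    exact ⟨h1, h2, fun i hi => (h1.1 k i hi).trans h3⟩
  · rintro ⟨h1, h2, h3⟩
    exact ⟨⟨h1, h2⟩, h3 k le_rfl⟩

theorem RR_ge {n : ℕ} (s t : ℝ) (k : Fin n) : RR n s t k ∩ {x | s ≤ pr k x} = RR n s t (k + 1) := by
  ext x
  simp only [RR, Set.mem_inter_iff, Set.mem_ofPred_eq, pr_apply]
  constructor
  · rintro ⟨⟨h1, h2⟩, h3⟩
    refine ⟨h1, fun i hi => ?_⟩
    rcases Nat.lt_succ_iff_lt_or_eq.1 hi with h | h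
    · exact h2 i h
    · rwa [Fin.ext h]
  · rintro ⟨h1, h2⟩
    exact ⟨⟨h1, fun i hi => h2 i (by omega)⟩, h2 k (by omega)⟩

theorem const_RR {n : ℕ} {s t : ℝ} (hs : 0 ≤ s) (ht : 0 ≤ t) (k : ℕ) :
    (WithLp.toLp 2 (fun _ => s) : Rn n) ∈ RR n s t k :=
  ⟨⟨fun i j _ => le_rfl, fun i => ⟨hs, by simpa using ht⟩⟩, fun i _ => le_rfl⟩

theorem const_PP {n : ℕ} {s t : ℝ} (hs : 0 ≤ s) (ht : 0 ≤ t) (k : ℕ) :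
    (WithLp.toLp 2 (fun _ => s) : Rn n) ∈ PP n s t k :=
  ⟨⟨fun i j _ => le_rfl, fun i => ⟨hs, by simpa using ht⟩⟩, fun i _ => le_rfl, fun i _ => le_rfl⟩

theorem RR_zero (n : ℕ) (s t : ℝ) : RR n s t 0 = Ord n (s + t) := by
  ext x; simp [RR]

theorem PP_zero (n : ℕ) {s t : ℝ} (ht : 0 ≤ t) : PP n s t 0 = Ord n s := by
  ext x
  simp only [PP, Ord, Set.mem_ofPred_eq]
  constructor
  · rintro ⟨⟨h1, h2⟩, -, h3⟩
    exact ⟨h1, fun i => ⟨(h2 i).1, h3 i (Nat.zero_le _)⟩⟩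
  · rintro ⟨h1, h2⟩
    exact ⟨⟨h1, fun i => ⟨(h2 i).1, by linarith [(h2 i).2]⟩⟩, fun i hi => absurd hi (Nat.not_lt_zero _), fun i _ => (h2 i).2⟩

theorem RR_last (n : ℕ) {s t : ℝ} (hs : 0 ≤ s) : RR n s t n = Ord n t + {WithLp.toLp 2 (fun _ => s)} := by
  ext x
  rw [mem_add_sing]
  simp only [RR, Ord, Set.mem_ofPred_eq, PiLp.sub_apply]
  constructor
  · rintro ⟨⟨h1, h2⟩, h3⟩
    exact ⟨fun i j hij => by linarith [h1 i j hij], fun i => ⟨by linarith [h3 i i.2], by linarith [(h2 i).2]⟩⟩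
  · rintro ⟨h1, h2⟩
    exact ⟨⟨fun i j hij => by linarith [h1 i j hij], fun i => ⟨by linarith [(h2 i).1], by linarith [(h2 i).2]⟩⟩,
      fun i _ => by linarith [(h2 i).1]⟩

theorem body_RR {n : ℕ} {s t : ℝ} (hs : 0 ≤ s) (ht : 0 ≤ t) (k : ℕ) (hk : k ≤ n) : IsConvexBody (RR n s t k) := by
  induction k with
  | zero => rw [RR_zero]; exact body_Ord n (add_nonneg hs ht)
  | succ k ih =>
    have := RR_ge s t (⟨k, hk⟩ : Fin n)
    simp only at this
    rw [← this]
    refine body_ge (ih (by omega)) _ _ ?_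
    rw [this]; exact ⟨_, const_RR hs ht _⟩

theorem PP_prod {k l : ℕ} {s t : ℝ} (hs : 0 ≤ s) (ht : 0 ≤ t) :
    ∃ (ι : Rn k →L[ℝ] Rn (k + l)) (κ : Rn l →L[ℝ] Rn (k + l)),
      PP (k + l) s t k = ι '' (Ord k t + {WithLp.toLp 2 (fun _ => s)}) + κ '' Ord l s := by
  let ι : Rn k →ₗ[ℝ] Rn (k + l) :=
    { toFun := fun x => WithLp.toLp 2 (Fin.append x 0)
      map_add' := fun x y => by
        ext i; refine Fin.addCases (fun j => ?_) (fun j => ?_) i <;> simp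
      map_smul' := fun c y => by
        ext i; refine Fin.addCases (fun j => ?_) (fun j => ?_) i <;> simp }
  let κ : Rn l →ₗ[ℝ] Rn (k + l) :=
    { toFun := fun x => WithLp.toLp 2 (Fin.append 0 x)
      map_add' := fun x y => by
        ext i; refine Fin.addCases (fun j => ?_) (fun j => ?_) i <;> simp
      map_smul' := fun c y => by
        ext i; refine Fin.addCases (fun j => ?_) (fun j => ?_) i <;> simp }
  refine ⟨LinearMap.toContinuousLinearMap ι, LinearMap.toContinuousLinearMap κ, ?_⟩
  have hadd : ∀ a b, ι a + κ b = WithLp.toLp 2 (Fin.append a b) := by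
    intro a b
    ext i; refine Fin.addCases (fun j => ?_) (fun j => ?_) i <;> simp [ι, κ]
  ext x
  constructor
  · rintro ⟨⟨h1, h2⟩, h3, h4⟩
    refine ⟨_, ⟨WithLp.toLp 2 fun i => x (Fin.castAdd l i), ?_, rfl⟩, _,
      ⟨WithLp.toLp 2 fun i => x (Fin.natAdd k i), ?_, rfl⟩, ?_⟩
    · rw [mem_add_sing]
      refine ⟨fun i j hij => ?_, fun i => ?_⟩
      · simpa using h1 (Fin.castAdd l i) (Fin.castAdd l j) (show (i:ℕ) ≤ j from hij)
      · have e1 := h3 (Fin.castAdd l i) (by simp)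
        have e2 := (h2 (Fin.castAdd l i)).2
        simp only [PiLp.sub_apply]
        constructor <;> linarith
    · refine ⟨fun i j hij => ?_, fun i => ?_⟩
      · exact h1 (Fin.natAdd k i) (Fin.natAdd k j) (show k + (i:ℕ) ≤ k + j from Nat.add_le_add_left hij k)
      · exact ⟨(h2 _).1, h4 _ (by simp)⟩
    · change ι _ + κ _ = x
      rw [hadd]
      ext i; refine Fin.addCases (fun j => ?_) (fun j => ?_) i <;> simp
  · rintro ⟨_, ⟨a, ha, rfl⟩, _, ⟨b, hb, rfl⟩, rfl⟩
    rw [mem_add_sing] at ha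
    have ha2 : ∀ i, s ≤ a i ∧ a i ≤ s + t := fun i => by
      have := ha.2 i
      simp only [PiLp.sub_apply] at this
      constructor <;> linarith [this.1, this.2]
    have ha1 : ∀ i j, i ≤ j → a j ≤ a i := fun i j hij => by
      have := ha.1 i j hij
      simp only [PiLp.sub_apply] at this
      linarith
    change ι a + κ b ∈ _
    rw [hadd]
    refine ⟨⟨fun i j => ?_, fun i => ?_⟩, fun i => ?_, fun i => ?_⟩
    · refine Fin.addCases (fun i' => ?_) (fun i' => ?_) i <;> 
        refine Fin.addCases (fun j' => ?_) (fun j' => ?_) j <;> intro hij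
      · simpa using ha1 i' j' (show (i':ℕ) ≤ j' from hij)
      · simpa using (hb.2 j').2.trans (ha2 i').1
      · simp [Fin.le_def] at hij; omega
      · simpa using hb.1 i' j' (Nat.le_of_add_le_add_left (show k + (i':ℕ) ≤ k + j' from hij))
    · refine Fin.addCases (fun i' => ?_) (fun i' => ?_) i
      · simpa using ⟨hs.trans (ha2 i').1, (ha2 i').2⟩
      · simpa using ⟨(hb.2 i').1, by linarith [(hb.2 i').2]⟩
    · refine Fin.addCases (fun i' => ?_) (fun i' => ?_) i
      · intro _; simpa using (ha2 i').1
      · intro h; simp at h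
    · refine Fin.addCases (fun i' => ?_) (fun i' => ?_) i
      · intro h; simp at h; omega
      · intro h; simpa using (hb.2 i').2

theorem PP_val {n : ℕ} {ψ : TIValuation n} (hP : ProdZero ψ) {s t : ℝ} (hs : 0 ≤ s) (ht : 0 ≤ t) {k : ℕ}
    (hk : 1 ≤ k) (hkn : k < n) : ψ.val (PP n s t k) = 0 := by
  obtain ⟨l, rfl⟩ := Nat.exists_eq_add_of_le hkn.le
  obtain ⟨ι, κ, h⟩ := PP_prod (k := k) (l := l) hs ht
  rw [h]
  exact hP k l hk (by omega) rfl ι κ _ _ (body_add (body_Ord k ht) (body_singleton _)) (body_Ord l hs)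

theorem Ord_add {n : ℕ} (hn : 1 ≤ n) {ψ : TIValuation n} (h : Simple ψ) (hP : ProdZero ψ) {s t : ℝ}
    (hs : 0 ≤ s) (ht : 0 ≤ t) : ψ.val (Ord n (s + t)) = ψ.val (Ord n s) + ψ.val (Ord n t) := by
  have step : ∀ k (hk : k < n), ψ.val (RR n s t k) = ψ.val (PP n s t k) + ψ.val (RR n s t (k+1)) := by
    intro k hk
    have h1 := RR_le s t (⟨k, hk⟩ : Fin n)
    have h2 := RR_ge s t (⟨k, hk⟩ : Fin n)
    simp only at h1 h2
    rw [val_cut h (body_RR hs ht k hk.le) (pr_ne (⟨k, hk⟩ : Fin n)) (c := s) (by rw [h1]; exact ⟨_, const_PP hs ht _⟩)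
      (by rw [h2]; exact ⟨_, const_RR hs ht _⟩), h1, h2]
  have key : ∀ k, 1 ≤ k → k ≤ n → ψ.val (Ord n (s + t)) = ψ.val (Ord n s) + ψ.val (RR n s t k) := by
    intro k hk
    induction k, hk using Nat.le_induction with
    | base => 
      intro _
      have := step 0 hn
      rwa [RR_zero, PP_zero n ht] at this
    | succ k hk ih =>
      intro hkn
      rw [ih (by omega), step k (by omega), PP_val hP hs ht hk (by omega), zero_add]
  rw [key n hn le_rfl, RR_last n hs, val_add_singleton ψ (body_Ord n ht)]

theorem Ord_lin {n : ℕ} (hn : 1 ≤ n) {ψ : TIValuation n} (h : Simple ψ) (hP : ProdZero ψ) {a : ℝ} (ha : 0 ≤ a) :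
    ψ.val (a • Ord n 1) = a * ψ.val (Ord n 1) := by
  have := additive_linear (fun s => ψ.val (s • Ord n 1)) (fun s t hs ht => by
    simp only [Ord_smul n hs, Ord_smul n ht, Ord_smul n (add_nonneg hs ht)]
    exact Ord_add hn h hP hs ht) (fun s hs u hu hlim => 
      ψ.continuity _ _ (fun i => body_smul _ (body_Ord n zero_le_one)) (body_smul _ (body_Ord n zero_le_one)) 
        (Conv.smul (body_Ord n zero_le_one) hlim)) a ha
  simpa using this

theorem image_smul' {m n : ℕ} (f : Rn m →L[ℝ] Rn n) (a : ℝ) (K : Set (Rn m)) : f '' (a • K) = a • (f '' K) := by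
  ext x
  simp only [Set.mem_image, Set.mem_smul_set]
  constructor
  · rintro ⟨_, ⟨y, hy, rfl⟩, rfl⟩; exact ⟨_, ⟨y, hy, rfl⟩, by simp⟩
  · rintro ⟨_, ⟨y, hy, rfl⟩, rfl⟩; exact ⟨_, ⟨y, hy, rfl⟩, by simp⟩

theorem deg_one {n : ℕ} (hn : 1 ≤ n) {ψ : TIValuation n} (h : Simple ψ) (hP : ProdZero ψ) {a : ℝ} (ha : 0 ≤ a)
    {K : Set (Rn n)} (hK : IsConvexBody K) : ψ.val (a • K) = a * ψ.val K := by
  have hs : Simple (comb 1 (-a) 0 (lpull ψ (a • ContinuousLinearMap.id ℝ (Rn n))) ψ) := (h.lpull _).comb h _ _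
  have := vanish_of_simplex hs (fun p => by
    obtain ⟨M, hM⟩ := hull_eq' p
    have hb := body_Ord n zero_le_one
    rw [comb_val, lpull_val, ← smul_eq_image, hM, smul_add, Set.smul_set_singleton,
      val_add_singleton ψ (body_smul _ (body_image M hb)),
      val_add_singleton ψ (body_image M hb), ← image_smul', ← lpull_val, ← lpull_val, 
      Ord_lin hn (h.lpull M) (hP.lpull M) ha]
    ring) hK
  rw [comb_val, lpull_val, ← smul_eq_image] at this
  linear_combination this

theorem prod_seg {m : ℕ} (hm : 1 ≤ m) {ψ : TIValuation (m+1)} (h : Simple ψ) (hP : ProdZero ψ) (v : Rn (m+1))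
    (K) (hK : IsConvexBody K) : ψ.val (K + segment ℝ 0 v) = ψ.val K := by
  refine seg_invariance h (fun F hF hFl => ?_) hK
  obtain ⟨ι, A, p, hA, rfl⟩ := flat_eq hF hFl
  obtain ⟨κ, hκ⟩ := seg_eq_image v
  rw [add_right_comm, val_add_singleton ψ (body_add (body_image _ hA) (body_segment 0 v)), hκ]
  exact hP m 1 hm le_rfl rfl ι κ A _ hA (body_cube 1)

end KS

namespace KS

theorem vol_neg {n : ℕ} (K : Set (Rn n)) : (vol n).val (-K) = (vol n).val K := by
  rw [vol_val, vol_val, Measure.measure_neg]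

theorem vol_smul {n : ℕ} {t : ℝ} (ht : 0 < t) (K : Set (Rn n)) : (vol n).val (t • K) = (t:ℂ) ^ n * (vol n).val K := by
  rw [vol_val, vol_val, Measure.addHaar_smul, ENNReal.toReal_mul, ENNReal.toReal_ofReal (abs_nonneg _),
    abs_of_nonneg (by positivity)]
  simp

theorem even_eq_vol {n : ℕ} {φ : TIValuation n} (h : Simple φ) (he : ∀ K, IsConvexBody K → φ.val (-K) = φ.val K) :
    ∃ c : ℂ, ∀ K, IsConvexBody K → φ.val K = c * (vol n).val K := by
  refine ⟨φ.val (cube n) / (vol n).val (cube n), fun K hK => ?_⟩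
  set c := φ.val (cube n) / (vol n).val (cube n) with hc
  have := even_all n (comb 1 (-c) 0 φ (vol n)) (h.comb (vol_simple n) _ _) (fun K hK => by
    rw [comb_val, comb_val, he K hK, vol_neg]) (by
    rw [comb_val, hc]
    field_simp [vol_cube_ne (n := n)]
    ring) K hK
  rw [comb_val] at this
  linear_combination this

theorem even_hom {n : ℕ} {φ : TIValuation n} (h : Simple φ) (he : ∀ K, IsConvexBody K → φ.val (-K) = φ.val K) 
    {t : ℝ} (ht : 0 < t) {K} (hK : IsConvexBody K) : φ.val (t • K) = (t:ℂ) ^ n * φ.val K := by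
  obtain ⟨c, hc⟩ := even_eq_vol h he
  rw [hc _ hK, hc _ (body_smul t hK), vol_smul ht]; ring

def OddThm (n : ℕ) : Prop := ∀ φ : TIValuation n, Simple φ →
  (∀ K, IsConvexBody K → φ.val (-K) = -φ.val K) →
  ∀ t : ℝ, 0 < t → ∀ K, IsConvexBody K → φ.val (t • K) = (t:ℂ) ^ (n - 1) * φ.val K

theorem odd_sym {n : ℕ} {φ : TIValuation n} (ho : ∀ K, IsConvexBody K → φ.val (-K) = -φ.val K) {K}
    (hK : IsConvexBody K) {u : Rn n} (hu : K = -K + {u}) : φ.val K = 0 := by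
  have h1 : φ.val K = -φ.val K := by
    conv_lhs => rw [hu, val_add_singleton φ (body_neg hK), ho K hK]
  have h2 : 2 * φ.val K = 0 := by linear_combination h1
  simpa using h2

theorem seg_sym {n : ℕ} (p q : Rn n) : ∃ u, segment ℝ p q = -segment ℝ p q + {u} := by
  refine ⟨p + q, ?_⟩
  rw [seg_trans, neg_add]
  conv_lhs => rw [neg_seg]
  rw [Set.neg_singleton, add_assoc, add_assoc, Set.singleton_add_singleton, Set.singleton_add_singleton]
  congr 2; abel

theorem odd_zero : OddThm 0 := by
  intro φ h ho t ht K hK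
  have h1 : K = -K + {0} := by
    obtain ⟨x, hx⟩ := hK.1
    ext y
    rw [mem_add_sing, Set.mem_neg, Subsingleton.elim (-(y - 0)) x, Subsingleton.elim y x]
  have hb := body_smul t hK
  have h2 : t • K = -(t • K) + {0} := by
    obtain ⟨x, hx⟩ := hb.1
    ext y
    rw [mem_add_sing, Set.mem_neg, Subsingleton.elim (-(y - 0)) x, Subsingleton.elim y x]
  rw [odd_sym ho hK h1, odd_sym ho hb h2, mul_zero]

theorem odd_one_zero {φ : TIValuation 1} (ho : ∀ K, IsConvexBody K → φ.val (-K) = -φ.val K) {K}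
    (hK : IsConvexBody K) : φ.val K = 0 := by
  obtain ⟨p, q, rfl⟩ := line_body hK
  obtain ⟨u, hu⟩ := seg_sym p q
  exact odd_sym ho hK hu

theorem odd_one : OddThm 1 := by
  intro φ h ho t ht K hK
  rw [odd_one_zero ho hK, odd_one_zero ho (body_smul t hK), mul_zero]

theorem odd_two : OddThm 2 := by
  intro φ h ho t ht K hK
  have hP : ProdZero φ := by
    intro k l hk hl hkl ι κ A B hA hB
    obtain rfl : k = 1 := by omega
    obtain rfl : l = 1 := by omega
    obtain ⟨p, q, rfl⟩ := line_body hA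
    obtain ⟨p', q', rfl⟩ := line_body hB
    rw [seg_image, seg_image]
    obtain ⟨u, hu⟩ := seg_sym (ι p) (ι q)
    obtain ⟨u', hu'⟩ := seg_sym (κ p') (κ q')
    refine odd_sym ho (body_add (body_segment _ _) (body_segment _ _)) (u := u + u') ?_
    conv_lhs => rw [hu, hu']
    rw [neg_add, ← Set.singleton_add_singleton]
    exact add_add_add_comm _ _ _ _
  rw [deg_one (by norm_num) h hP ht.le hK]
  norm_num

/-- homogeneity on products -/
theorem prod_hom {n k l : ℕ} (hk : 1 ≤ k) (hl : 1 ≤ l) (hkl : k + l = n) (hOk : OddThm k) (hOl : OddThm l)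
    {φ : TIValuation n} (h : Simple φ) (ho : ∀ K, IsConvexBody K → φ.val (-K) = -φ.val K)
    (ι : Rn k →L[ℝ] Rn n) (κ : Rn l →L[ℝ] Rn n) {A : Set (Rn k)} {B : Set (Rn l)}
    (hA : IsConvexBody A) (hB : IsConvexBody B) {t : ℝ} (ht : 0 < t) :
    φ.val (ι '' (t • A) + κ '' (t • B)) = (t:ℂ) ^ (n - 1) * φ.val (ι '' A + κ '' B) := by
  set g : Set (Rn k) → Set (Rn l) → ℂ := fun A B => φ.val (ι '' A + κ '' B) with hg
  have hodd : ∀ A B, IsConvexBody A → IsConvexBody B → g (-A) (-B) = -g A B := by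
    intro A B hA hB
    simp only [hg]
    rw [neg_image, neg_image, ← neg_add, ho _ (body_add (body_image _ hA) (body_image _ hB))]
  have hodd' : ∀ A B, IsConvexBody A → IsConvexBody B → g A (-B) = -g (-A) B := by
    intro A B hA hB
    have := hodd (-A) B (body_neg hA) hB
    rwa [neg_neg] at this
  -- the valuation in the first variable, with sign
  have hfst : ∀ (e : ℂ) B (hB : IsConvexBody B), ∃ χ : TIValuation k, Simple χ ∧
      ∀ A, χ.val A = g A B + e * g (-A) B := by
    intro e B hB
    let χ0 := pull φ ι (κ '' B) (body_image κ hB)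
    have hs : Simple χ0 := by
      intro A hA hF
      exact h _ (body_add (body_image _ hA) (body_image _ hB)) (flat_add_image ι κ B hF hkl.le)
    refine ⟨comb 1 e 0 χ0 (lpull χ0 (-ContinuousLinearMap.id ℝ (Rn k))), hs.comb (hs.lpull _) _ _, fun A => ?_⟩
    rw [comb_val, lpull_val, ← neg_eq_image]
    simp [χ0, hg]
  have hsnd : ∀ (e : ℂ) A (hA : IsConvexBody A), ∃ χ : TIValuation l, Simple χ ∧
      ∀ B, χ.val B = g A B + e * g (-A) B := by
    intro e A hA
    have hs : ∀ A (hA : IsConvexBody A), Simple (pull φ κ (ι '' A) (body_image ι hA)) := by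
      intro A hA B hB hF
      exact h _ (body_add (body_image _ hB) (body_image _ hA)) (flat_add_image κ ι A hF (by omega))
    refine ⟨comb 1 e 0 (pull φ κ (ι '' A) (body_image ι hA)) (pull φ κ (ι '' (-A)) (body_image ι (body_neg hA))),
      (hs _ hA).comb (hs _ (body_neg hA)) _ _, fun B => ?_⟩
    rw [comb_val, pull_val, pull_val, add_comm (κ '' B), add_comm (κ '' B)]
    simp [hg]
  -- even in A
  have h1 : g (t • A) (t • B) + g (-(t • A)) (t • B) = (t:ℂ) ^ (n - 1) * (g A B + g (-A) B) := by
    obtain ⟨χ, hχ, hv⟩ := hfst 1 (t • B) (body_smul t hB)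
    obtain ⟨ξ, hξ, hw⟩ := hsnd 1 A hA
    have e1 := even_hom hχ (fun K hK => by rw [hv, hv, neg_neg]; ring) ht hA
    have e2 := hOl ξ hξ (fun K hK => by
      rw [hw, hw, hodd' _ _ hA hK, hodd _ _ hA hK]; ring) t ht B hB
    rw [hv, hv] at e1
    rw [hw, hw] at e2
    simp only [one_mul] at e1 e2
    rw [e1, e2, ← mul_assoc, ← pow_add]
    congr 2; omega
  have h2 : g (t • A) (t • B) - g (-(t • A)) (t • B) = (t:ℂ) ^ (n - 1) * (g A B - g (-A) B) := by
    obtain ⟨χ, hχ, hv⟩ := hfst (-1) (t • B) (body_smul t hB)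
    obtain ⟨ξ, hξ, hw⟩ := hsnd (-1) A hA
    have e1 := hOk χ hχ (fun K hK => by rw [hv, hv, neg_neg]; ring) t ht A hA
    have e2 := even_hom hξ (fun K hK => by
      rw [hw, hw, hodd' _ _ hA hK, hodd _ _ hA hK]; ring) ht hB
    rw [hv, hv] at e1
    rw [hw, hw] at e2
    simp only [neg_one_mul, ← sub_eq_add_neg] at e1 e2
    rw [e1, e2, ← mul_assoc, ← pow_add]
    congr 2; omega
  have : g (t • A) (t • B) = (t:ℂ) ^ (n - 1) * g A B := by linear_combination (h1 + h2) / 2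
  exact this

/-- A simple valuation vanishing on products vanishes, for `n ≥ 3`. -/
theorem vanish_of_prod {m : ℕ} (hm : 2 ≤ m) {ψ : TIValuation (m+1)} (h : Simple ψ) (hP : ProdZero ψ) {K}
    (hK : IsConvexBody K) : ψ.val K = 0 := by
  have hseg := prod_seg (by omega) h hP
  have hpl : ∀ (ι : Rn 2 →L[ℝ] Rn (m+1)) (K) (hK : IsConvexBody K) (L) (hL : IsConvexBody L),
      ψ.val (ι '' L + K) = ψ.val K := by
    intro ι K hK L hL
    have hη : ∀ t : ℝ, 0 < t → (planar ψ ι K hK).val (t • L) = t * (planar ψ ι K hK).val L := by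
      intro t ht
      have := odd_two (planar ψ ι K hK) (planar_simple hseg ι K hK) (fun L hL => by
        have := planar_odd hseg ι K hK L hL
        linear_combination this) t ht L hL
      simpa using this
    have hη2 : ∀ t : ℝ, 0 < t → ψ.val (ι '' L + K) - ψ.val K = ψ.val (ι '' L + t⁻¹ • K) - (t⁻¹ : ℝ) * ψ.val K := by
      intro t ht
      have h1 := hη t ht
      rw [planar_val, planar_val] at h1
      have h2 : ι '' (t • L) + K = t • (ι '' L + t⁻¹ • K) := by
        rw [image_smul', smul_add, smul_smul, mul_inv_cancel₀ ht.ne', one_smul]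
      rw [h2, deg_one (by omega) h hP ht.le (body_add (body_image _ hL) (body_smul _ hK))] at h1
      have ht' : (t:ℂ) ≠ 0 := by exact_mod_cast ht.ne'
      have h3 : (t:ℂ) * (ψ.val (ι '' L + K) - ψ.val K) = t * (ψ.val (ι '' L + t⁻¹ • K) - (t⁻¹ : ℝ) * ψ.val K) := by
        rw [← h1, mul_sub, ← mul_assoc]
        push_cast
        rw [mul_inv_cancel₀ ht', one_mul]
      exact mul_left_cancel₀ ht' h3
    have hlim : Tendsto (fun i : ℕ => (((i:ℝ) + 1)⁻¹)) atTop (𝓝 0) := by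
      simpa [one_div] using tendsto_one_div_add_atTop_nhds_zero_nat (𝕜 := ℝ)
    have h0b : IsConvexBody ((0:ℝ) • K) := body_smul _ hK
    have hc := ψ.continuity (fun i : ℕ => ι '' L + ((i:ℝ) + 1)⁻¹ • K) (ι '' L + (0:ℝ) • K)
      (fun i => body_add (body_image _ hL) (body_smul _ hK)) (body_add (body_image _ hL) h0b)
      (Conv.add_left _ (fun i => body_smul _ hK) h0b (Conv.smul hK hlim))
    have hz : ψ.val (ι '' L + (0:ℝ) • K) = 0 := by
      rw [Set.zero_smul_set hK.1, add_zero]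
      exact h _ (body_image _ hL) (flat_image_of_lt ι L (by omega))
    rw [hz] at hc
    have hlim' : Tendsto (fun i : ℕ => ((((i:ℝ) + 1)⁻¹ : ℝ) : ℂ) * ψ.val K) atTop (𝓝 (((0:ℝ):ℂ) * ψ.val K)) :=
      ((Complex.continuous_ofReal.tendsto 0).comp hlim).mul_const _
    have h5 := hc.sub hlim'
    have h6 : (fun i : ℕ => ψ.val (ι '' L + ((i:ℝ) + 1)⁻¹ • K) - ((((i:ℝ) + 1)⁻¹ : ℝ) : ℂ) * ψ.val K) = 
        fun _ => ψ.val (ι '' L + K) - ψ.val K := by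
      funext i
      exact (hη2 _ (by positivity)).symm
    rw [h6] at h5
    have h7 := tendsto_nhds_unique h5 tendsto_const_nhds
    simp only [Complex.ofReal_zero, zero_mul, sub_zero] at h7
    exact sub_eq_zero.1 h7.symm
  have hD := minkowski_invariance ψ 0 (fun K hK L hL ι => by
    rw [Set.zero_smul_set (hL.1.image _), add_zero, add_comm K]
    exact hpl ι K hK L hL) {0} K (body_singleton 0) hK
  rw [Set.zero_smul_set hK.1, add_zero] at hD
  have e : ({0} : Set (Rn (m+1))) + K = K := by simp
  rw [e] at hD
  rw [hD]
  exact h _ (body_singleton 0) ⟨pr 0, pr_ne 0, 0, by simp⟩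

theorem odd_all (n : ℕ) : OddThm n := by
  induction n using Nat.strong_induction_on with
  | _ n ih =>
    match n, ih with
    | 0, _ => exact odd_zero
    | 1, _ => exact odd_one
    | 2, _ => exact odd_two
    | m + 3, ih =>
      intro φ h ho t ht K hK
      let ψ := comb 1 (-(t:ℂ) ^ (m + 3 - 1)) 0 (lpull φ (t • ContinuousLinearMap.id ℝ (Rn (m+3)))) φ
      have hψ : ∀ K, ψ.val K = φ.val (t • K) - (t:ℂ) ^ (m + 3 - 1) * φ.val K := by
        intro K
        simp only [ψ, comb_val, lpull_val, ← smul_eq_image]; ring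
      have hs : Simple ψ := (h.lpull _).comb h _ _
      have hP : ProdZero ψ := by
        intro k l hk hl hkl ι κ A B hA hB
        rw [hψ, smul_add, ← image_smul', ← image_smul', 
          prod_hom hk hl hkl (ih k (by omega)) (ih l (by omega)) h ho ι κ hA hB ht, sub_self]
      have := vanish_of_prod (m := m + 2) (by omega) hs hP hK
      rw [hψ, sub_eq_zero] at this
      exact this

theorem main (n : ℕ) (φ : TIValuation n)
    (hsimple : ∀ K : Set (Rn n), IsConvexBody K → interior K = ∅ → φ.val K = 0) :
    (∃ c : ℂ, ∀ K : Set (Rn n), IsConvexBody K →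
      φ.val K + φ.val (-K) = 2 * c * ((MeasureTheory.volume K).toReal : ℂ)) ∧
    (∀ t : ℝ, 0 < t → ∀ K : Set (Rn n), IsConvexBody K →
      (φ.val (t • K) - φ.val (-(t • K))) / 2
        = (t : ℂ) ^ (n - 1) * ((φ.val K - φ.val (-K)) / 2)) := by
  have h : Simple φ := fun K hK hF => hsimple K hK ((flat_iff hK).2 hF)
  have hv : ∀ (e : ℂ) K, (comb (1/2) e 0 φ (lpull φ (-ContinuousLinearMap.id ℝ (Rn n)))).val K 
      = 1 / 2 * φ.val K + e * φ.val (-K) := by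
    intro e K
    rw [comb_val, lpull_val, ← neg_eq_image, add_zero]
  have hs : ∀ e : ℂ, Simple (comb (1/2) e 0 φ (lpull φ (-ContinuousLinearMap.id ℝ (Rn n)))) :=
    fun e => h.comb (h.lpull _) _ _
  constructor
  · obtain ⟨c, hc⟩ := even_eq_vol (hs (1/2)) (fun K hK => by rw [hv, hv, neg_neg]; ring)
    refine ⟨c, fun K hK => ?_⟩
    have := hc K hK
    rw [hv, vol_val] at this
    linear_combination 2 * this
  · intro t ht K hK
    have := odd_all n _ (hs (-1/2)) (fun K hK => by rw [hv, hv, neg_neg]; ring) t ht K hK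
    rw [hv, hv] at this
    linear_combination this

end KS

/-- Klain–Schneider: for a simple translation invariant continuous valuation φ on ℝⁿ, the even
part of φ is a multiple of the Lebesgue measure and the odd part of φ is homogeneous of
degree n−1. -/
theorem simple_valuation_structure (n : ℕ) (φ : TIValuation n)
    (hsimple : ∀ K : Set (Rn n), IsConvexBody K → interior K = ∅ → φ.val K = 0) :
    (∃ c : ℂ, ∀ K : Set (Rn n), IsConvexBody K →
      φ.val K + φ.val (-K) = 2 * c * ((MeasureTheory.volume K).toReal : ℂ)) ∧
    (∀ t : ℝ, 0 < t → ∀ K : Set (Rn n), IsConvexBody K →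
      (φ.val (t • K) - φ.val (-(t • K))) / 2
        = (t : ℂ) ^ (n - 1) * ((φ.val K - φ.val (-K)) / 2)) :=
  KS.main n φ hsimple
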